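/- arXiv:1404.5892 — 2 statements merged into one kernel-verified Lean document; each statement's English description precedes it below -/
import Mathlib

section
/- For every simple graph G and every integer h ≥ 1: G admits a planar straight-line drawing in which every vertex has an integer y-coordinate in {1,…,h} if and only if G admits a planar flat visibility representation of height h. -/
open Set

noncomputable section

/-- Points of the plane. -/
abbrev Pt : Type := ℝ × ℝ

/-- The image (set of points) of a polygonal chain given by its list of breakpoints. -/
def chainSet : List Pt → Set Pt
  | [] => ∅
  | [p] => {p}
  | p :: q :: rest => segment ℝ p q ∪ chainSet (q :: rest)

/-- The bends (interior junction points) of a polygonal chain. -/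
def chainBends (l : List Pt) : List Pt := (l.drop 1).dropLast

/-- `S` is the image of a simple (injective) curve from `a` to `b`. -/
def IsSimpleArc (S : Set Pt) (a b : Pt) : Prop :=
  ∃ γ : ℝ → Pt, ContinuousOn γ (Icc (0:ℝ) 1) ∧ InjOn γ (Icc (0:ℝ) 1) ∧
    γ '' Icc (0:ℝ) 1 = S ∧ γ 0 = a ∧ γ 1 = b

/-- A poly-line drawing of a simple graph `G`: an injective placement of the vertices
together with, for each edge, a simple polygonal arc joining the endpoints. -/
structure PolyDrawing {V : Type} (G : SimpleGraph V) where
  pos : V → Pt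
  pos_inj : Function.Injective pos
  arc : Sym2 V → List Pt
  arc_ends : ∀ u v : V, G.Adj u v →
    ((arc s(u, v)).head? = some (pos u) ∧ (arc s(u, v)).getLast? = some (pos v)) ∨
    ((arc s(u, v)).head? = some (pos v) ∧ (arc s(u, v)).getLast? = some (pos u))
  arc_simple : ∀ u v : V, G.Adj u v →
    IsSimpleArc (chainSet (arc s(u, v))) (pos u) (pos v)

namespace PolyDrawing

variable {V : Type} {G : SimpleGraph V}

/-- The set of points used by the arc of an edge. -/
def edgePts (Γ : PolyDrawing G) (e : Sym2 V) : Set Pt := chainSet (Γ.arc e)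

/-- Planarity: no vertex point lies on the arc of a non-incident edge, and arcs of
distinct edges meet only in images of common endpoints. -/
def IsPlanar (Γ : PolyDrawing G) : Prop :=
  (∀ v : V, ∀ e ∈ G.edgeSet, v ∉ e → Γ.pos v ∉ Γ.edgePts e) ∧
  (∀ e ∈ G.edgeSet, ∀ f ∈ G.edgeSet, e ≠ f →
    ∀ p ∈ Γ.edgePts e ∩ Γ.edgePts f, ∃ w : V, w ∈ e ∧ w ∈ f ∧ p = Γ.pos w)

/-- `y`-monotone: along every edge arc the `y`-coordinate varies weakly monotonically. -/
def IsYMonotone (Γ : PolyDrawing G) : Prop :=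
  ∀ e ∈ G.edgeSet,
    List.Chain' (· ≤ ·) ((Γ.arc e).map Prod.snd) ∨
    List.Chain' (· ≥ ·) ((Γ.arc e).map Prod.snd)

/-- The drawing has height `h`: every vertex and every bend has an integer
`y`-coordinate in `{1, …, h}`. -/
def HasHeight (Γ : PolyDrawing G) (h : ℕ) : Prop :=
  (∀ v : V, ∃ k : ℤ, 1 ≤ k ∧ k ≤ (h : ℤ) ∧ (Γ.pos v).2 = (k : ℝ)) ∧
  (∀ e ∈ G.edgeSet, ∀ p ∈ chainBends (Γ.arc e), ∃ k : ℤ, 1 ≤ k ∧ k ≤ (h : ℤ) ∧ p.2 = (k : ℝ))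

/-- All vertices and bends have integer `y`-coordinates. -/
def IntegerY (Γ : PolyDrawing G) : Prop :=
  (∀ v : V, ∃ k : ℤ, (Γ.pos v).2 = (k : ℝ)) ∧
  (∀ e ∈ G.edgeSet, ∀ p ∈ chainBends (Γ.arc e), ∃ k : ℤ, p.2 = (k : ℝ))

/-- The set of all points of the drawing (vertex points and edge arcs). -/
def image (Γ : PolyDrawing G) : Set Pt :=
  Set.range Γ.pos ∪ ⋃ e ∈ G.edgeSet, Γ.edgePts e

/-- The union of the unbounded connected components of the complement of the drawing. -/
def outerRegion (Γ : PolyDrawing G) : Set Pt :=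
  {p | p ∉ Γ.image ∧ ¬ Bornology.IsBounded (connectedComponentIn Γ.imageᶜ p)}

/-- A vertex is inner if its point does not lie on the boundary of the unbounded
connected component of the complement of the drawing. -/
def IsInner (Γ : PolyDrawing G) (v : V) : Prop :=
  Γ.pos v ∉ frontier Γ.outerRegion

/-- Number of incoming edges at `v` (edges whose other endpoint is weakly below `v`;
horizontal edges count as incoming). -/
def indeg (Γ : PolyDrawing G) (v : V) : ℕ :=
  {w : V | G.Adj v w ∧ (Γ.pos w).2 ≤ (Γ.pos v).2}.ncard

/-- Number of outgoing edges at `v` (edges whose other endpoint is weakly above `v`;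
horizontal edges count as outgoing). -/
def outdeg (Γ : PolyDrawing G) (v : V) : ℕ :=
  {w : V | G.Adj v w ∧ (Γ.pos v).2 ≤ (Γ.pos w).2}.ncard

/-- The set of points drawn for an element (vertex or edge) of the graph. -/
def drawSet (Γ : PolyDrawing G) : V ⊕ ↥G.edgeSet → Set Pt
  | Sum.inl v => {Γ.pos v}
  | Sum.inr e => Γ.edgePts e

end PolyDrawing

/-- A straight-line drawing of a simple graph: an injective placement of the vertices;
each edge is drawn as the closed segment between its endpoints. -/
structure StraightDrawing {V : Type} (G : SimpleGraph V) where
  pos : V → Pt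
  pos_inj : Function.Injective pos

namespace StraightDrawing

variable {V : Type} {G : SimpleGraph V}

/-- The closed segment representing an edge. -/
def edgePts (Γ : StraightDrawing G) (e : Sym2 V) : Set Pt :=
  Sym2.lift ⟨fun u v => segment ℝ (Γ.pos u) (Γ.pos v),
    fun u v => segment_symm (𝕜 := ℝ) (Γ.pos u) (Γ.pos v)⟩ e

/-- Planarity of a straight-line drawing. -/
def IsPlanar (Γ : StraightDrawing G) : Prop :=
  (∀ v : V, ∀ e ∈ G.edgeSet, v ∉ e → Γ.pos v ∉ Γ.edgePts e) ∧
  (∀ e ∈ G.edgeSet, ∀ f ∈ G.edgeSet, e ≠ f →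
    ∀ p ∈ Γ.edgePts e ∩ Γ.edgePts f, ∃ w : V, w ∈ e ∧ w ∈ f ∧ p = Γ.pos w)

/-- Every vertex has an integer `y`-coordinate in `{1, …, h}`. -/
def HeightLe (Γ : StraightDrawing G) (h : ℕ) : Prop :=
  ∀ v : V, ∃ k : ℤ, 1 ≤ k ∧ k ≤ (h : ℤ) ∧ (Γ.pos v).2 = (k : ℝ)

/-- All vertices lie on integer grid points. -/
def IsGrid (Γ : StraightDrawing G) : Prop :=
  ∀ v : V, ∃ p : ℤ × ℤ, Γ.pos v = ((p.1 : ℝ), (p.2 : ℝ))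

/-- The set of points drawn for an element (vertex or edge) of the graph. -/
def drawSet (Γ : StraightDrawing G) : V ⊕ ↥G.edgeSet → Set Pt
  | Sum.inl v => {Γ.pos v}
  | Sum.inr e => Γ.edgePts e

end StraightDrawing

/-- The intersection of a set of points with the horizontal line `y = r`,
recorded as a set of `x`-coordinates. -/
def rowSlice (S : Set Pt) (r : ℝ) : Set ℝ := {x : ℝ | (x, r) ∈ S}

/-- Two drawings (given by the sets drawn for each vertex/edge element) have the same
left-to-right order in each row: for every integer row `r` and elements `a`, `b` both
meeting row `r` in both drawings, the drawing of `a` lies entirely strictly to the left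
of that of `b` in one drawing iff it does in the other. -/
def SameRowOrder {α : Type} (D D' : α → Set Pt) : Prop :=
  ∀ r : ℤ, ∀ a b : α,
    (rowSlice (D a) (r : ℝ)).Nonempty → (rowSlice (D b) (r : ℝ)).Nonempty →
    (rowSlice (D' a) (r : ℝ)).Nonempty → (rowSlice (D' b) (r : ℝ)).Nonempty →
    ((∀ x ∈ rowSlice (D a) (r : ℝ), ∀ y ∈ rowSlice (D b) (r : ℝ), x < y) ↔
     (∀ x ∈ rowSlice (D' a) (r : ℝ), ∀ y ∈ rowSlice (D' b) (r : ℝ), x < y))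

/-- A simple graph on `n ≥ 3` vertices is triangulated (maximal planar) if it admits a
planar poly-line drawing and has exactly `3n - 6` edges. -/
def IsTriangulated {V : Type} [Fintype V] (G : SimpleGraph V) : Prop :=
  3 ≤ Fintype.card V ∧ G.edgeSet.ncard = 3 * Fintype.card V - 6 ∧
  ∃ Γ : PolyDrawing G, Γ.IsPlanar

/-- Data of a flat visibility representation: a horizontal segment for every vertex
(given by its `y`-coordinate and left/right `x`-coordinates) and a segment (given by
its two endpoints) for every edge. -/
structure VisData (V : Type) where
  ly : V → ℝ
  lx : V → ℝ
  rx : V → ℝ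
  ep1 : Sym2 V → Pt
  ep2 : Sym2 V → Pt

/-- The horizontal segment of a vertex. -/
def VisData.vseg {V : Type} (D : VisData V) (v : V) : Set Pt :=
  segment ℝ (D.lx v, D.ly v) (D.rx v, D.ly v)

/-- The segment of an edge. -/
def VisData.eseg {V : Type} (D : VisData V) (e : Sym2 V) : Set Pt :=
  segment ℝ (D.ep1 e) (D.ep2 e)

/-- `D` is a planar flat visibility representation of `G` of height `h`. -/
def IsFlatVisRep {V : Type} (G : SimpleGraph V) (D : VisData V) (h : ℕ) : Prop :=
  (∀ v : V, D.lx v ≤ D.rx v) ∧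
  (∀ v : V, ∃ k : ℤ, 1 ≤ k ∧ k ≤ (h : ℤ) ∧ D.ly v = (k : ℝ)) ∧
  (∀ e ∈ G.edgeSet, (D.ep1 e).1 = (D.ep2 e).1 ∨ (D.ep1 e).2 = (D.ep2 e).2) ∧
  (∀ e ∈ G.edgeSet, ∀ p ∈ D.eseg e, 1 ≤ p.2 ∧ p.2 ≤ (h : ℝ)) ∧
  (∀ u v : V, G.Adj u v →
    (D.ep1 s(u, v) ∈ D.vseg u ∧ D.ep2 s(u, v) ∈ D.vseg v) ∨
    (D.ep1 s(u, v) ∈ D.vseg v ∧ D.ep2 s(u, v) ∈ D.vseg u)) ∧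
  (∀ u v : V, u ≠ v → Disjoint (D.vseg u) (D.vseg v)) ∧
  (∀ e ∈ G.edgeSet, ∀ w : V, ∀ p ∈ D.eseg e ∩ D.vseg w, p = D.ep1 e ∨ p = D.ep2 e) ∧
  (∀ e ∈ G.edgeSet, ∀ f ∈ G.edgeSet, e ≠ f → ∀ p ∈ D.eseg e ∩ D.eseg f,
    (p = D.ep1 e ∨ p = D.ep2 e) ∧ (p = D.ep1 f ∨ p = D.ep2 f))

end

noncomputable section

/-- A visibility representation on the integer grid, recorded by the rows and horizontal extents of
its vertices and by the columns of its vertical edges. -/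
structure RowVis (V E : Type) where
  y : V → ℤ
  l : V → ℤ
  r : V → ℤ
  x : E → ℤ
  lo : E → V
  hi : E → V
  h : ℤ
  one_le : ∀ v, 1 ≤ y v
  le_h : ∀ v, y v ≤ h
  l_le_r : ∀ v, l v ≤ r v
  lo_lt_hi : ∀ e, y (lo e) < y (hi e)
  disj : ∀ v w, v ≠ w → y v = y w → r v < l w ∨ r w < l v
  mem_lo : ∀ e, l (lo e) ≤ x e ∧ x e ≤ r (lo e)
  mem_hi : ∀ e, l (hi e) ≤ x e ∧ x e ≤ r (hi e)
  avoid : ∀ e v, y (lo e) < y v → y v < y (hi e) → x e < l v ∨ r v < x e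
  sep : ∀ e f, e ≠ f → x e = x f → y (hi e) ≤ y (lo f) ∨ y (hi f) ≤ y (lo e)
  simple : ∀ e f, lo e = lo f → hi e = hi f → e = f

namespace RowVis

variable {V E : Type} (K : RowVis V E)

/-- The edge `e` passes through row `r` strictly between its end-vertices. -/
def Crosses (e : E) (r : ℤ) : Prop := K.y (K.lo e) < r ∧ r < K.y (K.hi e)

/-- No vertex of row `r` extends over the unit interval just left of column `j`. -/
def Free (j r : ℤ) : Prop := ∀ v, K.y v = r → K.r v < j ∨ j ≤ K.l v

/-- A moment function: constant along each row except at crossing edges, convex along columns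
where no vertex obstructs, and vanishing outside a bounded region. -/
structure IsMoment (m M : ℤ) (S : ℤ → ℤ → ℝ) : Prop where
  step : ∀ j r, (∀ e, K.x e = j → ¬ K.Crosses e r) → S (j + 1) r = S j r
  convex : ∀ j r, K.Free j r → 2 * S j r ≤ S j (r + 1) + S j (r - 1)
  zero : ∀ j r, (j ≤ m ∨ M ≤ j ∨ r ≤ 1 ∨ K.h ≤ r) → S j r = 0

variable {K}

theorem Crosses.free {e : E} {r : ℤ} (h : K.Crosses e r) : K.Free (K.x e) r := by
  rintro v rfl
  have := K.avoid e v h.1 h.2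
  omega

theorem Crosses.free_succ {e : E} {r : ℤ} (h : K.Crosses e r) : K.Free (K.x e + 1) r := by
  rintro v rfl
  have := K.avoid e v h.1 h.2
  omega

theorem not_crosses_of_mem {e : E} {v : V} (h₁ : K.l v ≤ K.x e) (h₂ : K.x e ≤ K.r v) :
    ¬ K.Crosses e (K.y v) := by
  intro h
  have := K.avoid e v h.1 h.2
  omega

theorem eq_of_mem {v w : V} {j : ℤ} (hy : K.y v = K.y w) (h₁ : K.l v ≤ j) (h₂ : j ≤ K.r v)
    (h₃ : K.l w ≤ j) (h₄ : j ≤ K.r w) : v = w := by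
  by_contra hne
  have := K.disj v w hne hy
  omega

theorem free_l (v : V) : K.Free (K.l v) (K.y v) := by
  intro w hw
  by_contra hc
  have := K.l_le_r v
  have : w = v := eq_of_mem (j := K.l v) hw (by omega) (by omega) (by omega) (by omega)
  subst this
  omega

theorem free_r (v : V) : K.Free (K.r v + 1) (K.y v) := by
  intro w hw
  by_contra hc
  have := K.l_le_r v
  have : w = v := eq_of_mem (j := K.r v) hw (by omega) (by omega) (by omega) (by omega)
  subst this
  omega

namespace IsMoment

variable {m M : ℤ} {S : ℤ → ℤ → ℝ} (hS : K.IsMoment m M S)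
include hS

theorem eq_on_vertex (v : V) : ∀ i, K.l v ≤ i → i ≤ K.r v + 1 → S i (K.y v) = S (K.l v) (K.y v) := by
  intro i hi
  induction i, hi using Int.leInduction with
  | base => intro _; rfl
  | succ n hn ih =>
    intro h
    rw [← ih (by omega)]
    apply hS.step
    rintro e rfl
    exact not_crosses_of_mem hn (by omega)

theorem eq_lo (e : E) : S (K.x e + 1) (K.y (K.lo e)) = S (K.x e) (K.y (K.lo e)) := by
  apply hS.step
  intro f hf
  apply not_crosses_of_mem <;> rw [hf]
  exacts [(K.mem_lo e).1, (K.mem_lo e).2]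

theorem eq_hi (e : E) : S (K.x e + 1) (K.y (K.hi e)) = S (K.x e) (K.y (K.hi e)) := by
  apply hS.step
  intro f hf
  apply not_crosses_of_mem <;> rw [hf]
  exacts [(K.mem_hi e).1, (K.mem_hi e).2]

theorem exists_free (j r : ℤ) : ∃ i, K.Free i r ∧ S i r = S j r := by
  by_cases h : K.Free j r
  · exact ⟨j, h, rfl⟩
  · simp only [Free, not_forall] at h
    obtain ⟨v, rfl, h⟩ := h
    exact ⟨K.l v, free_l v, (hS.eq_on_vertex v j (by omega) (by omega)).symm⟩

theorem nonpos (j r : ℤ) : S j r ≤ 0 := by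
  by_contra hpos
  push Not at hpos
  have hbox : ∀ j r, S j r ≠ 0 → (j, r) ∈ Finset.Icc m M ×ˢ Finset.Icc 1 K.h := by
    intro j r hne
    have := mt (hS.zero j r) hne
    simp only [Finset.mem_product, Finset.mem_Icc]
    omega
  obtain ⟨⟨a, b⟩, -, hmax⟩ := Finset.exists_max_image (Finset.Icc m M ×ˢ Finset.Icc 1 K.h)
    (fun p => S p.1 p.2) ⟨_, hbox j r hpos.ne'⟩
  have hab : 0 < S a b := hpos.trans_le (hmax _ (hbox j r hpos.ne'))
  have hle : ∀ i q, S i q ≤ S a b := by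
    intro i q
    by_cases h0 : S i q = 0
    · rw [h0]; exact hab.le
    · exact hmax _ (hbox i q h0)
  have hup : ∀ n : ℕ, ∃ i, S i (b + n) = S a b := by
    intro n
    induction n with
    | zero => exact ⟨a, by simp⟩
    | succ n ih =>
      obtain ⟨i, hi⟩ := ih
      obtain ⟨i', hf, hi'⟩ := hS.exists_free i (b + n)
      refine ⟨i', ?_⟩
      have h1 := hS.convex _ _ hf
      have h2 := hle i' (b + n - 1)
      have h3 := hle i' (b + n + 1)
      push_cast
      rw [← add_assoc]
      linarith
  obtain ⟨i, hi⟩ := hup (K.h - b).toNat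
  rw [hS.zero i _ (by right; right; right; omega)] at hi
  linarith

section Slope

variable (hU : ∀ j r, S j (r + 1) - S j r ≤ 1)
include hU

theorem neg_h_le (j r : ℤ) : -(|K.h| : ℝ) ≤ S j r := by
  by_cases hr : r ≤ 1 ∨ K.h ≤ r
  · rw [hS.zero j r (by tauto)]
    have := abs_nonneg K.h
    have : (0 : ℝ) ≤ |(K.h : ℝ)| := abs_nonneg _
    linarith
  · push Not at hr
    have key : ∀ n : ℕ, -(n : ℝ) ≤ S j (K.h - n) := by
      intro n
      induction n with
      | zero => simp [hS.zero j K.h (by omega)]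
      | succ n ih =>
        have := hU j (K.h - (n + 1 : ℕ))
        rw [show K.h - ((n + 1 : ℕ) : ℤ) + 1 = K.h - n by push_cast; ring] at this
        push_cast at this ⊢
        linarith
    have h1 := key (K.h - r).toNat
    have h2 : (((K.h - r).toNat : ℤ)) = K.h - r := Int.toNat_of_nonneg (by omega)
    have h3 : (((K.h - r).toNat : ℝ)) = K.h - r := by exact_mod_cast h2
    rw [h2, h3] at h1
    have h4 : (0 : ℝ) < r := by exact_mod_cast (by omega : 0 < r)
    have := le_abs_self (K.h : ℝ)
    rw [show K.h - (K.h - r) = r by ring] at h1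
    linarith

theorem slope_of_free {j r : ℤ} (hf : K.Free j (r + 1)) (h : S j (r + 1) - S j r = 1) :
    S j (r + 1 + 1) - S j (r + 1) = 1 := by
  have := hS.convex _ _ hf
  have := hU j (r + 1)
  rw [add_sub_cancel_right] at *
  linarith

omit hS in
theorem slope_one_of_sum (j a : ℤ) (n : ℕ) (h : S j (a + n) - S j a = n) :
    ∀ i : ℕ, i ≤ n → S j (a + i) = S j a + i := by
  have hle : ∀ (c : ℤ) (k : ℕ), S j (c + k) ≤ S j c + k := by
    intro c k
    induction k with
    | zero => simp
    | succ k ih =>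
      have := hU j (c + k)
      push_cast
      rw [← add_assoc]
      linarith
  intro i hi
  obtain ⟨k, rfl⟩ := Nat.exists_eq_add_of_le hi
  have h1 := hle a i
  have h2 := hle (a + i) k
  push_cast at h
  rw [add_assoc] at h2
  linarith

/-- If the slope is maximal on one side of an edge just above its lower end, it is maximal along
both sides of the edge. -/
theorem slope_edge (e : E)
    (h : S (K.x e) (K.y (K.lo e) + 1) - S (K.x e) (K.y (K.lo e)) = 1 ∨
      S (K.x e + 1) (K.y (K.lo e) + 1) - S (K.x e + 1) (K.y (K.lo e)) = 1) :
    ∀ r, K.y (K.lo e) ≤ r → r < K.y (K.hi e) →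
      S (K.x e) (r + 1) - S (K.x e) r = 1 ∧ S (K.x e + 1) (r + 1) - S (K.x e + 1) r = 1 := by
  have hlt := K.lo_lt_hi e
  obtain ⟨n, hn⟩ : ∃ n : ℕ, K.y (K.hi e) = K.y (K.lo e) + n :=
    ⟨(K.y (K.hi e) - K.y (K.lo e)).toNat, by omega⟩
  have go : ∀ j, (∀ r, K.Crosses e r → K.Free j r) →
      S j (K.y (K.lo e) + 1) - S j (K.y (K.lo e)) = 1 → S j (K.y (K.hi e)) - S j (K.y (K.lo e)) = n := by
    intro j hfree h1
    have : ∀ k : ℕ, k < n → S j (K.y (K.lo e) + k + 1) - S j (K.y (K.lo e) + k) = 1 := by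
      intro k
      induction k with
      | zero => intro _; simpa using h1
      | succ k ih =>
        intro hk
        have := hS.slope_of_free hU (hfree _ ⟨by omega, by omega⟩) (ih (by omega))
        push_cast
        rwa [← add_assoc]
    rw [hn]
    have h2 : ∀ k : ℕ, k ≤ n → S j (K.y (K.lo e) + k) - S j (K.y (K.lo e)) = k := by
      intro k
      induction k with
      | zero => simp
      | succ k ih =>
        intro hk
        have := this k (by omega)
        have := ih (by omega)
        push_cast
        rw [← add_assoc]
        linarith
    exact h2 n le_rfl
  have hsum : S (K.x e) (K.y (K.hi e)) - S (K.x e) (K.y (K.lo e)) = n ∧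
      S (K.x e + 1) (K.y (K.hi e)) - S (K.x e + 1) (K.y (K.lo e)) = n := by
    have h1 := hS.eq_lo e
    have h2 := hS.eq_hi e
    rcases h with h | h
    · have := go _ (fun r hr => hr.free) h
      exact ⟨this, by linarith⟩
    · have := go _ (fun r hr => hr.free_succ) h
      exact ⟨by linarith, this⟩
  intro r hr1 hr2
  obtain ⟨k, rfl⟩ : ∃ k : ℕ, r = K.y (K.lo e) + k := ⟨(r - K.y (K.lo e)).toNat, by omega⟩
  rw [hn] at hsum
  constructor
  · have h1 := slope_one_of_sum hU _ _ n hsum.1 k (by omega)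
    have h2 := slope_one_of_sum hU _ _ n hsum.1 (k + 1) (by omega)
    push_cast at h2
    rw [add_assoc, h1, h2]; ring
  · have h1 := slope_one_of_sum hU _ _ n hsum.2 k (by omega)
    have h2 := slope_one_of_sum hU _ _ n hsum.2 (k + 1) (by omega)
    push_cast at h2
    rw [add_assoc, h1, h2]; ring

theorem slope_congr {j r : ℤ} (h : ∀ e, K.x e = j → ¬ K.Crosses e r) :
    S j (r + 1) - S j r = 1 ↔ S (j + 1) (r + 1) - S (j + 1) r = 1 := by
  by_cases h' : ∀ e, K.x e = j → ¬ K.Crosses e (r + 1)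
  · rw [hS.step _ _ h, hS.step _ _ h']
  · push Not at h'
    obtain ⟨e, rfl, he⟩ := h'
    have h2 := h e rfl
    have h3 : K.y (K.lo e) = r := by
      simp only [Crosses] at he h2
      omega
    have := hS.slope_edge hU e
    rw [h3] at this
    have h4 := fun hh => this hh r le_rfl (by have := he.2; omega)
    exact ⟨fun hh => (h4 (Or.inl hh)).2, fun hh => (h4 (Or.inr hh)).1⟩

end Slope

end IsMoment
end RowVis

namespace RowVis
variable {V E : Type} {K : RowVis V E}

theorem exists_pos_forall_le {α : Type*} (s : Finset α) (f : α → ℝ) (hf : ∀ x ∈ s, 0 < f x) :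
    ∃ δ > 0, ∀ x ∈ s, δ ≤ f x := by
  rcases s.eq_empty_or_nonempty with rfl | hs
  · exact ⟨1, one_pos, by simp⟩
  · obtain ⟨a, ha, hmin⟩ := s.exists_min_image f hs
    exact ⟨f a, hf a ha, hmin⟩

variable (K) in
/-- The moment functions of slope at most `1`. -/
def momentSet (m M : ℤ) : Set (ℤ → ℤ → ℝ) :=
  {S | K.IsMoment m M S ∧ ∀ j r, S j (r + 1) - S j r ≤ 1}

theorem isCompact_momentSet (m M : ℤ) : IsCompact (K.momentSet m M) := by
  have hbox : IsCompact (Set.univ.pi fun _ : ℤ => Set.univ.pi fun _ : ℤ => Icc (-(|K.h| : ℝ)) 0) :=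
    isCompact_univ_pi fun _ => isCompact_univ_pi fun _ => isCompact_Icc
  refine hbox.of_isClosed_subset ?_ ?_
  · have : K.momentSet m M =
        {S | ∀ j r, (∀ e, K.x e = j → ¬ K.Crosses e r) → S (j + 1) r = S j r} ∩
        {S | ∀ j r, K.Free j r → 2 * S j r ≤ S j (r + 1) + S j (r - 1)} ∩
        {S | ∀ j r, (j ≤ m ∨ M ≤ j ∨ r ≤ 1 ∨ K.h ≤ r) → S j r = 0} ∩
        {S | ∀ j r, S j (r + 1) - S j r ≤ 1} := by
      ext S
      constructor
      · rintro ⟨⟨h1, h2, h3⟩, h4⟩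
        exact ⟨⟨⟨h1, h2⟩, h3⟩, h4⟩
      · rintro ⟨⟨⟨h1, h2⟩, h3⟩, h4⟩
        exact ⟨⟨h1, h2, h3⟩, h4⟩
    rw [this]
    simp only [ofPred_forall]
    refine ((IsClosed.inter ?_ ?_).inter ?_).inter ?_
    · exact isClosed_iInter fun j => isClosed_iInter fun r => isClosed_iInter fun _ =>
        isClosed_eq (by fun_prop) (by fun_prop)
    · exact isClosed_iInter fun j => isClosed_iInter fun r => isClosed_iInter fun _ =>
        isClosed_le (by fun_prop) (by fun_prop)
    · exact isClosed_iInter fun j => isClosed_iInter fun r => isClosed_iInter fun _ =>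
        isClosed_eq (by fun_prop) (by fun_prop)
    · exact isClosed_iInter fun j => isClosed_iInter fun r =>
        isClosed_le (by fun_prop) (by fun_prop)
  · rintro S ⟨hS, hU⟩ j - r -
    exact ⟨hS.neg_h_le hU j r, hS.nonpos j r⟩

theorem IsMoment.smul {m M : ℤ} {S : ℤ → ℤ → ℝ} (hS : K.IsMoment m M S) {c : ℝ} (hc : 0 ≤ c) :
    K.IsMoment m M fun j r => c * S j r where
  step j r h := by rw [hS.step j r h]
  convex j r h := by nlinarith [hS.convex j r h]
  zero j r h := by rw [hS.zero j r h, mul_zero]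

/-- The length of the maximal run of unit slopes of `S j` starting upwards from row `r`. -/
def runLength (S : ℤ → ℤ → ℝ) (h j r : ℤ) : ℝ :=
  Nat.rec (motive := fun _ => ℝ) 0
    (fun n d => open Classical in if S j (h - (n + 1) + 1) - S j (h - (n + 1)) = 1 then d + 1 else 0)
    (h - r).toNat

theorem runLength_of_le {S : ℤ → ℤ → ℝ} {h j r : ℤ} (hr : h ≤ r) : runLength S h j r = 0 := by
  simp [runLength, Int.toNat_of_nonpos (show h - r ≤ 0 by omega)]

theorem runLength_of_lt {S : ℤ → ℤ → ℝ} {h j r : ℤ} (hr : r < h) : runLength S h j r =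
    open Classical in if S j (r + 1) - S j r = 1 then runLength S h j (r + 1) + 1 else 0 := by
  rw [runLength, runLength, show (h - r).toNat = (h - (r + 1)).toNat + 1 by omega]
  have : h - (((h - (r + 1)).toNat : ℤ) + 1) = r := by omega
  simp only [this]

namespace IsMoment

variable {m M : ℤ} {S : ℤ → ℤ → ℝ} (hS : K.IsMoment m M S)
  (hU : ∀ j r, S j (r + 1) - S j r ≤ 1)

include hS in
theorem lt_of_slope {j r : ℤ} (hT : S j (r + 1) - S j r = 1) :
    S j r < 0 ∧ m < j ∧ j < M ∧ 1 < r ∧ r < K.h := by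
  have := hS.nonpos j (r + 1)
  have h1 : S j r < 0 := by linarith
  have := mt (hS.zero j r) h1.ne
  refine ⟨h1, ?_⟩
  omega

include hS in
theorem runLength_pos {j r : ℤ} (hT : S j (r + 1) - S j r = 1) :
    runLength S K.h j r = runLength S K.h j (r + 1) + 1 := by
  rw [runLength_of_lt (hS.lt_of_slope hT).2.2.2.2, if_pos hT]

theorem runLength_neg {j r : ℤ} (hT : ¬ S j (r + 1) - S j r = 1) :
    runLength S K.h j r = 0 := by
  by_cases hr : K.h ≤ r
  · exact runLength_of_le hr
  · rw [runLength_of_lt (by omega), if_neg hT]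

include hS in
theorem runLength_le (j r : ℤ) : 0 ≤ runLength S K.h j r ∧ runLength S K.h j r ≤ - S j r := by
  have key : ∀ n : ℕ, ∀ r, (K.h - r).toNat = n →
      0 ≤ runLength S K.h j r ∧ runLength S K.h j r ≤ - S j r := by
    intro n
    induction n with
    | zero =>
      intro r hr
      rw [runLength_of_le (by omega), hS.zero j r (by omega)]
      simp
    | succ n ih =>
      intro r hr
      by_cases hT : S j (r + 1) - S j r = 1
      · rw [hS.runLength_pos hT]
        have := ih (r + 1) (by omega)
        constructor <;> linarith
      · rw [runLength_neg hT]
        have := hS.nonpos j r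
        constructor <;> linarith
  exact key _ r rfl

include hS hU in
theorem runLength_step (j r : ℤ) (h : ∀ e, K.x e = j → ¬ K.Crosses e r) :
    runLength S K.h (j + 1) r = runLength S K.h j r := by
  have key : ∀ n : ℕ, ∀ r, (K.h - r).toNat = n → (∀ e, K.x e = j → ¬ K.Crosses e r) →
      runLength S K.h (j + 1) r = runLength S K.h j r := by
    intro n
    induction n using Nat.strong_induction_on with
    | _ n ih =>
      intro r hr h
      by_cases hT : S j (r + 1) - S j r = 1
      · have hT' := (hS.slope_congr hU h).1 hT
        have hrh := (hS.lt_of_slope hT).2.2.2.2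
        by_cases h' : ∀ e, K.x e = j → ¬ K.Crosses e (r + 1)
        · rw [hS.runLength_pos hT, hS.runLength_pos hT', ih _ (by omega) (r + 1) rfl h']
        · push Not at h'
          obtain ⟨e, rfl, he⟩ := h'
          have h2 := h e rfl
          have h3 : K.y (K.lo e) = r := by
            simp only [Crosses] at he h2
            omega
          subst h3
          have hsl := hS.slope_edge hU e (Or.inl hT)
          have hlt := K.lo_lt_hi e
          have hh := K.le_h (K.hi e)
          have htop := ih _ (by omega) (K.y (K.hi e)) rfl (by
            intro f hf
            apply not_crosses_of_mem <;> rw [hf]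
            exacts [(K.mem_hi e).1, (K.mem_hi e).2])
          have down : ∀ k : ℕ, K.y (K.lo e) ≤ K.y (K.hi e) - k →
              runLength S K.h (K.x e + 1) (K.y (K.hi e) - k) =
                runLength S K.h (K.x e) (K.y (K.hi e) - k) := by
            intro k
            induction k with
            | zero => intro _; simpa using htop
            | succ k ihk =>
              intro hk
              push_cast at hk ⊢
              obtain ⟨h5, h6⟩ := hsl (K.y (K.hi e) - (k + 1)) hk (by omega)
              rw [hS.runLength_pos h5, hS.runLength_pos h6,
                show K.y (K.hi e) - ((k : ℤ) + 1) + 1 = K.y (K.hi e) - k by ring, ihk (by omega)]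
          have := down (K.y (K.hi e) - K.y (K.lo e)).toNat (by omega)
          rwa [show K.y (K.hi e) - ((K.y (K.hi e) - K.y (K.lo e)).toNat : ℤ) = K.y (K.lo e) by
            omega] at this
      · rw [runLength_neg hT, runLength_neg (mt (hS.slope_congr hU h).2 hT)]
  exact key _ r rfl h

include hS hU in
theorem exists_perturb : ∃ ε : ℝ, 0 < ε ∧ ε < 1 ∧
    K.IsMoment m M (fun j r => S j r + ε * runLength S K.h j r) ∧
    ∀ j r, S j (r + 1) + ε * runLength S K.h j (r + 1) - (S j r + ε * runLength S K.h j r) ≤ 1 - ε := by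
  classical
  obtain ⟨δ, hδ0, hδ⟩ := exists_pos_forall_le
    ((Finset.Icc m M ×ˢ Finset.Icc 0 K.h).filter fun p => ¬ S p.1 (p.2 + 1) - S p.1 p.2 = 1)
    (fun p => 1 - (S p.1 (p.2 + 1) - S p.1 p.2)) (by
      intro p hp
      have h1 := (Finset.mem_filter.1 hp).2
      have h2 := lt_of_le_of_ne (hU p.1 p.2) h1
      linarith)
  have hgap : ∀ j r, ¬ S j (r + 1) - S j r = 1 → S j (r + 1) - S j r ≤ 1 - min δ (1 / 2) := by
    intro j r hT
    by_cases hb : m ≤ j ∧ j ≤ M ∧ 0 ≤ r ∧ r ≤ K.h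
    · have := hδ (j, r) (by
        simp only [Finset.mem_filter, Finset.mem_product, Finset.mem_Icc]
        exact ⟨⟨⟨hb.1, hb.2.1⟩, hb.2.2⟩, hT⟩)
      have := min_le_left δ (1 / 2)
      simp only at *
      linarith
    · rw [hS.zero j r (by omega), hS.zero j (r + 1) (by omega)]
      have := min_le_right δ (1 / 2)
      linarith
  set H : ℝ := |(K.h : ℝ)| + 1 with hH
  have hH0 : 1 ≤ H := by have := abs_nonneg (K.h : ℝ); linarith
  have hδ1 : 0 < min δ (1 / 2) := by positivity
  have hδ2 : min δ (1 / 2) < 1 := (min_le_right _ _).trans_lt (by norm_num)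
  set d := min δ (1 / 2)
  have hD : ∀ j r, runLength S K.h j r + 1 ≤ H := by
    intro j r
    have h1 := hS.neg_h_le hU j r
    have h2 := (hS.runLength_le j r).2
    linarith
  have hεD : ∀ j r, d / H * (runLength S K.h j r + 1) ≤ d := by
    intro j r
    rw [div_mul_eq_mul_div, div_le_iff₀ (by linarith)]
    exact mul_le_mul_of_nonneg_left (hD j r) hδ1.le
  have hε0 : 0 < d / H := by positivity
  refine ⟨d / H, hε0, ?_, ⟨?_, ?_, ?_⟩, ?_⟩
  · rw [div_lt_one (by linarith)]; linarith
  · intro j r h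
    rw [hS.step j r h, hS.runLength_step hU j r h]
  · intro j r hf
    have hc := hS.convex j r hf
    by_cases hT : S j (r + 1) - S j r = 1
    · have h1 := hS.runLength_pos hT
      by_cases hT' : S j (r - 1 + 1) - S j (r - 1) = 1
      · have h2 := hS.runLength_pos hT'
        rw [sub_add_cancel] at h2
        rw [h2]
        have h3 : runLength S K.h j (r + 1) = runLength S K.h j r - 1 := by linarith
        rw [h3]
        linarith
      · have h2 := hgap _ _ hT'
        rw [runLength_neg hT']
        rw [sub_add_cancel] at h2
        have h3 : runLength S K.h j (r + 1) = runLength S K.h j r - 1 := by linarith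
        rw [h3]
        have := hεD j r
        linarith
    · have hT' : ¬ S j (r - 1 + 1) - S j (r - 1) = 1 := by
        intro hT'
        have := hS.slope_of_free hU (j := j) (r := r - 1) (by rwa [sub_add_cancel]) hT'
        rw [sub_add_cancel] at this
        exact hT this
      rw [runLength_neg hT, runLength_neg hT']
      have := mul_nonneg hε0.le (hS.runLength_le j (r + 1)).1
      linarith
  · intro j r h
    have h1 := hS.zero j r h
    have := hS.runLength_le j r
    rw [h1] at this ⊢
    rw [show runLength S K.h j r = 0 by linarith]
    simp
  · intro j r
    by_cases hT : S j (r + 1) - S j r = 1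
    · rw [hS.runLength_pos hT]
      linarith
    · rw [runLength_neg hT]
      have := hgap _ _ hT
      have := hεD j (r + 1)
      linarith

include hS in
theorem sum_neg {j r : ℤ} (h : S j r ≠ 0) :
    ∑ p ∈ Finset.Icc m M ×ˢ Finset.Icc 1 K.h, S p.1 p.2 < 0 := by
  refine Finset.sum_neg' (fun p _ => hS.nonpos p.1 p.2) ⟨(j, r), ?_, ?_⟩
  · have := mt (hS.zero j r) h
    simp only [Finset.mem_product, Finset.mem_Icc]
    omega
  · exact lt_of_le_of_ne (hS.nonpos j r) h

include hS in
theorem exists_slope_le : ∃ c : ℝ, 0 < c ∧ ∀ j r, c * S j (r + 1) - c * S j r ≤ 1 := by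
  obtain ⟨B, hB⟩ : ∃ B, ∀ p ∈ Finset.Icc m M ×ˢ Finset.Icc 0 K.h, S p.1 (p.2 + 1) - S p.1 p.2 ≤ B := by
    obtain ⟨B, hB⟩ := ((Finset.Icc m M ×ˢ Finset.Icc 0 K.h).image
      fun p => S p.1 (p.2 + 1) - S p.1 p.2).bddAbove
    exact ⟨B, fun p hp => hB (Finset.mem_coe.2 (Finset.mem_image_of_mem _ hp))⟩
  refine ⟨(|B| + 1)⁻¹, by positivity, fun j r => ?_⟩
  rw [← mul_sub, inv_mul_le_iff₀ (by positivity), mul_one]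
  by_cases hb : m ≤ j ∧ j ≤ M ∧ 0 ≤ r ∧ r ≤ K.h
  · have := hB (j, r) (by
      simp only [Finset.mem_product, Finset.mem_Icc]; tauto)
    have := le_abs_self B
    simp only at *
    linarith
  · rw [hS.zero j r (by omega), hS.zero j (r + 1) (by omega)]
    have := abs_nonneg B
    linarith

/-- If there is a nonzero moment function, then there is one all of whose negative values are
followed by a unit increment. -/
theorem exists_unit_slope {S₀ : ℤ → ℤ → ℝ} (hS₀ : K.IsMoment m M S₀) {j r : ℤ} (hne : S₀ j r ≠ 0) :
    ∃ S, K.IsMoment m M S ∧ (∀ j r, S j (r + 1) - S j r ≤ 1) ∧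
      (∃ j r, S j r < 0) ∧ ∀ j r, S j r < 0 → S j (r + 1) - S j r = 1 := by
  obtain ⟨c, hc, hcS⟩ := hS₀.exists_slope_le
  have h₁ : (fun j r => c * S₀ j r) ∈ K.momentSet m M := ⟨hS₀.smul hc.le, hcS⟩
  obtain ⟨S, ⟨hS, hU⟩, hmin⟩ := (isCompact_momentSet (K := K) m M).exists_isMinOn ⟨_, h₁⟩
    (f := fun S => ∑ p ∈ Finset.Icc m M ×ˢ Finset.Icc 1 K.h, S p.1 p.2) (by fun_prop)
  have hneg := (hS₀.smul hc.le).sum_neg (j := j) (r := r) (mul_ne_zero hc.ne' hne)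
  have hSneg := (isMinOn_iff.1 hmin _ h₁).trans_lt hneg
  obtain ⟨ε, hε0, hε1, hP, hPU⟩ := hS.exists_perturb hU
  have hcmp := isMinOn_iff.1 hmin (fun j r => (1 - ε)⁻¹ * (S j r + ε * runLength S K.h j r))
    ⟨hP.smul (inv_nonneg.2 (by linarith)), fun j r => by
      rw [← mul_sub, inv_mul_le_iff₀ (by linarith), mul_one]
      exact hPU j r⟩
  rw [← Finset.mul_sum, le_inv_mul_iff₀ (by linarith), Finset.sum_add_distrib, ← Finset.mul_sum] at hcmp
  have hle : ∀ p ∈ Finset.Icc m M ×ˢ Finset.Icc 1 K.h, runLength S K.h p.1 p.2 ≤ - S p.1 p.2 :=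
    fun p _ => (hS.runLength_le p.1 p.2).2
  have heq := (Finset.sum_eq_sum_iff_of_le hle).1 (le_antisymm (Finset.sum_le_sum hle) (by
    rw [Finset.sum_neg_distrib]
    have : ε * (-∑ p ∈ Finset.Icc m M ×ˢ Finset.Icc 1 K.h, S p.1 p.2) ≤
      ε * ∑ p ∈ Finset.Icc m M ×ˢ Finset.Icc 1 K.h, runLength S K.h p.1 p.2 := by linarith
    exact le_of_mul_le_mul_left this hε0))
  refine ⟨S, hS, hU, ?_, ?_⟩
  · by_contra hcon
    push Not at hcon
    exact absurd (Finset.sum_nonneg fun p _ => hcon p.1 p.2) (not_le.2 hSneg)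
  · intro j r hjr
    by_contra hT
    have hb := mt (hS.zero j r) hjr.ne
    have := heq (j, r) (by simp only [Finset.mem_product, Finset.mem_Icc]; omega)
    simp only at this
    rw [runLength_neg hT] at this
    linarith

end IsMoment
end RowVis

namespace RowVis
variable {V E : Type} {K : RowVis V E}
namespace IsMoment
variable {m M : ℤ} {S : ℤ → ℤ → ℝ} (hS : K.IsMoment m M S)
  (hU : ∀ j r, S j (r + 1) - S j r ≤ 1) (hP : ∀ j r, S j r < 0 → S j (r + 1) - S j r = 1)

include hS hU hP in
theorem neg_of_free {j r : ℤ} (h : S j r < 0) (hf : K.Free j (r + 1)) : S j (r + 1) < 0 := by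
  have h1 := hS.slope_of_free hU hf (hP _ _ h)
  have := hS.nonpos j (r + 1 + 1)
  linarith

include hS in
theorem eq_zero_of_free {j a b : ℤ} (h₀ : S j a = 0) (h₁ : S j (a + 1) = 0)
    (hf : ∀ r, a < r → r < b → K.Free j r) : ∀ r, a ≤ r → r ≤ b → S j r = 0 := by
  have key : ∀ n : ℕ, a + n + 1 ≤ b → S j (a + n) = 0 ∧ S j (a + n + 1) = 0 := by
    intro n
    induction n with
    | zero => intro _; simpa using ⟨h₀, h₁⟩
    | succ n ih =>
      intro hn
      push_cast at hn ⊢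
      obtain ⟨h2, h3⟩ := ih (by omega)
      have h4 := hS.convex j (a + n + 1) (hf _ (by omega) (by omega))
      rw [add_sub_cancel_right, h2, h3] at h4
      rw [← add_assoc]
      exact ⟨h3, le_antisymm (hS.nonpos _ _) (by linarith)⟩
  intro r har hrb
  rcases har.eq_or_lt with rfl | har
  · exact h₀
  · have := (key (r - a - 1).toNat (by omega)).2
    rwa [show a + ((r - a - 1).toNat : ℤ) + 1 = r by omega] at this

include hS hU hP in
theorem not_neg (j r : ℤ) : ¬ S j r < 0 := by
  intro hneg
  obtain ⟨r₀, ⟨j, hj⟩, hr₀⟩ := Int.exists_least_of_bdd (P := fun r => ∃ j, S j r < 0)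
    ⟨1, fun r ⟨j, hj⟩ => by
      by_contra hc
      rw [hS.zero j r (by omega)] at hj
      exact lt_irrefl _ hj⟩ ⟨r, j, hneg⟩
  have hlow : ∀ i q, q < r₀ → S i q = 0 := by
    intro i q hq
    refine le_antisymm (hS.nonpos _ _) (not_lt.1 fun h => ?_)
    have := hr₀ q ⟨i, h⟩
    omega
  obtain ⟨a, ⟨haj, ha0⟩, ha⟩ := Int.exists_greatest_of_bdd (P := fun i => i ≤ j ∧ S i r₀ = 0)
    ⟨j, fun i hi => hi.1⟩ ⟨min j m, min_le_left _ _, hS.zero _ _ (by omega)⟩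
  obtain ⟨b, ⟨hbj, hb0⟩, hb⟩ := Int.exists_least_of_bdd (P := fun i => j ≤ i ∧ S i r₀ = 0)
    ⟨j, fun i hi => hi.1⟩ ⟨max j M, le_max_left _ _, hS.zero _ _ (by omega)⟩
  have haj' : a < j := lt_of_le_of_ne haj (by rintro rfl; linarith)
  have hbj' : j < b := lt_of_le_of_ne hbj (by rintro rfl; linarith)
  have hmid : ∀ i, a < i → i < b → S i r₀ < 0 := by
    intro i h1 h2
    refine lt_of_le_of_ne (hS.nonpos _ _) fun h0 => ?_
    rcases le_total i j with h | h
    · have := ha i ⟨h, h0⟩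
      omega
    · have := hb i ⟨h, h0⟩
      omega
  obtain ⟨e, he, hec⟩ : ∃ e, K.x e = a ∧ K.Crosses e r₀ := by
    by_contra hc
    push Not at hc
    have := hS.step a r₀ hc
    have := hmid (a + 1) (by omega) (by omega)
    linarith
  obtain ⟨f, hf, hfc⟩ : ∃ f, K.x f = b - 1 ∧ K.Crosses f r₀ := by
    by_contra hc
    push Not at hc
    have h1 := hS.step (b - 1) r₀ hc
    rw [sub_add_cancel] at h1
    have := hmid (b - 1) (by omega) (by omega)
    linarith
  obtain rfl : b = K.x f + 1 := by omega
  subst he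
  clear hf ha hb hbj haj hneg hr₀
  have hblock : ∀ i, K.x e < i → i < K.x f + 1 →
      ∃ v, K.y v = r₀ - 1 ∧ K.l v < i ∧ i ≤ K.r v := by
    intro i h1 h2
    by_contra hc
    have hfree : K.Free i (r₀ - 1) := by
      intro v hv
      by_contra hcon
      exact hc ⟨v, hv, by omega, by omega⟩
    have h3 := hS.convex _ _ hfree
    rw [sub_add_cancel, hlow i (r₀ - 1) (by omega), hlow i (r₀ - 1 - 1) (by omega)] at h3
    have := hmid i h1 h2
    linarith
  obtain ⟨v, hv, hv1, hv2⟩ := hblock (K.x e + 1) (by omega) (by omega)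
  have hvr : ∀ n : ℕ, K.x e + 1 + n < K.x f + 1 → K.x e + 1 + n ≤ K.r v := by
    intro n
    induction n with
    | zero => intro _; simpa using hv2
    | succ n ih =>
      intro hn
      push_cast at hn ⊢
      have h1 := ih (by omega)
      obtain ⟨w, hw, hw1, hw2⟩ := hblock (K.x e + 1 + (n + 1)) (by omega) (by omega)
      obtain rfl : v = w := eq_of_mem (j := K.x e + 1 + n) (by omega) (by omega) h1 (by omega)
        (by omega)
      exact hw2
  have hvr' : K.x f ≤ K.r v := by
    have := hvr (K.x f - K.x e - 1).toNat (by omega)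
    omega
  have hlo : ∀ g, K.Crosses g r₀ → K.l v ≤ K.x g → K.x g ≤ K.r v → K.lo g = v := by
    intro g hg h1 h2
    have h3 : K.y (K.lo g) = K.y v := by
      by_contra hne
      have := hg.1
      have := hg.2
      exact not_crosses_of_mem h1 h2 ⟨by omega, by omega⟩
    exact eq_of_mem h3 (K.mem_lo g).1 (K.mem_lo g).2 h1 h2
  have hloe := hlo e hec (by omega) (by omega)
  have hlof := hlo f hfc (by omega) (by omega)
  have hze := hS.eq_zero_of_free (j := K.x e) (a := r₀ - 1) (b := K.y (K.hi e))
    (hlow _ _ (by omega)) (by rwa [sub_add_cancel])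
    (fun r h1 h2 => Crosses.free ⟨by rw [hloe]; omega, h2⟩)
  have hzf := hS.eq_zero_of_free (j := K.x f + 1) (a := r₀ - 1) (b := K.y (K.hi f))
    (hlow _ _ (by omega)) (by rwa [sub_add_cancel])
    (fun r h1 h2 => Crosses.free_succ ⟨by rw [hlof]; omega, h2⟩)
  have hze' := hze _ (by have := hec.2; omega) le_rfl
  have hzf' := hzf _ (by have := hfc.2; omega) le_rfl
  rw [hS.eq_hi] at hzf'
  have hrun : ∀ n : ℕ, r₀ + n < K.y (K.hi e) → r₀ + n < K.y (K.hi f) →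
      ∀ i, K.x e < i → i < K.x f + 1 → S i (r₀ + n) < 0 := by
    intro n
    induction n with
    | zero => intro _ _; simpa using hmid
    | succ n ih =>
      intro h1 h2 i hi1 hi2
      push_cast at h1 h2 ⊢
      rw [← add_assoc] at *
      have ih := ih (by omega) (by omega)
      by_cases hfr : K.Free i (r₀ + n + 1)
      · exact hS.neg_of_free hU hP (ih i hi1 hi2) hfr
      · simp only [Free, not_forall] at hfr
        obtain ⟨w, hw, hw'⟩ := hfr
        have h3 : K.x e < K.l w := by
          have := K.avoid e w (by rw [hloe]; omega) (by omega)
          omega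
        have h4 := hS.neg_of_free hU hP (ih (K.l w) h3 (by omega)) (by rw [← hw]; exact free_l w)
        have h5 := hS.eq_on_vertex w i (by omega) (by omega)
        rw [hw] at h5
        rwa [h5]
  have hrun' : ∀ r, r₀ ≤ r → r < K.y (K.hi e) → r < K.y (K.hi f) →
      ∀ i, K.x e < i → i < K.x f + 1 → S i r < 0 := by
    intro r h0 h1 h2
    have := hrun (r - r₀).toNat (by omega) (by omega)
    rwa [show r₀ + ((r - r₀).toNat : ℤ) = r by omega] at this
  have hhi : K.hi e = K.hi f := by
    rcases le_total (K.y (K.hi e)) (K.y (K.hi f)) with hle | hle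
    · have h1 : K.x f ≤ K.r (K.hi e) := by
        by_contra hc
        have hm := K.mem_hi e
        have h2 := hrun' (K.y (K.hi e) - 1) (by have := hec.2; omega) (by omega) (by omega)
          (K.r (K.hi e) + 1) (by omega) (by omega)
        have h3 := hS.neg_of_free hU hP h2 (by rw [sub_add_cancel]; exact free_r _)
        rw [sub_add_cancel, hS.eq_on_vertex _ _ (by omega) le_rfl,
          ← hS.eq_on_vertex _ (K.x e) (by omega) (by omega), hze'] at h3
        exact lt_irrefl _ h3
      have hm := K.mem_hi e
      have h2 : K.y (K.hi e) = K.y (K.hi f) := by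
        by_contra hne
        exact not_crosses_of_mem (K := K) (v := K.hi e) (e := f) (by omega) (by omega)
          ⟨by rw [hlof, ← hloe]; exact K.lo_lt_hi e, by omega⟩
      exact eq_of_mem (j := K.x f) h2 (by omega) (by omega) (K.mem_hi f).1 (K.mem_hi f).2
    · have h1 : K.l (K.hi f) ≤ K.x e := by
        by_contra hc
        have hm := K.mem_hi f
        have h2 := hrun' (K.y (K.hi f) - 1) (by have := hfc.2; omega) (by omega) (by omega)
          (K.l (K.hi f)) (by omega) (by omega)
        have h3 := hS.neg_of_free hU hP h2 (by rw [sub_add_cancel]; exact free_l _)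
        rw [sub_add_cancel, ← hS.eq_on_vertex _ (K.x f) (by omega) (by omega), hzf'] at h3
        exact lt_irrefl _ h3
      have hm := K.mem_hi f
      have h2 : K.y (K.hi e) = K.y (K.hi f) := by
        by_contra hne
        exact not_crosses_of_mem (K := K) (v := K.hi f) (e := e) (by omega) (by omega)
          ⟨by rw [hloe, ← hlof]; exact K.lo_lt_hi f, by omega⟩
      exact eq_of_mem (j := K.x e) h2 (K.mem_hi e).1 (K.mem_hi e).2 (by omega) (by omega)
  have := K.simple e f (hloe.trans hlof.symm) hhi
  subst this
  omega

omit hS in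
/-- There are no nontrivial moment functions. -/
theorem eq_zero (hS : K.IsMoment m M S) (j r : ℤ) : S j r = 0 := by
  by_contra hne
  obtain ⟨S', hS', hU, ⟨j, r, h⟩, hP⟩ := exists_unit_slope hS hne
  exact hS'.not_neg hU hP j r h

end IsMoment
end RowVis

namespace RowVis
variable {V E : Type} (K : RowVis V E)

/-- The vertex or edge `a` meets row `r`, for an edge away from its end-vertices. -/
def InRow (a : V ⊕ E) (r : ℤ) : Prop := a.elim (fun v => K.y v = r) (fun e => K.Crosses e r)

/-- The leftmost column of a vertex or edge. -/
def left (a : V ⊕ E) : ℤ := a.elim K.l K.x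

/-- The rightmost column of a vertex or edge. -/
def right (a : V ⊕ E) : ℤ := a.elim K.r K.x

theorem left_le_right (a : V ⊕ E) : K.left a ≤ K.right a := by
  rcases a with v | e
  exacts [K.l_le_r v, le_rfl]

/-- Abscissae for the vertices and for the points of the edges in all rows. -/
abbrev Placement (V E : Type) := (V → ℝ) × (E → ℤ → ℝ)

/-- The abscissa of a vertex or edge in row `r`. -/
def abscissa (r : ℤ) (a : V ⊕ E) (p : Placement V E) : ℝ := a.elim p.1 (fun e => p.2 e r)

/-- The abscissa of the edge `e` in row `r`, including the rows of its end-vertices. -/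
def edgeAbscissa (e : E) (r : ℤ) (p : Placement V E) : ℝ :=
  if r = K.y (K.lo e) then p.1 (K.lo e) else if r = K.y (K.hi e) then p.1 (K.hi e) else p.2 e r

/-- Pairs of objects in a common row, the first one to the left of the second one. -/
abbrev RowPair := {t : (V ⊕ E) × (V ⊕ E) × Finset.Icc 1 K.h //
  K.InRow t.1 t.2.2 ∧ K.InRow t.2.1 t.2.2 ∧ K.right t.1 < K.left t.2.1}

/-- The differences of abscissae of consecutive objects. -/
def gap : Placement V E →ₗ[ℝ] K.RowPair → ℝ where
  toFun p t := abscissa t.1.2.2 t.1.2.1 p - abscissa t.1.2.2 t.1.1 p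
  map_add' p q := by
    funext ⟨⟨a, b, r⟩, h⟩
    rcases a with a | a <;> rcases b with b | b <;> simp [abscissa] <;> ring
  map_smul' c p := by
    funext ⟨⟨a, b, r⟩, h⟩
    rcases a with a | a <;> rcases b with b | b <;> simp [abscissa] <;> ring

open Classical in
/-- The second differences of the abscissae along the edges. -/
def bend : Placement V E →ₗ[ℝ] E × Finset.Icc 1 K.h → ℝ where
  toFun p t := if K.Crosses t.1 t.2 then K.edgeAbscissa t.1 (t.2 + 1) p
    - 2 * K.edgeAbscissa t.1 t.2 p + K.edgeAbscissa t.1 (t.2 - 1) p else 0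
  map_add' p q := by
    funext t
    simp only [edgeAbscissa, Prod.fst_add, Prod.snd_add, Pi.add_apply]
    split_ifs <;> ring
  map_smul' c p := by
    funext t
    simp only [edgeAbscissa, Prod.smul_fst, Prod.smul_snd, Pi.smul_apply, smul_eq_mul,
      RingHom.id_apply]
    split_ifs <;> ring

theorem gap_apply (p : Placement V E) (t : K.RowPair) :
    K.gap p t = abscissa t.1.2.2 t.1.2.1 p - abscissa t.1.2.2 t.1.1 p := rfl

open Classical in
theorem bend_apply (p : Placement V E) (t : E × Finset.Icc 1 K.h) :
    K.bend p t = if K.Crosses t.1 t.2 then K.edgeAbscissa t.1 (t.2 + 1) p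
    - 2 * K.edgeAbscissa t.1 t.2 p + K.edgeAbscissa t.1 (t.2 - 1) p else 0 := rfl

open Classical in
/-- The placement moving everything in row `r` to the left of column `j` by a unit. -/
def shift (j r : ℤ) : Placement V E :=
  (fun v => if K.y v = r ∧ K.r v < j then -1 else 0, fun e q => if q = r ∧ K.x e < j then -1 else 0)

open Classical in
/-- The crossings of row `r` left of column `j`. -/
def crossVec (j r : ℤ) : E × Finset.Icc 1 K.h → ℝ :=
  fun t => if K.x t.1 < j ∧ (t.2 : ℤ) = r ∧ K.Crosses t.1 t.2 then -1 else 0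

variable {K}

theorem Crosses.mem_Icc {e : E} {r : ℤ} (h : K.Crosses e r) : 1 < r ∧ r < K.h := by
  have := K.one_le (K.lo e)
  have := K.le_h (K.hi e)
  have := h.1
  have := h.2
  omega

theorem abscissa_shift {a : V ⊕ E} {q : ℤ} (ha : K.InRow a q) (j r : ℤ) :
    open Classical in abscissa q a (K.shift j r) = if q = r ∧ K.right a < j then -1 else 0 := by
  rcases a with v | e
  · have : K.y v = q := ha
    subst this
    rfl
  · rfl

theorem edgeAbscissa_shift {j r : ℤ} (hf : K.Free j r) (e : E) {q : ℤ} :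
    open Classical in K.edgeAbscissa e q (K.shift j r) = if q = r ∧ K.x e < j then -1 else 0 := by
  classical
  have h1 := hf (K.lo e)
  have h2 := hf (K.hi e)
  have h3 := K.mem_lo e
  have h4 := K.mem_hi e
  unfold edgeAbscissa
  by_cases h5 : q = K.y (K.lo e)
  · rw [if_pos h5]
    refine if_congr ?_ rfl rfl
    rw [h5]
    constructor <;> rintro ⟨h6, h7⟩ <;> have := h1 h6 <;> exact ⟨h6, by omega⟩
  · rw [if_neg h5]
    by_cases h5 : q = K.y (K.hi e)
    · rw [if_pos h5]
      refine if_congr ?_ rfl rfl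
      rw [h5]
      constructor <;> rintro ⟨h6, h7⟩ <;> have := h2 h6 <;> exact ⟨h6, by omega⟩
    · rw [if_neg h5]
      rfl

theorem bend_shift {j r : ℤ} (hf : K.Free j r) :
    K.bend (K.shift j r) = K.crossVec j (r + 1) - (2 : ℝ) • K.crossVec j r + K.crossVec j (r - 1) := by
  classical
  funext ⟨e, q, hq⟩
  rw [bend_apply]
  simp only [edgeAbscissa_shift hf, crossVec, Pi.add_apply, Pi.sub_apply, Pi.smul_apply,
    smul_eq_mul]
  by_cases hc : K.Crosses e q <;> by_cases hx : K.x e < j <;> simp only [hc, hx, and_true, and_false,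
    true_and, false_and, if_true, if_false] <;> try norm_num
  have e1 : (q + 1 = r) ↔ (q = r - 1) := by omega
  have e2 : (q - 1 = r) ↔ (q = r + 1) := by omega
  simp only [e1, e2]
  ring

theorem gap_shift_nonneg (j r : ℤ) : 0 ≤ K.gap (K.shift j r) := by
  classical
  rintro ⟨⟨a, b, q⟩, ha, hb, hab⟩
  have := K.left_le_right b
  rw [gap_apply]
  simp only [abscissa_shift ha, abscissa_shift hb, Pi.zero_apply]
  split_ifs with h1 h2
  · norm_num
  · exact absurd ⟨h1.1, (hab.trans_le this).trans h1.2⟩ h2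
  · norm_num
  · norm_num

theorem gap_shift_eq_zero {j : ℤ} (hj : ∀ a, K.right a < j) (r : ℤ) : K.gap (K.shift j r) = 0 := by
  classical
  funext ⟨⟨a, b, q⟩, ha, hb, hab⟩
  rw [gap_apply]
  simp only at *
  simp only [abscissa_shift ha, abscissa_shift hb, hj, Pi.zero_apply, sub_self]

/-- A functional of the second differences that is nonnegative on shifts is a moment function. -/
theorem isMoment_of_functional {m M : ℤ} (hm : ∀ a, m ≤ K.left a) (hM : ∀ a, K.right a < M)
    (μ : (E × Finset.Icc 1 K.h → ℝ) →ₗ[ℝ] ℝ) (Λ : (K.RowPair → ℝ) → ℝ) (hΛ : ∀ g, 0 ≤ g → 0 ≤ Λ g)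
    (hΛ0 : Λ 0 = 0) (hμ : ∀ p, μ (K.bend p) = Λ (K.gap p)) :
    K.IsMoment m M fun j r => μ (K.crossVec j r) := by
  classical
  have hrow : ∀ j r, r ≤ 1 ∨ K.h ≤ r → K.crossVec j r = 0 := by
    intro j r h
    funext t
    refine if_neg ?_
    rintro ⟨-, rfl, hc⟩
    have := hc.mem_Icc
    omega
  have hbend : ∀ j r, K.Free j r → μ (K.crossVec j (r + 1)) - 2 * μ (K.crossVec j r)
      + μ (K.crossVec j (r - 1)) = Λ (K.gap (K.shift j r)) := by
    intro j r hf
    rw [← hμ, bend_shift hf, map_add, map_sub, map_smul, smul_eq_mul]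
  refine ⟨fun j r h => ?_, fun j r hf => ?_, fun j r h => ?_⟩
  · congr 1
    funext t
    unfold crossVec
    congr 1
    rw [eq_iff_iff]
    constructor
    · rintro ⟨h1, rfl, h2⟩
      refine ⟨lt_of_le_of_ne (by omega) fun h3 => h _ h3 h2, rfl, h2⟩
    · rintro ⟨h1, h2⟩
      exact ⟨by omega, h2⟩
  · have := hbend j r hf
    have := hΛ _ (gap_shift_nonneg (K := K) j r)
    linarith
  · rcases h with h | h | h
    · rw [show K.crossVec j r = 0 from ?_, map_zero]
      funext t
      refine if_neg ?_
      have := hm (Sum.inr t.1)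
      simp only [left, Sum.elim_inr] at this
      omega
    · have hz : ∀ r, μ (K.crossVec j (r + 1)) - 2 * μ (K.crossVec j r)
          + μ (K.crossVec j (r - 1)) = 0 := by
        intro r
        rw [hbend, gap_shift_eq_zero (fun a => (hM a).trans_le h), hΛ0]
        intro v _
        exact Or.inl ((hM (Sum.inl v)).trans_le h)
      have key : ∀ n : ℕ, μ (K.crossVec j n) = 0 ∧ μ (K.crossVec j (n + 1)) = 0 := by
        intro n
        induction n with
        | zero =>
          rw [hrow _ _ (by simp), hrow _ _ (by simp)]
          simp
        | succ n ih =>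
          have := hz (n + 1)
          rw [add_sub_cancel_right, ih.1, ih.2] at this
          push_cast
          exact ⟨ih.2, by linarith⟩
      rcases le_or_gt r 1 with h1 | h1
      · simp [hrow j r (Or.inl h1)]
      · have := (key r.toNat).1
        rwa [Int.toNat_of_nonneg (by omega)] at this
    · simp [hrow j r h]

theorem exists_bounds [Finite V] [Finite E] (K : RowVis V E) :
    ∃ m M : ℤ, (∀ a, m ≤ K.left a) ∧ ∀ a, K.right a < M := by
  obtain ⟨m, hm⟩ := (Set.finite_range K.left).bddBelow
  obtain ⟨M, hM⟩ := (Set.finite_range K.right).bddAbove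
  exact ⟨m, M + 1, fun a => hm ⟨a, rfl⟩, fun a => Int.lt_add_one_of_le (hM ⟨a, rfl⟩)⟩

/-- There is a placement without bends that respects the order in all rows. -/
theorem exists_bend_eq_zero [Finite V] [Finite E] (K : RowVis V E) :
    ∃ p, K.bend p = 0 ∧ ∀ t, 0 < K.gap p t := by
  classical
  cases nonempty_fintype V
  cases nonempty_fintype E
  by_contra hcon
  push Not at hcon
  have hopen : IsOpen {g : K.RowPair → ℝ | ∀ t, 0 < g t} := by
    simp only [ofPred_forall]
    exact isOpen_iInter_of_finite fun t => isOpen_lt (by fun_prop) (by fun_prop)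
  have hconv : Convex ℝ {g : K.RowPair → ℝ | ∀ t, 0 < g t} := by
    intro g hg g' hg' a b ha hb hab t
    have h1 := hg t
    have h2 := hg' t
    simp only [Pi.add_apply, Pi.smul_apply, smul_eq_mul]
    rcases ha.eq_or_lt with rfl | ha
    · rw [zero_add] at hab; subst hab; simpa using h2
    · have := mul_pos ha h1
      have := mul_nonneg hb h2.le
      linarith
  have hdisj : Disjoint {g : K.RowPair → ℝ | ∀ t, 0 < g t} ((LinearMap.ker K.bend).map K.gap) := by
    rw [Set.disjoint_left]
    rintro g hg ⟨p, hp, rfl⟩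
    obtain ⟨t, ht⟩ := hcon p hp
    exact absurd (hg t) (not_lt.2 ht)
  obtain ⟨f, u, hfu, hf⟩ := geometric_hahn_banach_open hconv hopen
    (Submodule.convex (𝕜 := ℝ) ((LinearMap.ker K.bend).map K.gap)) hdisj
  have hu : u ≤ 0 := by simpa using hf 0 (Submodule.zero_mem _)
  have hker : ∀ p, K.bend p = 0 → f (K.gap p) = 0 := by
    intro p hp
    by_contra hne
    have := hf (K.gap (((u - 1) / f (K.gap p)) • p)) ⟨_, by simp [hp], rfl⟩
    rw [map_smul, map_smul, smul_eq_mul, div_mul_cancel₀ _ hne] at this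
    linarith
  have hneg : ∀ g : K.RowPair → ℝ, 0 ≤ g → f g ≤ 0 := by
    intro g hg
    by_contra hpos
    push Not at hpos
    have h1 : f 1 < 0 := (hfu 1 (fun _ => one_pos)).trans_le hu
    have h2 := hfu (g + (f g / (- f 1)) • 1) (fun t => by
      have := hg t
      have h3 : 0 < f g / (- f 1) := div_pos hpos (by linarith)
      simp only [Pi.add_apply, Pi.smul_apply, Pi.one_apply, smul_eq_mul, Pi.zero_apply, mul_one] at *
      linarith)
    rw [map_add, map_smul, smul_eq_mul, div_neg, neg_mul, div_mul_cancel₀ _ h1.ne] at h2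
    linarith
  obtain ⟨μ, hμ⟩ : ∃ μ : (E × Finset.Icc 1 K.h → ℝ) →ₗ[ℝ] ℝ,
      ∀ p, μ (K.bend p) = f (K.gap p) := by
    have : (f : (K.RowPair → ℝ) →ₗ[ℝ] ℝ) ∘ₗ K.gap ∈ (LinearMap.ker K.bend).dualAnnihilator := by
      rw [Submodule.mem_dualAnnihilator]
      exact hker
    rw [← LinearMap.range_dualMap_eq_dualAnnihilator_ker] at this
    obtain ⟨μ, hμ⟩ := this
    exact ⟨μ, fun p => LinearMap.congr_fun hμ p⟩
  obtain ⟨m, M, hm, hM⟩ := K.exists_bounds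
  have hS := isMoment_of_functional hm hM (-μ) (fun g => - f g) (fun g hg => by
    have := hneg g hg; linarith) (by simp) (fun p => by simp [hμ])
  have hsingle : ∀ e r, K.Crosses e r.1 → μ (Pi.single (e, r) 1) = 0 := by
    intro e r hc
    have h1 := hS.eq_zero (K.x e) r
    have h2 := hS.eq_zero (K.x e + 1) r
    simp only [LinearMap.neg_apply, neg_eq_zero] at h1 h2
    have h3 : (Pi.single (e, r) 1 : E × Finset.Icc 1 K.h → ℝ) =
        K.crossVec (K.x e) r - K.crossVec (K.x e + 1) r := by
      funext ⟨e', r'⟩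
      by_cases h : (e', r') = (e, r)
      · obtain ⟨rfl, rfl⟩ := Prod.mk.inj h
        simp [crossVec, hc]
      · rw [Pi.single_eq_of_ne h, Pi.sub_apply, eq_comm, sub_eq_zero, crossVec, crossVec]
        congr 1
        rw [eq_iff_iff]
        constructor
        · rintro ⟨h1, h2⟩
          exact ⟨by simp only at *; omega, h2⟩
        · rintro ⟨h4, h5, h6⟩
          refine ⟨lt_of_le_of_ne (by simp only at *; omega) fun h7 => ?_, h5, h6⟩
          have hr : r' = r := Subtype.ext h5
          subst hr
          have hne : e' ≠ e := by rintro rfl; exact h rfl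
          have := K.sep e' e hne h7
          have := hc.1
          have := hc.2
          have := h6.1
          have := h6.2
          simp only at *
          omega
    rw [h3, map_sub, h1, h2, sub_zero]
  have hμ0 : ∀ p, μ (K.bend p) = 0 := by
    intro p
    rw [LinearMap.pi_apply_eq_sum_univ]
    refine Finset.sum_eq_zero fun t _ => ?_
    by_cases hc : K.Crosses t.1 t.2
    · have : (fun s => if t = s then (1 : ℝ) else 0) = Pi.single (t.1, t.2) 1 := by
        funext s
        simp [Pi.single_apply, eq_comm]
      rw [this, hsingle _ _ hc, smul_zero]
    · rw [bend_apply, if_neg hc, zero_smul]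
  have hpos : ∀ t, 0 < K.gap ((fun v => (K.l v : ℝ), fun e _ => (K.x e : ℝ))) t := by
    rintro ⟨⟨a, b, r⟩, ha, hb, hab⟩
    rw [gap_apply, sub_pos]
    rcases a with v | e <;> rcases b with w | e' <;>
      simp only [abscissa, Sum.elim_inl, Sum.elim_inr, left, right] at * <;> norm_cast
    · exact (K.l_le_r v).trans_lt hab
    · exact (K.l_le_r v).trans_lt hab
  have := (hfu _ hpos).trans_le hu
  rw [← hμ, hμ0] at this
  exact lt_irrefl _ this

variable (K) in
/-- The abscissa at height `t` of the straight line through the ends of the edge `e`. -/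
def interp (X : V → ℝ) (e : E) (t : ℝ) : ℝ :=
  X (K.lo e) + (t - K.y (K.lo e)) * ((X (K.hi e) - X (K.lo e)) / (K.y (K.hi e) - K.y (K.lo e)))

theorem edgeAbscissa_eq_interp {p : Placement V E} (hp : K.bend p = 0) {e : E} {r : ℤ}
    (hc : K.Crosses e r) : p.2 e r = K.interp p.1 e r := by
  classical
  have hlt := K.lo_lt_hi e
  have h2 : ∀ q, K.Crosses e q → K.edgeAbscissa e (q + 1) p - 2 * K.edgeAbscissa e q p +
      K.edgeAbscissa e (q - 1) p = 0 := by
    intro q hq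
    have h3 := congrFun hp (e, ⟨q, Finset.mem_Icc.2 ⟨hq.mem_Icc.1.le, hq.mem_Icc.2.le⟩⟩)
    rwa [bend_apply, if_pos hq] at h3
  set a := K.y (K.lo e)
  set d := K.edgeAbscissa e (a + 1) p - K.edgeAbscissa e a p with hd
  have key : ∀ n : ℕ, a + n + 1 ≤ K.y (K.hi e) → K.edgeAbscissa e (a + n) p =
      K.edgeAbscissa e a p + n * d ∧ K.edgeAbscissa e (a + n + 1) p =
      K.edgeAbscissa e a p + (n + 1) * d := by
    intro n
    induction n with
    | zero => intro _; simp [hd]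
    | succ n ih =>
      intro hn
      push_cast at hn ⊢
      obtain ⟨h3, h4⟩ := ih (by omega)
      have := h2 (a + n + 1) ⟨by simp only [a]; omega, by omega⟩
      rw [add_sub_cancel_right] at this
      rw [← add_assoc]
      refine ⟨h4, ?_⟩
      rw [h3, h4] at this
      linarith
  have key' : ∀ q, a < q → q ≤ K.y (K.hi e) → K.edgeAbscissa e q p =
      K.edgeAbscissa e a p + (q - a) * d := by
    intro q h3 h4
    have h5 := (key (q - a - 1).toNat (by omega)).2
    rw [show a + ((q - a - 1).toNat : ℤ) + 1 = q by omega] at h5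
    rw [h5]
    have h6 : ((q - a - 1).toNat : ℤ) = q - a - 1 := Int.toNat_of_nonneg (by omega)
    have h7 : ((q - a - 1).toNat : ℝ) = q - a - 1 := by exact_mod_cast h6
    rw [h7]
    ring
  have e1 : K.edgeAbscissa e a p = p.1 (K.lo e) := if_pos rfl
  have e2 : K.edgeAbscissa e (K.y (K.hi e)) p = p.1 (K.hi e) := by
    rw [edgeAbscissa, if_neg hlt.ne', if_pos rfl]
  have e3 : K.edgeAbscissa e r p = p.2 e r := by
    rw [edgeAbscissa, if_neg hc.1.ne', if_neg hc.2.ne]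
  have h3 := key' _ hlt le_rfl
  have h4 := key' r hc.1 hc.2.le
  have hpos : (0 : ℝ) < K.y (K.hi e) - a := by
    rw [sub_pos]; exact_mod_cast hlt
  rw [e1, e2] at h3
  rw [e1, e3] at h4
  rw [h4, interp, h3]
  simp only [a] at *
  field_simp
  ring

variable (K) in
/-- The abscissa in row `r` of a vertex or of a straight edge. -/
def place (X : V → ℝ) (r : ℤ) (a : V ⊕ E) : ℝ := a.elim X (fun e => K.interp X e r)

/-- Vertices can be placed so that in every row, vertices and straight edges
appear in the order prescribed by the visibility representation. -/
theorem exists_straight [Finite V] [Finite E] (K : RowVis V E) :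
    ∃ X : V → ℝ, ∀ a b r, K.InRow a r → K.InRow b r → K.right a < K.left b →
      K.place X r a < K.place X r b := by
  obtain ⟨p, hp, hgap⟩ := K.exists_bend_eq_zero
  have heq : ∀ a r, K.InRow a r → K.place p.1 r a = abscissa r a p := by
    rintro (v | e) r h
    · rfl
    · exact (edgeAbscissa_eq_interp hp h).symm
  refine ⟨p.1, fun a b r ha hb hab => ?_⟩
  have hr : r ∈ Finset.Icc 1 K.h := by
    rw [Finset.mem_Icc]
    rcases a with v | e
    · obtain rfl : K.y v = r := ha
      exact ⟨K.one_le v, K.le_h v⟩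
    · have := Crosses.mem_Icc ha
      omega
  have := hgap ⟨(a, b, ⟨r, hr⟩), ha, hb, hab⟩
  rw [gap_apply, sub_pos] at this
  rw [heq a r ha, heq b r hb]
  exact this

end RowVis

namespace RowVis
variable {V E : Type} {K : RowVis V E}

theorem interp_lo (X : V → ℝ) (e : E) : K.interp X e (K.y (K.lo e)) = X (K.lo e) := by
  simp [interp]

theorem interp_hi (X : V → ℝ) (e : E) : K.interp X e (K.y (K.hi e)) = X (K.hi e) := by
  have : (0 : ℝ) < K.y (K.hi e) - K.y (K.lo e) := by
    rw [sub_pos]; exact_mod_cast K.lo_lt_hi e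
  rw [interp]
  field_simp
  ring

theorem interp_affine (X : V → ℝ) (e : E) (a b t : ℝ) : (b - a) * K.interp X e t =
    (b - t) * K.interp X e a + (t - a) * K.interp X e b := by
  simp only [interp]
  ring

theorem exists_inRow (X : V → ℝ) {e : E} {q : ℤ} (h₁ : K.y (K.lo e) ≤ q) (h₂ : q ≤ K.y (K.hi e)) :
    ∃ a, K.InRow a q ∧ K.left a ≤ K.x e ∧ K.x e ≤ K.right a ∧ K.place X q a = K.interp X e q ∧
      (a = Sum.inr e ∨ a = Sum.inl (K.lo e) ∨ a = Sum.inl (K.hi e)) := by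
  rcases h₁.eq_or_lt with rfl | h₁
  · exact ⟨Sum.inl (K.lo e), rfl, (K.mem_lo e).1, (K.mem_lo e).2, (interp_lo X e).symm, by simp⟩
  rcases h₂.eq_or_lt with rfl | h₂
  · exact ⟨Sum.inl (K.hi e), rfl, (K.mem_hi e).1, (K.mem_hi e).2, (interp_hi X e).symm, by simp⟩
  exact ⟨Sum.inr e, ⟨h₁, h₂⟩, le_rfl, le_rfl, rfl, by simp⟩

variable {X : V → ℝ} (hX : ∀ a b r, K.InRow a r → K.InRow b r → K.right a < K.left b →
      K.place X r a < K.place X r b)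
include hX

theorem eq_of_place_eq {v w : V} (hx : X v = X w) (hy : K.y v = K.y w) : v = w := by
  by_contra hne
  rcases K.disj v w hne hy with h | h
  · exact (hX (Sum.inl v) (Sum.inl w) _ hy rfl h).ne hx
  · exact (hX (Sum.inl w) (Sum.inl v) _ hy.symm rfl h).ne' hx

theorem interp_lt_or {e f : E} (hef : K.x e < K.x f) {q : ℤ} (h₁ : K.y (K.lo e) ≤ q)
    (h₂ : q ≤ K.y (K.hi e)) (h₃ : K.y (K.lo f) ≤ q) (h₄ : q ≤ K.y (K.hi f)) :
    K.interp X e q < K.interp X f q ∨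
      ∃ w, K.y w = q ∧ (w = K.lo e ∨ w = K.hi e) ∧ (w = K.lo f ∨ w = K.hi f) := by
  obtain ⟨a, ha, ha1, ha2, ha3, ha4⟩ := exists_inRow X h₁ h₂
  obtain ⟨b, hb, hb1, hb2, hb3, hb4⟩ := exists_inRow X h₃ h₄
  rw [← ha3, ← hb3]
  have key : K.right a < K.left b ∨ a = b := by
    rcases a with v | e' <;> rcases b with w | f'
    · by_cases hvw : v = w
      · exact Or.inr (hvw ▸ rfl)
      · left
        have := K.disj v w hvw (ha.trans hb.symm)
        simp only [left, right, Sum.elim_inl] at *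
        omega
    · left
      obtain rfl : f' = f := by simpa using hb4
      obtain rfl : K.y v = q := ha
      have := K.avoid f' v hb.1 hb.2
      simp only [left, right, Sum.elim_inl, Sum.elim_inr] at *
      omega
    · left
      obtain rfl : e' = e := by simpa using ha4
      obtain rfl : K.y w = q := hb
      have := K.avoid e' w ha.1 ha.2
      simp only [left, right, Sum.elim_inl, Sum.elim_inr] at *
      omega
    · left
      simp only [left, right, Sum.elim_inr] at *
      omega
  rcases key with h | rfl
  · exact Or.inl (hX a b q ha hb h)
  · right
    rcases a with v | e'
    · exact ⟨v, ha, by simpa using ha4, by simpa using hb4⟩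
    · simp at ha4 hb4
      subst ha4
      subst hb4
      omega

theorem eq_vertex_of_interp_eq_of_lt {e f : E} (hef : K.x e < K.x f) {t : ℝ}
    (h₁ : K.y (K.lo e) ≤ t) (h₂ : t ≤ K.y (K.hi e)) (h₃ : K.y (K.lo f) ≤ t)
    (h₄ : t ≤ K.y (K.hi f)) (heq : K.interp X e t = K.interp X f t) :
    ∃ w, t = K.y w ∧ (w = K.lo e ∨ w = K.hi e) ∧ (w = K.lo f ∨ w = K.hi f) := by
  set a := max (K.y (K.lo e)) (K.y (K.lo f)) with ha
  set b := min (K.y (K.hi e)) (K.y (K.hi f)) with hb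
  have hat : (a : ℝ) ≤ t := by rw [ha]; push_cast; exact max_le h₁ h₃
  have htb : t ≤ b := by rw [hb]; push_cast; exact le_min h₂ h₄
  have hab : a ≤ b := by exact_mod_cast hat.trans htb
  have hA := interp_lt_or hX hef (q := a) (le_max_left _ _) (hab.trans (min_le_left _ _))
    (le_max_right _ _) (hab.trans (min_le_right _ _))
  have hB := interp_lt_or hX hef (q := b) ((le_max_left _ _).trans hab) (min_le_left _ _)
    ((le_max_right _ _).trans hab) (min_le_right _ _)
  have hcommon : ∀ q : ℤ, (∃ w, K.y w = q ∧ (w = K.lo e ∨ w = K.hi e) ∧ (w = K.lo f ∨ w = K.hi f)) →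
      K.interp X e q = K.interp X f q := by
    rintro q ⟨w, rfl, hwe, hwf⟩
    trans X w
    · rcases hwe with rfl | rfl
      exacts [interp_lo X e, interp_hi X e]
    · rcases hwf with rfl | rfl
      exacts [(interp_lo X f).symm, (interp_hi X f).symm]
  have hne : e ≠ f := by rintro rfl; exact lt_irrefl _ hef
  have e1 := K.interp_affine X e a b t
  have e2 := K.interp_affine X f a b t
  rcases hA with hA | hA
  · rcases hB with hB | hB
    · exfalso
      rcases hat.eq_or_lt with h | h
      · rw [h] at hA; linarith
      · rw [← heq] at e2
        nlinarith
    · obtain rfl : t = b := by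
        have := hcommon b hB
        rw [← heq, ← this] at e2
        have h5 : (b - t) * (K.interp X f a - K.interp X e a) = 0 := by linarith
        rcases mul_eq_zero.1 h5 with h | h <;> linarith
      obtain ⟨w, hw, h⟩ := hB
      exact ⟨w, by rw [hw], h⟩
  · rcases hB with hB | hB
    · obtain rfl : t = a := by
        have := hcommon a hA
        rw [← heq, ← this] at e2
        have h5 : (t - a) * (K.interp X f b - K.interp X e b) = 0 := by linarith
        rcases mul_eq_zero.1 h5 with h | h <;> linarith
      obtain ⟨w, hw, h⟩ := hA
      exact ⟨w, by rw [hw], h⟩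
    · obtain ⟨w, hw, hwe, hwf⟩ := hA
      obtain ⟨w', hw', hwe', hwf'⟩ := hB
      rcases hab.eq_or_lt with h | h
      · refine ⟨w, le_antisymm ?_ ?_, hwe, hwf⟩
        · rw [hw, h]; exact htb
        · rw [hw]; exact hat
      · exfalso
        have := K.lo_lt_hi e
        have := K.lo_lt_hi f
        apply hne
        rcases hwe with rfl | rfl <;> rcases hwe' with h1 | h1 <;> subst h1 <;> try omega
        rcases hwf with h1 | h1 <;> rcases hwf' with h2 | h2
        · rw [h1] at hw; rw [h2] at hw'; omega
        · exact K.simple e f h1 h2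
        · rw [h1] at hw; rw [h2] at hw'; omega
        · rw [h1] at hw; rw [h2] at hw'; omega

theorem eq_vertex_of_interp_eq {e f : E} (hef : e ≠ f) {t : ℝ}
    (h₁ : K.y (K.lo e) ≤ t) (h₂ : t ≤ K.y (K.hi e)) (h₃ : K.y (K.lo f) ≤ t)
    (h₄ : t ≤ K.y (K.hi f)) (heq : K.interp X e t = K.interp X f t) :
    ∃ w, t = K.y w ∧ (w = K.lo e ∨ w = K.hi e) ∧ (w = K.lo f ∨ w = K.hi f) := by
  rcases lt_trichotomy (K.x e) (K.x f) with h | h | h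
  · exact eq_vertex_of_interp_eq_of_lt hX h h₁ h₂ h₃ h₄ heq
  · rcases K.sep e f hef h with h' | h'
    · have h5 : (K.y (K.hi e) : ℝ) ≤ K.y (K.lo f) := by exact_mod_cast h'
      have h6 : t = K.y (K.hi e) := by linarith
      have h7 : t = K.y (K.lo f) := by linarith
      have h8 : K.hi e = K.lo f := by
        apply eq_of_place_eq hX
        · rw [← interp_hi X e, ← interp_lo X f, ← h6, ← h7, heq]
        · exact_mod_cast h6.symm.trans h7
      exact ⟨K.hi e, h6, Or.inr rfl, Or.inl h8⟩
    · have h5 : (K.y (K.hi f) : ℝ) ≤ K.y (K.lo e) := by exact_mod_cast h'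
      have h6 : t = K.y (K.hi f) := by linarith
      have h7 : t = K.y (K.lo e) := by linarith
      have h8 : K.hi f = K.lo e := by
        apply eq_of_place_eq hX
        · rw [← interp_hi X f, ← interp_lo X e, ← h6, ← h7, heq]
        · exact_mod_cast h6.symm.trans h7
      exact ⟨K.lo e, h7, Or.inl rfl, Or.inr h8.symm⟩
  · obtain ⟨w, h5, h6, h7⟩ := eq_vertex_of_interp_eq_of_lt hX h h₃ h₄ h₁ h₂ heq.symm
    exact ⟨w, h5, h7, h6⟩

omit hX in
theorem mem_edge_segment {e : E} {p : ℝ × ℝ}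
    (hp : p ∈ segment ℝ (X (K.lo e), (K.y (K.lo e) : ℝ)) (X (K.hi e), (K.y (K.hi e) : ℝ))) :
    K.y (K.lo e) ≤ p.2 ∧ p.2 ≤ K.y (K.hi e) ∧ p.1 = K.interp X e p.2 := by
  have hpos : (0 : ℝ) < K.y (K.hi e) - K.y (K.lo e) := by
    rw [sub_pos]; exact_mod_cast K.lo_lt_hi e
  obtain ⟨a, b, ha, hb, hab, rfl⟩ := hp
  obtain rfl : a = 1 - b := by linarith
  simp only [Prod.fst_add, Prod.snd_add, Prod.smul_fst, Prod.smul_snd, smul_eq_mul, interp]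
  refine ⟨by nlinarith, by nlinarith, ?_⟩
  field_simp
  ring

omit hX in
theorem mem_horizontal_segment {a b c : ℝ} (hab : a ≤ b) {p : ℝ × ℝ}
    (hp : p ∈ segment ℝ (a, c) (b, c)) : p.2 = c ∧ a ≤ p.1 ∧ p.1 ≤ b := by
  obtain ⟨s, t, hs, ht, hst, rfl⟩ := hp
  obtain rfl : s = 1 - t := by linarith
  simp only [Prod.fst_add, Prod.snd_add, Prod.smul_fst, Prod.smul_snd, smul_eq_mul]
  exact ⟨by ring, by nlinarith, by nlinarith⟩

end RowVis

open RowVis in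
/-- A graph represented by a visibility representation on the grid has a straight-line drawing
of the same height. -/
theorem RowVis.exists_straightDrawing {V E : Type} [Finite V] [Finite E] (K : RowVis V E)
    (G : SimpleGraph V) (hE : ∀ u v, G.Adj u v → K.y u < K.y v → ∃ e, K.lo e = u ∧ K.hi e = v)
    (hV : ∀ u v, G.Adj u v → K.y u = K.y v → K.r u < K.l v →
      ∀ a, K.InRow a (K.y u) → K.r u < K.left a → ¬ K.right a < K.l v)
    (h : ℕ) (hh : K.h = h) : ∃ Γ : StraightDrawing G, Γ.IsPlanar ∧ Γ.HeightLe h := by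
  obtain ⟨X, hX⟩ := K.exists_straight
  let Γ : StraightDrawing G := ⟨fun v => (X v, K.y v), fun v w hvw => by
    obtain ⟨h1, h2⟩ := Prod.mk.inj hvw
    exact eq_of_place_eq hX h1 (by exact_mod_cast h2)⟩
  have hcases : ∀ e ∈ G.edgeSet, (∃ f, e = s(K.lo f, K.hi f)) ∨
      ∃ u v, e = s(u, v) ∧ G.Adj u v ∧ K.y u = K.y v ∧ K.r u < K.l v := by
    intro e
    induction e using Sym2.ind with
    | _ u v =>
      intro he
      rw [SimpleGraph.mem_edgeSet] at he
      rcases lt_trichotomy (K.y u) (K.y v) with h1 | h1 | h1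
      · obtain ⟨f, rfl, rfl⟩ := hE u v he h1
        exact Or.inl ⟨f, rfl⟩
      · right
        rcases K.disj u v he.ne h1 with h2 | h2
        · exact ⟨u, v, rfl, he, h1, h2⟩
        · exact ⟨v, u, Sym2.eq_swap, he.symm, h1.symm, h2⟩
      · obtain ⟨f, rfl, rfl⟩ := hE v u he.symm h1
        exact Or.inl ⟨f, Sym2.eq_swap⟩
  have hlt : ∀ u v, K.y u = K.y v → K.r u < K.l v → X u < X v := fun u v h1 h2 =>
    hX (Sum.inl u) (Sum.inl v) _ h1 rfl h2
  have hsegE : ∀ f p, p ∈ Γ.edgePts s(K.lo f, K.hi f) →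
      K.y (K.lo f) ≤ p.2 ∧ p.2 ≤ K.y (K.hi f) ∧ p.1 = K.interp X f p.2 :=
    fun f p hp => mem_edge_segment hp
  have hsegH : ∀ u v p, K.y u = K.y v → K.r u < K.l v → p ∈ Γ.edgePts s(u, v) →
      p.2 = K.y u ∧ X u ≤ p.1 ∧ p.1 ≤ X v := by
    intro u v p h1 h2 hp
    change p ∈ segment ℝ (X u, (K.y u : ℝ)) (X v, (K.y v : ℝ)) at hp
    rw [← h1] at hp
    exact mem_horizontal_segment (hlt u v h1 h2).le hp
  have hbetween : ∀ u v w, G.Adj u v → K.y u = K.y v → K.r u < K.l v → K.y w = K.y u →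
      X u ≤ X w → X w ≤ X v → w = u ∨ w = v := by
    intro u v w ha h1 h2 h3 h4 h5
    by_contra hcon
    push Not at hcon
    have h6 : K.r u < K.l w := by
      refine (K.disj w u hcon.1 h3).resolve_left fun h => ?_
      have := hlt w u h3 h
      linarith
    have h7 : K.r w < K.l v := by
      refine (K.disj w v hcon.2 (h3.trans h1)).resolve_right fun h => ?_
      have := hlt v w (h3.trans h1).symm h
      linarith
    exact hV u v ha h1 h2 (Sum.inl w) h3 h6 h7
  have hvert : ∀ v : V, ∀ e ∈ G.edgeSet, v ∉ e → Γ.pos v ∉ Γ.edgePts e := by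
    intro v e he hve hp
    apply hve
    rcases hcases e he with ⟨f, rfl⟩ | ⟨u, w, rfl, ha, h1, h2⟩
    · obtain ⟨h1, h2, h3⟩ := hsegE f _ hp
      replace h1 : K.y (K.lo f) ≤ K.y v := Int.cast_le.1 h1
      replace h2 : K.y v ≤ K.y (K.hi f) := Int.cast_le.1 h2
      replace h3 : X v = K.interp X f (K.y v) := h3
      rw [Sym2.mem_iff]
      rcases h1.eq_or_lt with h4 | h4
      · left
        rw [← h4, interp_lo] at h3
        exact eq_of_place_eq hX h3 h4.symm
      rcases h2.eq_or_lt with h5 | h5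
      · right
        rw [h5, interp_hi] at h3
        exact eq_of_place_eq hX h3 h5
      exfalso
      rcases K.avoid f v h4 h5 with h6 | h6
      · exact (hX (Sum.inr f) (Sum.inl v) (K.y v) ⟨h4, h5⟩ rfl h6).ne' h3
      · exact (hX (Sum.inl v) (Sum.inr f) (K.y v) rfl ⟨h4, h5⟩ h6).ne h3
    · obtain ⟨h3, h4, h5⟩ := hsegH u w _ h1 h2 hp
      rw [Sym2.mem_iff]
      exact hbetween u w v ha h1 h2 (Int.cast_injective h3) h4 h5
  have hEH : ∀ f u v p, G.Adj u v → K.y u = K.y v → K.r u < K.l v → p ∈ Γ.edgePts s(u, v) →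
      p ∈ Γ.edgePts s(K.lo f, K.hi f) → ∃ w, w ∈ s(K.lo f, K.hi f) ∧ w ∈ s(u, v) ∧ p = Γ.pos w := by
    intro f u v p ha h1 h2 hp hp'
    obtain ⟨h3, h4, h5⟩ := hsegH u v p h1 h2 hp
    obtain ⟨h6, h7, h8⟩ := hsegE f p hp'
    rw [h3] at h6 h7 h8
    have h6' : K.y (K.lo f) ≤ K.y u := by exact_mod_cast h6
    have h7' : K.y u ≤ K.y (K.hi f) := by exact_mod_cast h7
    have hdone : ∀ w, w ∈ s(K.lo f, K.hi f) → p = Γ.pos w →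
        ∃ w, w ∈ s(K.lo f, K.hi f) ∧ w ∈ s(u, v) ∧ p = Γ.pos w := by
      intro w hw hpw
      refine ⟨w, hw, ?_, hpw⟩
      by_contra hc
      exact hvert w s(u, v) ha hc (hpw ▸ hp)
    rcases h6'.eq_or_lt with h9 | h9
    · refine hdone (K.lo f) (by simp) (Prod.ext ?_ ?_)
      · rw [h8, ← h9, interp_lo]
      · rw [h3, ← h9]
    rcases h7'.eq_or_lt with h10 | h10
    · refine hdone (K.hi f) (by simp) (Prod.ext ?_ ?_)
      · rw [h8, h10, interp_hi]
      · rw [h3, h10]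
    exfalso
    have hcr : K.Crosses f (K.y u) := ⟨h9, h10⟩
    refine hV u v ha h1 h2 (Sum.inr f) hcr ?_ ?_
    · refine (K.avoid f u h9 h10).resolve_left fun h11 => ?_
      have : K.interp X f (K.y u) < X u := hX (Sum.inr f) (Sum.inl u) (K.y u) hcr rfl h11
      linarith
    · refine (K.avoid f v (h1 ▸ h9) (h1 ▸ h10)).resolve_right fun h11 => ?_
      have : X v < K.interp X f (K.y u) := hX (Sum.inl v) (Sum.inr f) (K.y u) h1.symm hcr h11
      linarith
  refine ⟨Γ, ⟨hvert, ?_⟩, fun v => ⟨K.y v, K.one_le v, hh ▸ K.le_h v, rfl⟩⟩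
  rintro e he f hf hef p ⟨hpe, hpf⟩
  rcases hcases e he with ⟨e, rfl⟩ | ⟨u, v, rfl, ha, h1, h2⟩ <;>
    rcases hcases f hf with ⟨f, rfl⟩ | ⟨u', v', rfl, ha', h1', h2'⟩
  · obtain ⟨h1, h2, h3⟩ := hsegE e p hpe
    obtain ⟨h4, h5, h6⟩ := hsegE f p hpf
    obtain ⟨w, hw, hwe, hwf⟩ := eq_vertex_of_interp_eq hX (e := e) (f := f)
      (by rintro rfl; exact hef rfl) h1 h2 h4 h5 (h3.symm.trans h6)
    refine ⟨w, Sym2.mem_iff.2 hwe, Sym2.mem_iff.2 hwf, Prod.ext ?_ hw⟩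
    rw [h3, hw]
    rcases hwe with rfl | rfl
    exacts [interp_lo X e, interp_hi X e]
  · exact hEH e u' v' p ha' h1' h2' hpf hpe
  · obtain ⟨w, h3, h4, h5⟩ := hEH f u v p ha h1 h2 hpe hpf
    exact ⟨w, h4, h3, h5⟩
  · obtain ⟨h3, h4, h5⟩ := hsegH u v p h1 h2 hpe
    obtain ⟨h3', h4', h5'⟩ := hsegH u' v' p h1' h2' hpf
    have hy : K.y u = K.y u' := by exact_mod_cast h3.symm.trans h3'
    have hXlt := hlt u v h1 h2
    have hXlt' := hlt u' v' h1' h2'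
    rcases le_total (X u) (X u') with h6 | h6
    · rcases hbetween u v u' ha h1 h2 hy.symm h6 (h4'.trans h5) with rfl | rfl
      · rcases le_total (X v) (X v') with h7 | h7
        · rcases hbetween u' v' v ha' h1' h2' h1.symm hXlt.le h7 with rfl | rfl
          · exact absurd hXlt (lt_irrefl _)
          · exact absurd rfl hef
        · rcases hbetween u' v v' ha h1 h2 h1'.symm hXlt'.le h7 with rfl | rfl
          · exact absurd hXlt' (lt_irrefl _)
          · exact absurd rfl hef
      · exact ⟨u', by simp, by simp, Prod.ext (le_antisymm h5 h4') h3'⟩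
    · rcases hbetween u' v' u ha' h1' h2' hy h6 (h4.trans h5') with rfl | rfl
      · rcases le_total (X v) (X v') with h7 | h7
        · rcases hbetween u v' v ha' h1' h2' h1.symm hXlt.le h7 with rfl | rfl
          · exact absurd hXlt (lt_irrefl _)
          · exact absurd rfl hef
        · rcases hbetween u v v' ha h1 h2 h1'.symm hXlt'.le h7 with rfl | rfl
          · exact absurd hXlt' (lt_irrefl _)
          · exact absurd rfl hef
      · exact ⟨u, by simp, by simp, Prod.ext (le_antisymm h5' h4) h3⟩

theorem mk_mem_segment_horizontal {a b c x : ℝ} (h : x ∈ Icc a b) : (x, c) ∈ segment ℝ (a, c) (b, c) := by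
  rw [← Prod.image_mk_segment_left, segment_eq_Icc (h.1.trans h.2)]
  exact ⟨x, h, rfl⟩

theorem mk_mem_segment_vertical {a b c x : ℝ} (h : x ∈ Icc a b) : (c, x) ∈ segment ℝ (c, a) (c, b) := by
  rw [← Prod.image_mk_segment_right, segment_eq_Icc (h.1.trans h.2)]
  exact ⟨x, h, rfl⟩

/-- The number of elements of `C` below `x`. -/
def rankIn (C : Finset ℝ) (x : ℝ) : ℤ := (C.filter (· < x)).card

theorem rankIn_mono (C : Finset ℝ) {x y : ℝ} (h : x ≤ y) : rankIn C x ≤ rankIn C y := by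
  refine Int.ofNat_le.2 (Finset.card_le_card ?_)
  intro z
  simp only [Finset.mem_filter]
  exact fun hz => ⟨hz.1, hz.2.trans_le h⟩

theorem rankIn_lt {C : Finset ℝ} {x y : ℝ} (hx : x ∈ C) : rankIn C x < rankIn C y ↔ x < y := by
  constructor
  · intro h
    by_contra hc
    exact absurd (rankIn_mono C (not_lt.1 hc)) (not_le.2 h)
  · intro h
    refine Int.ofNat_lt.2 (Finset.card_lt_card ⟨?_, fun hsub => ?_⟩)
    · intro z
      simp only [Finset.mem_filter]
      exact fun hz => ⟨hz.1, hz.2.trans h⟩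
    · have := hsub (Finset.mem_filter.2 ⟨hx, h⟩)
      exact lt_irrefl _ (Finset.mem_filter.1 this).2

theorem rankIn_inj {C : Finset ℝ} {x y : ℝ} (hx : x ∈ C) (hy : y ∈ C)
    (h : rankIn C x = rankIn C y) : x = y := by
  rcases lt_trichotomy x y with h' | h' | h'
  · exact absurd h ((rankIn_lt hx).2 h').ne
  · exact h'
  · exact absurd h ((rankIn_lt hy).2 h').ne'

theorem IsFlatVisRep.exists_ends {V : Type} {G : SimpleGraph V} {D : VisData V} {h : ℕ}
    (hD : IsFlatVisRep G D h) {u v : V} (huv : G.Adj u v) :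
    ∃ P Q, D.eseg s(u, v) = segment ℝ P Q ∧
      (∀ p, p = D.ep1 s(u, v) ∨ p = D.ep2 s(u, v) → p = P ∨ p = Q) ∧
      (P.2 = D.ly u ∧ D.lx u ≤ P.1 ∧ P.1 ≤ D.rx u) ∧ (Q.2 = D.ly v ∧ D.lx v ≤ Q.1 ∧ Q.1 ≤ D.rx v) ∧
      (P.1 = Q.1 ∨ P.2 = Q.2) := by
  obtain ⟨h1, h2, h3, h4, h5, h6, h7, h8⟩ := hD
  have hal := h3 s(u, v) huv
  rcases h5 u v huv with ⟨hu, hv⟩ | ⟨hv, hu⟩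
  · exact ⟨D.ep1 s(u, v), D.ep2 s(u, v), rfl, fun p hp => hp,
      RowVis.mem_horizontal_segment (h1 u) hu, RowVis.mem_horizontal_segment (h1 v) hv, hal⟩
  · exact ⟨D.ep2 s(u, v), D.ep1 s(u, v), segment_symm _ _ _, fun p hp => hp.symm,
      RowVis.mem_horizontal_segment (h1 u) hu, RowVis.mem_horizontal_segment (h1 v) hv,
      hal.imp Eq.symm Eq.symm⟩

theorem IsFlatVisRep.exists_straightDrawing {V : Type} [Finite V] {G : SimpleGraph V} {D : VisData V}
    {h : ℕ} (hD : IsFlatVisRep G D h) : ∃ Γ : StraightDrawing G, Γ.IsPlanar ∧ Γ.HeightLe h := by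
  classical
  cases nonempty_fintype V
  obtain ⟨hlr, hy, -, -, -, hdisj, hvert, hedge⟩ := id hD
  choose y hy1 hyh hy using hy
  let E := {p : V × V // G.Adj p.1 p.2 ∧ y p.1 < y p.2}
  have hends : ∀ e : E, ∃ c : ℝ,
      D.eseg s(e.1.1, e.1.2) = segment ℝ (c, (y e.1.1 : ℝ)) (c, (y e.1.2 : ℝ)) ∧
      (∀ p, p = D.ep1 s(e.1.1, e.1.2) ∨ p = D.ep2 s(e.1.1, e.1.2) → p.2 = y e.1.1 ∨ p.2 = y e.1.2) ∧
      (D.lx e.1.1 ≤ c ∧ c ≤ D.rx e.1.1) ∧ D.lx e.1.2 ≤ c ∧ c ≤ D.rx e.1.2 := by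
    rintro ⟨⟨u, v⟩, ha, hlt⟩
    obtain ⟨⟨P1, P2⟩, ⟨Q1, Q2⟩, h1, h2, ⟨h3, h3'⟩, ⟨h4, h4'⟩, h5⟩ := hD.exists_ends ha
    simp only at *
    rw [hy] at h3 h4
    subst h3
    subst h4
    have : (y u : ℝ) < y v := by exact_mod_cast hlt
    have h6 := h5.resolve_right this.ne
    subst h6
    refine ⟨P1, h1, fun p hp => ?_, h3', h4'⟩
    rcases h2 p hp with rfl | rfl
    exacts [Or.inl rfl, Or.inr rfl]
  choose x hseg hep hlo hhi using hends
  have : Finite E := inferInstanceAs (Finite {p : V × V // G.Adj p.1 p.2 ∧ y p.1 < y p.2})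
  cases nonempty_fintype E
  have hne : ∀ e f : E, e ≠ f → s(e.1.1, e.1.2) ≠ s(f.1.1, f.1.2) := by
    rintro ⟨⟨u, v⟩, ha, hlt⟩ ⟨⟨u', v'⟩, ha', hlt'⟩ hne heq
    rcases Sym2.eq_iff.1 heq with ⟨h1, h2⟩ | ⟨h1, h2⟩ <;> simp only at * <;> subst h1 <;> subst h2
    · exact hne rfl
    · exact lt_asymm hlt hlt'
  have hmem : ∀ (e : E) (t : ℝ), y e.1.1 ≤ t → t ≤ y e.1.2 → (x e, t) ∈ D.eseg s(e.1.1, e.1.2) := by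
    intro e t h1 h2
    rw [hseg]
    exact mk_mem_segment_vertical ⟨h1, h2⟩
  have hvmem : ∀ (v : V) (c : ℝ), D.lx v ≤ c → c ≤ D.rx v → (c, (y v : ℝ)) ∈ D.vseg v := by
    intro v c h1 h2
    rw [VisData.vseg, hy]
    exact mk_mem_segment_horizontal ⟨h1, h2⟩
  let C : Finset ℝ := Finset.univ.image D.lx ∪ Finset.univ.image D.rx ∪ Finset.univ.image x
  have hCl : ∀ v, D.lx v ∈ C := fun v => by simp [C]
  have hCr : ∀ v, D.rx v ∈ C := fun v => by simp [C]
  have hCx : ∀ e, x e ∈ C := fun e => by simp [C]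
  let K : RowVis V E :=
    { y := y
      l := fun v => rankIn C (D.lx v)
      r := fun v => rankIn C (D.rx v)
      x := fun e => rankIn C (x e)
      lo := fun e => e.1.1
      hi := fun e => e.1.2
      h := h
      one_le := hy1
      le_h := hyh
      l_le_r := fun v => rankIn_mono C (hlr v)
      lo_lt_hi := fun e => e.2.2
      disj := by
        intro v w hvw hyy
        rw [rankIn_lt (hCr v), rankIn_lt (hCr w)]
        by_contra hc
        push Not at hc
        refine Set.disjoint_left.1 (hdisj v w hvw)
          (hvmem v (max (D.lx v) (D.lx w)) (le_max_left _ _) (max_le (hlr v) hc.1)) ?_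
        rw [hyy]
        exact hvmem w _ (le_max_right _ _) (max_le hc.2 (hlr w))
      mem_lo := fun e => ⟨rankIn_mono C (hlo e).1, rankIn_mono C (hlo e).2⟩
      mem_hi := fun e => ⟨rankIn_mono C (hhi e).1, rankIn_mono C (hhi e).2⟩
      avoid := by
        intro e v h1 h2
        rw [rankIn_lt (hCr v), rankIn_lt (hCx e)]
        by_contra hc
        push Not at hc
        have h3 := hep e _ (hvert _ e.2.1 v (x e, y v)
          ⟨hmem e _ (by exact_mod_cast h1.le) (by exact_mod_cast h2.le), hvmem v _ hc.1 hc.2⟩)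
        simp only [Int.cast_inj] at h3
        omega
      sep := by
        intro e f hef hxx
        replace hxx := rankIn_inj (hCx e) (hCx f) hxx
        by_contra hc
        push Not at hc
        obtain ⟨t, ht1, ht2⟩ := exists_between (show max (y e.1.1 : ℝ) (y f.1.1) < min (y e.1.2 : ℝ) (y f.1.2)
          from max_lt (lt_min (by exact_mod_cast e.2.2) (by exact_mod_cast hc.2))
            (lt_min (by exact_mod_cast hc.1) (by exact_mod_cast f.2.2)))
        rw [max_lt_iff] at ht1
        rw [lt_min_iff] at ht2
        have h3 := hep e _ (hedge _ e.2.1 _ f.2.1 (hne e f hef) (x e, t)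
          ⟨hmem e _ ht1.1.le ht2.1.le, by rw [hxx]; exact hmem f _ ht1.2.le ht2.2.le⟩).1
        rcases h3 with h3 | h3
        exacts [ht1.1.ne' h3, ht2.1.ne h3]
      simple := fun e f h1 h2 => Subtype.ext (Prod.ext h1 h2) }
  refine K.exists_straightDrawing G (fun u v ha hlt => ⟨⟨(u, v), ha, hlt⟩, rfl, rfl⟩) ?_ h rfl
  intro u v ha hyy huv a haq h1 h2
  replace huv : D.rx u < D.lx v := (rankIn_lt (hCr u)).1 huv
  obtain ⟨⟨P1, P2⟩, ⟨Q1, Q2⟩, h3, h4, ⟨h5, h5'⟩, ⟨h6, h6'⟩, -⟩ := hD.exists_ends ha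
  simp only at *
  have hyy' : y u = y v := hyy
  rw [hy] at h5 h6
  rw [← hyy'] at h6
  subst h5
  subst h6
  have hum : ∀ c, D.rx u < c → c < D.lx v → (c, (y u : ℝ)) ∈ D.eseg s(u, v) := by
    intro c h7 h8
    rw [h3]
    exact mk_mem_segment_horizontal ⟨by linarith, by linarith⟩
  rcases a with w | e
  · replace h1 : D.rx u < D.lx w := (rankIn_lt (hCr u)).1 h1
    replace h2 : D.rx w < D.lx v := (rankIn_lt (hCr w)).1 h2
    have hw : y w = y u := haq
    have hlw := hlr w
    have h7 := h4 _ (hvert _ ha w (D.lx w, y u) ⟨hum _ h1 (by linarith), by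
      rw [← hw]; exact hvmem w _ le_rfl hlw⟩)
    rcases h7 with h7 | h7 <;> have h8 := congrArg Prod.fst h7 <;> simp only at h8 <;> linarith
  · replace h1 : D.rx u < x e := (rankIn_lt (hCr u)).1 h1
    replace h2 : x e < D.lx v := (rankIn_lt (hCx e)).1 h2
    have hc1 : y e.1.1 < y u := haq.1
    have hc2 : y u < y e.1.2 := haq.2
    have hneq : s(e.1.1, e.1.2) ≠ s(u, v) := by
      intro heq
      rcases Sym2.eq_iff.1 heq with ⟨h8, h9⟩ | ⟨h8, h9⟩ <;> rw [h8] at hc1 <;> omega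
    have h7 := hep e _ (hedge _ e.2.1 _ ha hneq (x e, y u)
      ⟨hmem e _ (by exact_mod_cast hc1.le) (by exact_mod_cast hc2.le), hum _ h1 h2⟩).1
    simp only [Int.cast_inj] at h7
    omega

/-- Curves over intervals that do not cross can be ordered consistently from left to right. -/
theorem exists_order_of_noncrossing {O : Type*} [Finite O] (lo hi : O → ℝ) (X : O → ℝ → ℝ)
    (hX : ∀ a b t s, t ∈ Icc (lo a) (hi a) → t ∈ Icc (lo b) (hi b) → s ∈ Icc (lo a) (hi a) →
      s ∈ Icc (lo b) (hi b) → X a t < X b t → X a s ≤ X b s) :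
    ∃ f : O → ℝ, ∀ a b t, t ∈ Icc (lo a) (hi a) → t ∈ Icc (lo b) (hi b) → X a t < X b t →
      f a < f b := by
  classical
  cases nonempty_fintype O
  suffices H : ∀ s : Finset O, ∃ f : O → ℝ, ∀ a ∈ s, ∀ b ∈ s, ∀ t, t ∈ Icc (lo a) (hi a) →
      t ∈ Icc (lo b) (hi b) → X a t < X b t → f a < f b by
    obtain ⟨f, hf⟩ := H Finset.univ
    exact ⟨f, fun a b => hf a (Finset.mem_univ _) b (Finset.mem_univ _)⟩
  intro s
  induction s using Finset.induction_on_max_value lo with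
  | empty => exact ⟨0, by simp⟩
  | insert z s hz hmax ih =>
    obtain ⟨f, hf⟩ := ih
    obtain ⟨c, hc₁, hc₂⟩ := Order.exists_between_finsets
      (lo := (s.filter fun a => ∃ t, t ∈ Icc (lo a) (hi a) ∧ t ∈ Icc (lo z) (hi z) ∧
        X a t < X z t).image f)
      (hi := (s.filter fun b => ∃ t, t ∈ Icc (lo z) (hi z) ∧ t ∈ Icc (lo b) (hi b) ∧
        X z t < X b t).image f) (by
        simp only [Finset.mem_image, Finset.mem_filter]
        rintro _ ⟨a, ⟨ha, t, hta, htz, hlt⟩, rfl⟩ _ ⟨b, ⟨hb, t', htz', htb', hlt'⟩, rfl⟩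
        have h1 := hmax a ha
        have h2 := hmax b hb
        rcases le_total t t' with h | h
        · have htb : t ∈ Icc (lo b) (hi b) := ⟨h2.trans htz.1, h.trans htb'.2⟩
          exact hf a ha b hb t hta htb (hlt.trans_le (hX z b t' t htz' htb' htz htb hlt'))
        · have hta' : t' ∈ Icc (lo a) (hi a) := ⟨h1.trans htz'.1, h.trans hta.2⟩
          exact hf a ha b hb t' hta' htb' ((hX a z t t' hta htz hta' htz' hlt).trans_lt hlt'))
    refine ⟨Function.update f z c, ?_⟩
    intro a ha b hb t hta htb hlt
    rw [Finset.mem_insert] at ha hb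
    rcases ha with rfl | ha <;> rcases hb with rfl | hb
    · exact absurd hlt (lt_irrefl _)
    · rw [Function.update_self, Function.update_of_ne (by rintro rfl; exact hz hb)]
      exact hc₂ _ (Finset.mem_image_of_mem _ (Finset.mem_filter.2 ⟨hb, t, hta, htb, hlt⟩))
    · rw [Function.update_self, Function.update_of_ne (by rintro rfl; exact hz ha)]
      exact hc₁ _ (Finset.mem_image_of_mem _ (Finset.mem_filter.2 ⟨ha, t, hta, htb, hlt⟩))
    · rw [Function.update_of_ne (by rintro rfl; exact hz ha),
        Function.update_of_ne (by rintro rfl; exact hz hb)]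
      exact hf a ha b hb t hta htb hlt

/-- The abscissa at height `t` of the line through `P` and `Q`. -/
def lineAbscissa (P Q : Pt) (t : ℝ) : ℝ := P.1 + (t - P.2) * ((Q.1 - P.1) / (Q.2 - P.2))

theorem lineAbscissa_left (P Q : Pt) : lineAbscissa P Q P.2 = P.1 := by simp [lineAbscissa]

theorem lineAbscissa_right {P Q : Pt} (h : P.2 < Q.2) : lineAbscissa P Q Q.2 = Q.1 := by
  have : 0 < Q.2 - P.2 := sub_pos.2 h
  rw [lineAbscissa]
  field_simp
  ring

theorem lineAbscissa_mem {P Q : Pt} (h : P.2 < Q.2) {t : ℝ} (ht : t ∈ Icc P.2 Q.2) :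
    (lineAbscissa P Q t, t) ∈ segment ℝ P Q := by
  have h0 : 0 < Q.2 - P.2 := sub_pos.2 h
  refine ⟨1 - (t - P.2) / (Q.2 - P.2), (t - P.2) / (Q.2 - P.2), ?_, ?_, by ring, ?_⟩
  · rw [sub_nonneg, div_le_one h0]
    linarith [ht.2]
  · exact div_nonneg (by linarith [ht.1]) h0.le
  · refine Prod.ext ?_ ?_
    · simp only [Prod.fst_add, Prod.smul_fst, smul_eq_mul, lineAbscissa]
      ring
    · simp only [Prod.snd_add, Prod.smul_snd, smul_eq_mul]
      field_simp
      ring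

theorem lineAbscissa_exists_eq {P Q P' Q' : Pt} {t s : ℝ}
    (ht : lineAbscissa P Q t < lineAbscissa P' Q' t)
    (hs : lineAbscissa P' Q' s < lineAbscissa P Q s) :
    ∃ r, min t s < r ∧ r < max t s ∧ lineAbscissa P Q r = lineAbscissa P' Q' r := by
  set g := fun r => lineAbscissa P Q r - lineAbscissa P' Q' r with hg
  have hcont : ContinuousOn g (uIcc t s) := by
    refine Continuous.continuousOn ?_
    simp only [hg, lineAbscissa]
    fun_prop
  obtain ⟨r, hr, h0⟩ := intermediate_value_uIcc hcont (show (0 : ℝ) ∈ uIcc (g t) (g s) from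
    mem_uIcc.2 (Or.inl ⟨by simp only [hg]; linarith, by simp only [hg]; linarith⟩))
  have hrt : r ≠ t := by rintro rfl; simp only [hg] at h0; linarith
  have hrs : r ≠ s := by rintro rfl; simp only [hg] at h0; linarith
  rw [uIcc, mem_Icc] at hr
  refine ⟨r, lt_of_le_of_ne hr.1 fun h => ?_, lt_of_le_of_ne hr.2 fun h => ?_, sub_eq_zero.1 h0⟩
  · rcases min_choice t s with h' | h' <;> rw [h'] at h
    exacts [hrt h.symm, hrs h.symm]
  · rcases max_choice t s with h' | h' <;> rw [h'] at h
    exacts [hrt h, hrs h]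

theorem mem_vertical_segment {a b c : ℝ} (hab : a ≤ b) {p : ℝ × ℝ}
    (hp : p ∈ segment ℝ (c, a) (c, b)) : p.1 = c ∧ a ≤ p.2 ∧ p.2 ≤ b := by
  obtain ⟨s, t, hs, ht, hst, rfl⟩ := hp
  obtain rfl : s = 1 - t := by linarith
  simp only [Prod.fst_add, Prod.snd_add, Prod.smul_fst, Prod.smul_snd, smul_eq_mul]
  exact ⟨by ring, by nlinarith, by nlinarith⟩

theorem StraightDrawing.exists_isFlatVisRep {V : Type} [Finite V] {G : SimpleGraph V}
    (Γ : StraightDrawing G) (hΓ : Γ.IsPlanar) {h : ℕ} (hh : Γ.HeightLe h) :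
    ∃ D : VisData V, IsFlatVisRep G D h := by
  classical
  cases nonempty_fintype V
  obtain ⟨hvert, hedge⟩ := hΓ
  set x : V → ℝ := fun v => (Γ.pos v).1 with hx
  set y : V → ℝ := fun v => (Γ.pos v).2 with hy
  have hinj : ∀ u v, x u = x v → y u = y v → u = v := fun u v h1 h2 =>
    Γ.pos_inj (Prod.ext h1 h2)
  let O := {p : V × V // p.1 = p.2 ∨ (G.Adj p.1 p.2 ∧ y p.1 < y p.2)}
  have : Finite O := inferInstanceAs (Finite {p : V × V // p.1 = p.2 ∨ (G.Adj p.1 p.2 ∧ y p.1 < y p.2)})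
  cases nonempty_fintype O
  let X : O → ℝ → ℝ := fun o => lineAbscissa (Γ.pos o.1.1) (Γ.pos o.1.2)
  let active : O → Set ℝ := fun o => Icc (y o.1.1) (y o.1.2)
  have hadj : ∀ o : O, y o.1.1 < y o.1.2 → s(o.1.1, o.1.2) ∈ G.edgeSet := by
    rintro ⟨⟨u, v⟩, huv | huv⟩ hlt
    · exact absurd (congrArg y huv) hlt.ne
    · exact huv.1
  have hXmem : ∀ (o : O) t, y o.1.1 < y o.1.2 → t ∈ active o →
      (X o t, t) ∈ Γ.edgePts s(o.1.1, o.1.2) := fun o t h1 h2 => lineAbscissa_mem h1 h2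
  have hXv : ∀ (o : O) v, v = o.1.1 ∨ v = o.1.2 → y v ∈ active o ∧ X o (y v) = x v := by
    rintro ⟨⟨u, w⟩, h1⟩ v h2
    rcases h1 with h1 | ⟨_, h1⟩
    · simp only at h1
      subst h1
      obtain rfl : v = u := by simpa using h2
      exact ⟨⟨le_rfl, le_rfl⟩, lineAbscissa_left _ _⟩
    · rcases h2 with rfl | rfl
      · exact ⟨⟨le_rfl, h1.le⟩, lineAbscissa_left _ _⟩
      · exact ⟨⟨h1.le, le_rfl⟩, lineAbscissa_right h1⟩
  have hmeet : ∀ (o o' : O) t, o ≠ o' → y o.1.1 < y o.1.2 → y o'.1.1 < y o'.1.2 → t ∈ active o →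
      t ∈ active o' → X o t = X o' t → t = y o.1.1 ∨ t = y o.1.2 := by
    intro o o' t hne h1 h2 h3 h4 h5
    have hne' : s(o.1.1, o.1.2) ≠ s(o'.1.1, o'.1.2) := by
      intro heq
      rcases Sym2.eq_iff.1 heq with ⟨h6, h7⟩ | ⟨h6, h7⟩
      · exact hne (Subtype.ext (Prod.ext h6 h7))
      · rw [h6, h7] at h1
        exact lt_asymm h1 h2
    obtain ⟨w, hw, -, hpw⟩ := hedge _ (hadj o h1) _ (hadj o' h2) hne' (X o t, t)
      ⟨hXmem o t h1 h3, by rw [h5]; exact hXmem o' t h2 h4⟩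
    have h6 : t = y w := congrArg Prod.snd hpw
    rcases Sym2.mem_iff.1 hw with rfl | rfl
    exacts [Or.inl h6, Or.inr h6]
  obtain ⟨f, hf⟩ := exists_order_of_noncrossing (O := O) (fun o => y o.1.1) (fun o => y o.1.2) X (by
    intro a b t s hta htb hsa hsb hlt
    by_contra hc
    push Not at hc
    obtain ⟨r, hr1, hr2, hr⟩ := lineAbscissa_exists_eq hlt hc
    have hne : a ≠ b := by rintro rfl; exact lt_irrefl _ hlt
    have ha1 := (le_min hta.1 hsa.1).trans_lt hr1
    have ha2 := hr2.trans_le (max_le hta.2 hsa.2)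
    have hb1 := (le_min htb.1 hsb.1).trans_lt hr1
    have hb2 := hr2.trans_le (max_le htb.2 hsb.2)
    rcases hmeet a b r hne (ha1.trans ha2) (hb1.trans hb2) ⟨ha1.le, ha2.le⟩ ⟨hb1.le, hb2.le⟩ hr with h | h
    exacts [ha1.ne' h, ha2.ne h])
  replace hf : ∀ a b t, t ∈ active a → t ∈ active b → X a t < X b t → f a < f b := hf
  let inc : V → Finset O := fun v => Finset.univ.filter fun o => v = o.1.1 ∨ v = o.1.2
  have hinc : ∀ v (o : O), o ∈ inc v ↔ v = o.1.1 ∨ v = o.1.2 := by simp [inc]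
  have hne : ∀ v, (inc v).Nonempty := fun v => ⟨⟨(v, v), Or.inl rfl⟩, by simp [inc]⟩
  let l : V → ℝ := fun v => (inc v).inf' (hne v) f
  let r : V → ℝ := fun v => (inc v).sup' (hne v) f
  have hl : ∀ v (o : O), v = o.1.1 ∨ v = o.1.2 → l v ≤ f o := fun v o ho =>
    Finset.inf'_le f ((hinc v o).2 ho)
  have hr : ∀ v (o : O), v = o.1.1 ∨ v = o.1.2 → f o ≤ r v := fun v o ho =>
    Finset.le_sup' f ((hinc v o).2 ho)
  have hlr : ∀ v, l v ≤ r v := fun v =>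
    (hl v ⟨(v, v), Or.inl rfl⟩ (Or.inl rfl)).trans (hr v ⟨(v, v), Or.inl rfl⟩ (Or.inl rfl))
  have hlt_l : ∀ (o : O) v, y v ∈ active o → X o (y v) < x v → f o < l v := by
    intro o v h1 h2
    refine (Finset.lt_inf'_iff _).2 fun o' ho' => ?_
    obtain ⟨h3, h4⟩ := hXv o' v ((hinc v o').1 ho')
    exact hf o o' (y v) h1 h3 (by rwa [h4])
  have hr_lt : ∀ (o : O) v, y v ∈ active o → x v < X o (y v) → r v < f o := by
    intro o v h1 h2
    refine (Finset.sup'_lt_iff _).2 fun o' ho' => ?_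
    obtain ⟨h3, h4⟩ := hXv o' v ((hinc v o').1 ho')
    exact hf o' o (y v) h3 h1 (by rwa [h4])
  have hr_lt_l : ∀ u v, y u = y v → x u < x v → r u < l v := by
    intro u v h1 h2
    refine (Finset.sup'_lt_iff _).2 fun o ho => ?_
    obtain ⟨h3, h4⟩ := hXv o u ((hinc u o).1 ho)
    exact hlt_l o v (h1 ▸ h3) (by rwa [← h1, h4])
  have hbetween : ∀ u v w, G.Adj u v → y u = y v → y w = y u → x u ≤ x w → x w ≤ x v →
      w = u ∨ w = v := by
    intro u v w ha h1 h2 h3 h4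
    by_contra hc
    refine hvert w s(u, v) ha (by simpa using hc) ?_
    have h5 : (x w, y u) ∈ segment ℝ (x u, y u) (x v, y u) := mk_mem_segment_horizontal ⟨h3, h4⟩
    have h6 : (x w, y w) ∈ segment ℝ (x u, y u) (x v, y v) := by
      rw [h2, ← h1]
      exact h5
    exact h6
  let Vertical : Sym2 V → Pt → Pt → Prop := fun e P Q =>
    ∃ o : O, y o.1.1 < y o.1.2 ∧ e = s(o.1.1, o.1.2) ∧ P = (f o, y o.1.1) ∧ Q = (f o, y o.1.2)
  let Horizontal : Sym2 V → Pt → Pt → Prop := fun e P Q =>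
    ∃ u v, G.Adj u v ∧ y u = y v ∧ x u < x v ∧ e = s(u, v) ∧ P = (r u, y u) ∧ Q = (l v, y u)
  have hends : ∀ e : Sym2 V, ∃ P Q, e ∈ G.edgeSet → Vertical e P Q ∨ Horizontal e P Q := by
    intro e
    by_cases he : e ∈ G.edgeSet
    · induction e using Sym2.ind with
      | _ u v =>
        have ha : G.Adj u v := he
        rcases lt_trichotomy (y u) (y v) with h1 | h1 | h1
        · exact ⟨_, _, fun _ => Or.inl ⟨⟨(u, v), Or.inr ⟨ha, h1⟩⟩, h1, rfl, rfl, rfl⟩⟩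
        · rcases lt_trichotomy (x u) (x v) with h2 | h2 | h2
          · exact ⟨_, _, fun _ => Or.inr ⟨u, v, ha, h1, h2, rfl, rfl, rfl⟩⟩
          · exact absurd (hinj u v h2 h1) ha.ne
          · exact ⟨_, _, fun _ => Or.inr ⟨v, u, ha.symm, h1.symm, h2, Sym2.eq_swap, rfl, rfl⟩⟩
        · exact ⟨_, _, fun _ => Or.inl ⟨⟨(v, u), Or.inr ⟨ha.symm, h1⟩⟩, h1, Sym2.eq_swap, rfl, rfl⟩⟩
    · exact ⟨0, 0, fun h => absurd h he⟩
  choose P Q hPQ using hends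
  let D : VisData V := ⟨y, l, r, P, Q⟩
  have hvseg : ∀ v p, p ∈ D.vseg v → p.2 = y v ∧ l v ≤ p.1 ∧ p.1 ≤ r v := fun v p hp =>
    RowVis.mem_horizontal_segment (hlr v) hp
  have hvseg' : ∀ v c, l v ≤ c → c ≤ r v → (c, y v) ∈ D.vseg v := fun v c h1 h2 =>
    mk_mem_segment_horizontal ⟨h1, h2⟩
  have hesegV : ∀ e p (o : O), y o.1.1 < y o.1.2 → P e = (f o, y o.1.1) → Q e = (f o, y o.1.2) →
      p ∈ D.eseg e → p.1 = f o ∧ p.2 ∈ active o := by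
    intro e p o h1 h2 h3 hp
    have hp' : p ∈ segment ℝ (P e) (Q e) := hp
    rw [h2, h3] at hp'
    exact mem_vertical_segment h1.le hp'
  have hesegH : ∀ e p u v, y u = y v → x u < x v → P e = (r u, y u) → Q e = (l v, y u) →
      p ∈ D.eseg e → p.2 = y u ∧ r u ≤ p.1 ∧ p.1 ≤ l v := by
    intro e p u v h1 h1' h2 h3 hp
    have hp' : p ∈ segment ℝ (P e) (Q e) := hp
    rw [h2, h3] at hp'
    exact RowVis.mem_horizontal_segment (hr_lt_l u v h1 h1').le hp'
  have hone : ∀ v, 1 ≤ y v ∧ y v ≤ h := by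
    intro v
    obtain ⟨k, h1, h2, h3⟩ := hh v
    simp only [hy]
    rw [h3]
    exact ⟨by exact_mod_cast h1, by exact_mod_cast h2⟩
  have hVH : ∀ (o : O) (u v : V) (p : Pt), y o.1.1 < y o.1.2 → G.Adj u v → y u = y v → x u < x v →
      p.2 ∈ active o → p.1 = f o → p.2 = y u → r u ≤ p.1 → p.1 ≤ l v →
      ∃ w, (w = o.1.1 ∨ w = o.1.2) ∧ (w = u ∨ w = v) ∧ p.2 = y w := by
    intro o u v p h1 h2 h3 h4 h5 h6 h7 h8 h9
    rw [h7] at h5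
    have h10 : x u ≤ X o (y u) := by
      by_contra hc
      have := hlt_l o u h5 (not_le.1 hc)
      have := hlr u
      linarith
    have h11 : X o (y u) ≤ x v := by
      by_contra hc
      have := hr_lt o v (h3 ▸ h5) (by rw [← h3]; exact not_le.1 hc)
      have := hlr v
      linarith
    have hne : s(o.1.1, o.1.2) ≠ s(u, v) := by
      intro heq
      rcases Sym2.eq_iff.1 heq with ⟨h12, h13⟩ | ⟨h12, h13⟩ <;> rw [h12, h13, h3] at h1 <;>
        exact lt_irrefl _ h1
    have h12 : (X o (y u), y u) ∈ segment ℝ (x u, y u) (x v, y v) := by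
      rw [← h3]
      exact mk_mem_segment_horizontal ⟨h10, h11⟩
    obtain ⟨w, hw1, hw2, hw⟩ := hedge _ (hadj o h1) _ h2 hne _ ⟨hXmem o (y u) h1 h5, h12⟩
    have h13 := congrArg Prod.snd hw
    exact ⟨w, by simpa using hw1, by simpa using hw2, h7.trans h13⟩
  have hend : ∀ e ∈ G.edgeSet, ∀ e' ∈ G.edgeSet, e ≠ e' → ∀ p ∈ D.eseg e ∩ D.eseg e',
      p = P e ∨ p = Q e := by
    rintro e he e' he' hee p ⟨hp, hp'⟩
    rcases hPQ e he with ⟨o, h1, rfl, h2, h3⟩ | ⟨u, v, ha, h1, h2, rfl, h3, h4⟩ <;>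
      rcases hPQ e' he' with ⟨o', h1', rfl, h2', h3'⟩ | ⟨u', v', ha', h1', h2', rfl, h3', h4'⟩
    · obtain ⟨h4, h5⟩ := hesegV _ p o h1 h2 h3 hp
      obtain ⟨h4', h5'⟩ := hesegV _ p o' h1' h2' h3' hp'
      have hne : o ≠ o' := by rintro rfl; exact hee rfl
      have heq : X o p.2 = X o' p.2 := by
        rcases lt_trichotomy (X o p.2) (X o' p.2) with h | h | h
        · exact absurd (h4.symm.trans h4') (hf o o' _ h5 h5' h).ne
        · exact h
        · exact absurd (h4.symm.trans h4') (hf o' o _ h5' h5 h).ne'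
      rw [h2, h3]
      exact (hmeet o o' p.2 hne h1 h1' h5 h5' heq).imp (Prod.ext h4) (Prod.ext h4)
    · obtain ⟨h4, h5⟩ := hesegV _ p o h1 h2 h3 hp
      obtain ⟨h6, h7, h8⟩ := hesegH _ p u' v' h1' h2' h3' h4' hp'
      obtain ⟨w, hw, -, hpw⟩ := hVH o u' v' p h1 ha' h1' h2' h5 h4 h6 h7 h8
      rw [h2, h3]
      exact hw.imp (fun hw => Prod.ext h4 (by rw [hpw, hw])) fun hw => Prod.ext h4 (by rw [hpw, hw])
    · obtain ⟨h5, h6⟩ := hesegV _ p o' h1' h2' h3' hp'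
      obtain ⟨h7, h8, h9⟩ := hesegH _ p u v h1 h2 h3 h4 hp
      obtain ⟨w, hw, hw', hpw⟩ := hVH o' u v p h1' ha h1 h2 h6 h5 h7 h8 h9
      rw [h3, h4]
      rcases hw' with rfl | rfl
      · left
        refine Prod.ext (le_antisymm ?_ h8) h7
        rw [h5]
        exact hr _ o' hw
      · right
        refine Prod.ext (le_antisymm h9 ?_) h7
        rw [h5]
        exact hl _ o' hw
    · obtain ⟨h5, h6, h7⟩ := hesegH _ p u v h1 h2 h3 h4 hp
      obtain ⟨h5', h6', h7'⟩ := hesegH _ p u' v' h1' h2' h3' h4' hp'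
      have hyy : y u' = y u := h5'.symm.trans h5
      rw [h3, h4]
      by_contra hc
      rw [not_or] at hc
      have h8 : r u < p.1 := lt_of_le_of_ne h6 fun h => hc.1 (Prod.ext h.symm h5)
      have h9 : p.1 < l v := lt_of_le_of_ne h7 fun h => hc.2 (Prod.ext h h5)
      have h10 : x u' ≤ x u := by
        by_contra h10
        push Not at h10
        rcases lt_or_ge (x v) (x u') with h11 | h11
        · have := hr_lt_l v u' (h1.symm.trans hyy.symm) h11
          have := hlr v
          have := hlr u'
          linarith
        · rcases hbetween u v u' ha h1 hyy h10.le h11 with h12 | h12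
          · rw [h12] at h10
            exact lt_irrefl _ h10
          · rw [h12] at h6'
            have := hlr v
            linarith
      have h11 : x v ≤ x v' := by
        by_contra h11
        push Not at h11
        rcases lt_or_ge (x v') (x u) with h12 | h12
        · have := hr_lt_l v' u (h1'.symm.trans hyy) h12
          have := hlr u
          have := hlr v'
          linarith
        · rcases hbetween u v v' ha h1 (h1'.symm.trans hyy) h12 h11.le with h13 | h13
          · rw [h13] at h7'
            have := hlr u
            linarith
          · rw [h13] at h11
            exact lt_irrefl _ h11
      rcases hbetween u' v' u ha' h1' hyy.symm h10 (h2.le.trans h11) with h12 | h12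
      · rcases hbetween u' v' v ha' h1' (h1.symm.trans hyy.symm) (h10.trans h2.le) h11 with h13 | h13
        · rw [h13, h12] at h2
          exact lt_irrefl _ h2
        · rw [h12, h13] at hee
          exact hee rfl
      · rw [h12] at h2
        linarith
  refine ⟨D, hlr, hh, ?_, ?_, ?_, ?_, ?_, ?_⟩
  · intro e he
    change (P e).1 = (Q e).1 ∨ (P e).2 = (Q e).2
    rcases hPQ e he with ⟨o, -, -, h2, h3⟩ | ⟨u, v, -, -, -, -, h2, h3⟩ <;> rw [h2, h3]
    exacts [Or.inl rfl, Or.inr rfl]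
  · intro e he p hp
    rcases hPQ e he with ⟨o, h1, rfl, h2, h3⟩ | ⟨u, v, ha, h1, h2, rfl, h3, h4⟩
    · have := (hesegV _ p o h1 h2 h3 hp).2
      exact ⟨(hone _).1.trans this.1, this.2.trans (hone _).2⟩
    · rw [(hesegH _ p u v h1 h2 h3 h4 hp).1]
      exact hone u
  · intro u v huv
    change (P _ ∈ _ ∧ Q _ ∈ _) ∨ (P _ ∈ _ ∧ Q _ ∈ _)
    rcases hPQ s(u, v) huv with ⟨o, h1, heq, h2, h3⟩ | ⟨u', v', ha, h1, h1', heq, h2, h3⟩ <;>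
      rw [h2, h3] <;> rcases Sym2.eq_iff.1 heq with ⟨h4, h5⟩ | ⟨h4, h5⟩ <;> rw [h4, h5]
    · exact Or.inl ⟨hvseg' _ _ (hl _ o (Or.inl rfl)) (hr _ o (Or.inl rfl)),
        hvseg' _ _ (hl _ o (Or.inr rfl)) (hr _ o (Or.inr rfl))⟩
    · exact Or.inr ⟨hvseg' _ _ (hl _ o (Or.inl rfl)) (hr _ o (Or.inl rfl)),
        hvseg' _ _ (hl _ o (Or.inr rfl)) (hr _ o (Or.inr rfl))⟩
    · exact Or.inl ⟨hvseg' _ _ (hlr _) le_rfl, by rw [h1]; exact hvseg' _ _ le_rfl (hlr _)⟩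
    · exact Or.inr ⟨hvseg' _ _ (hlr _) le_rfl, by rw [h1]; exact hvseg' _ _ le_rfl (hlr _)⟩
  · intro u v huv
    rw [Set.disjoint_left]
    intro p hp hp'
    obtain ⟨h1, h2, h3⟩ := hvseg u p hp
    obtain ⟨h4, h5, h6⟩ := hvseg v p hp'
    have hyy := h1.symm.trans h4
    rcases lt_trichotomy (x u) (x v) with h | h | h
    · have := hr_lt_l u v hyy h
      linarith
    · exact huv (hinj u v h hyy)
    · have := hr_lt_l v u hyy.symm h
      linarith
  · rintro e he w p ⟨hp, hpw⟩
    change p = P e ∨ p = Q e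
    obtain ⟨h5, h6, h7⟩ := hvseg w p hpw
    rcases hPQ e he with ⟨o, h1, rfl, h2, h3⟩ | ⟨u, v, ha, h1, h2, rfl, h3, h4⟩
    · obtain ⟨h8, h9⟩ := hesegV _ p o h1 h2 h3 hp
      rw [h2, h3]
      by_contra hc
      rw [not_or] at hc
      rw [h5] at h9
      have hXw : X o (y w) = x w := by
        rcases lt_trichotomy (X o (y w)) (x w) with h | h | h
        · have := hlt_l o w h9 h
          linarith
        · exact h
        · have := hr_lt o w h9 h
          linarith
      refine hvert w _ he (fun hw => ?_) (?_ : (x w, y w) ∈ _)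
      · rcases Sym2.mem_iff.1 hw with rfl | rfl
        · exact hc.1 (Prod.ext h8 h5)
        · exact hc.2 (Prod.ext h8 h5)
      · rw [← hXw]
        exact hXmem o _ h1 h9
    · obtain ⟨h8, h9, h10⟩ := hesegH _ p u v h1 h2 h3 h4 hp
      have hyy : y w = y u := h5.symm.trans h8
      rw [h3, h4]
      rcases lt_or_ge (x w) (x u) with h11 | h11
      · have := hr_lt_l w u hyy h11
        have := hlr u
        linarith
      rcases lt_or_ge (x v) (x w) with h12 | h12
      · have := hr_lt_l v w (h1.symm.trans hyy.symm) h12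
        have := hlr v
        linarith
      rcases hbetween u v w ha h1 hyy h11 h12 with rfl | rfl
      · exact Or.inl (Prod.ext (le_antisymm h7 h9) h8)
      · exact Or.inr (Prod.ext (le_antisymm h10 h6) h8)
  · rintro e he e' he' hne p ⟨hp, hp'⟩
    exact ⟨hend e he e' he' hne p ⟨hp, hp'⟩, hend e' he' e he hne.symm p ⟨hp', hp⟩⟩

end

/-- A simple graph admits a planar straight-line drawing with all
vertex `y`-coordinates integers in `{1, …, h}` iff it admits a planar flat visibility
representation of height `h`. -/
theorem stmt14 {V : Type} [Fintype V] (G : SimpleGraph V) (h : ℕ) (hh : 1 ≤ h) :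
    (∃ Γ : StraightDrawing G, Γ.IsPlanar ∧ Γ.HeightLe h) ↔
    (∃ D : VisData V, IsFlatVisRep G D h):= by
  exact ⟨fun ⟨Γ, hΓ, hΓh⟩ => Γ.exists_isFlatVisRep hΓ hΓh, fun ⟨_, hD⟩ => hD.exists_straightDrawing⟩
end

section
/- For every planar flat visibility representation (of some height h) of a simple graph G there exists a planar straight-line drawing of G in which the y-coordinate of every vertex equals the y-coordinate of the horizontal segment representing that vertex in the visibility representation. -/
open Set

/-- Gordan's alternative for finitely many linear functionals on `V → ℝ`. -/
theorem exists_forall_pos_or_exists_convex_combination_eq_zero {V ι : Type} [Fintype V] [Finite ι]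
    (f : ι → (V → ℝ) →ₗ[ℝ] ℝ) :
    (∃ x, ∀ i, 0 < f i x) ∨
      ∃ (κ : Type) (_ : Fintype κ) (w : κ → ℝ) (c : κ → ι),
        (∀ k, 0 ≤ w k) ∧ ∑ k, w k = 1 ∧ ∀ x, ∑ k, w k * f (c k) x = 0 := by
  classical
  let g : ι → V → ℝ := fun i v => f i (Pi.single v 1)
  have hfg : ∀ i x, f i x = ∑ v, x v * g i v := by
    intro i x
    rw [LinearMap.pi_apply_eq_sum_univ (f i) x]
    refine Finset.sum_congr rfl fun v _ => ?_
    rw [smul_eq_mul]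
    congr 2
    funext j
    simp [Pi.single_apply, eq_comm]
  by_cases h0 : (0 : V → ℝ) ∈ convexHull ℝ (Set.range g)
  · right
    obtain ⟨κ, hκ, w, z, hw, hw1, hz, hsum⟩ := mem_convexHull_iff_exists_fintype.1 h0
    choose c hc using hz
    refine ⟨κ, hκ, w, c, hw, hw1, fun x => ?_⟩
    have : ∀ v, ∑ k, w k * g (c k) v = 0 := by
      intro v
      have := congrFun hsum v
      simpa [← hc] using this
    calc ∑ k, w k * f (c k) x = ∑ k, ∑ v, x v * (w k * g (c k) v) := by
          refine Finset.sum_congr rfl fun k _ => ?_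
          rw [hfg, Finset.mul_sum]
          exact Finset.sum_congr rfl fun v _ => by ring
      _ = ∑ v, x v * ∑ k, w k * g (c k) v := by
          rw [Finset.sum_comm]
          exact Finset.sum_congr rfl fun v _ => by rw [Finset.mul_sum]
      _ = 0 := by simp [this]
  · left
    obtain ⟨φ, u, hu, hφ⟩ := geometric_hahn_banach_point_closed (convex_convexHull ℝ (Set.range g))
      (Set.Finite.isCompact_convexHull ℝ (Set.finite_range g)).isClosed h0
    refine ⟨fun v => φ (Pi.single v 1), fun i => ?_⟩
    have h1 := hφ _ (subset_convexHull ℝ _ (Set.mem_range_self i))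
    rw [map_zero] at hu
    have h2 : φ (g i) = f i fun v => φ (Pi.single v 1) := by
      rw [hfg, ← ContinuousLinearMap.coe_coe, LinearMap.pi_apply_eq_sum_univ]
      refine Finset.sum_congr rfl fun v _ => ?_
      rw [smul_eq_mul, mul_comm]
      congr 2
      funext j
      simp [Pi.single_apply, eq_comm]
    rw [← h2]
    exact hu.trans h1

/-- Finitely many disjoint horizontal bars on integer rows, together with vertical connectors
`e` at abscissa `ex e` running from the bar `lo e` up to the bar `hi e`. -/
structure BarSystem (V E : Type) where
  row : V → ℤ
  lx : V → ℝ
  rx : V → ℝ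
  lo : E → V
  hi : E → V
  ex : E → ℝ
  bot : ℤ
  top : ℤ
  bot_le : ∀ v, bot ≤ row v
  le_top : ∀ v, row v ≤ top
  lx_le_rx : ∀ v, lx v ≤ rx v
  disjoint : ∀ u v, u ≠ v → row u = row v → rx u < lx v ∨ rx v < lx u
  row_lt : ∀ e, row (lo e) < row (hi e)
  lx_lo : ∀ e, lx (lo e) ≤ ex e
  rx_lo : ∀ e, ex e ≤ rx (lo e)
  lx_hi : ∀ e, lx (hi e) ≤ ex e
  rx_hi : ∀ e, ex e ≤ rx (hi e)
  cross : ∀ e v, row (lo e) < row v → row v < row (hi e) → ex e < lx v ∨ rx v < ex e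
  simple : ∀ e f, lo e = lo f → hi e = hi f → e = f

namespace BarSystem

variable {V E : Type} (B : BarSystem V E)

/-- The connector `e` passes strictly through row `y`. -/
def Spans (e : E) (y : ℤ) : Prop := B.row (B.lo e) < y ∧ y < B.row (B.hi e)

/-- No bar of row `y` is cut by a vertical line slightly to the left of `ξ`. -/
def Gap (ξ : ℝ) (y : ℤ) : Prop := ∀ v, B.row v = y → B.lx v < ξ → B.rx v < ξ

/-- The reflection of a bar system in the line `y = 0`. -/
def reflect : BarSystem V E where
  row v := -B.row v
  lx := B.lx
  rx := B.rx
  lo := B.hi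
  hi := B.lo
  ex := B.ex
  bot := -B.top
  top := -B.bot
  bot_le v := neg_le_neg (B.le_top v)
  le_top v := neg_le_neg (B.bot_le v)
  lx_le_rx := B.lx_le_rx
  disjoint u v h h' := B.disjoint u v h (neg_injective h')
  row_lt e := neg_lt_neg (B.row_lt e)
  lx_lo := B.lx_hi
  rx_lo := B.rx_hi
  lx_hi := B.lx_lo
  rx_hi := B.rx_lo
  cross e v h h' := B.cross e v (neg_lt_neg_iff.1 h') (neg_lt_neg_iff.1 h)
  simple e f h h' := B.simple e f h' h

theorem gap_ex {e : E} {y : ℤ} (h : B.Spans e y) : B.Gap (B.ex e) y := by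
  rintro v rfl hv
  exact (B.cross e v h.1 h.2).resolve_left hv.not_gt

theorem gap_lx (v : V) : B.Gap (B.lx v) (B.row v) := by
  intro u hu huv
  rcases eq_or_ne u v with rfl | hne
  · exact absurd huv (lt_irrefl _)
  · exact (B.disjoint u v hne hu).resolve_right
      fun h => absurd (h.trans huv) (B.lx_le_rx v).not_gt

/-- There is an abscissa immediately to the right of `c`. -/
theorem exists_right [Finite V] [Finite E] (c : ℝ) :
    ∃ ξ, c < ξ ∧ (∀ e, B.ex e < ξ → B.ex e ≤ c) ∧ ∀ v, B.lx v < ξ → B.lx v ≤ c := by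
  have hfin : ((Set.range B.ex ∪ Set.range B.lx) ∩ Set.Ioi c).Finite :=
    ((Set.finite_range _).union (Set.finite_range _)).inter_of_left _
  have h : ∃ ξ, c < ξ ∧ ∀ s ∈ Set.range B.ex ∪ Set.range B.lx, s < ξ → s ≤ c := by
    rcases ((Set.range B.ex ∪ Set.range B.lx) ∩ Set.Ioi c).eq_empty_or_nonempty with h | h
    · refine ⟨c + 1, by linarith, fun s hs _ => ?_⟩
      by_contra! hc
      exact Set.notMem_empty s (h ▸ ⟨hs, hc⟩)
    · obtain ⟨ξ, hξ, hmin⟩ := Set.exists_min_image _ id hfin h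
      refine ⟨ξ, hξ.2, fun s hs hsξ => ?_⟩
      by_contra! hc
      exact absurd (hmin s ⟨hs, hc⟩) hsξ.not_ge
  obtain ⟨ξ, h1, h2⟩ := h
  exact ⟨ξ, h1, fun e => h2 _ (Or.inl ⟨e, rfl⟩), fun v => h2 _ (Or.inr ⟨v, rfl⟩)⟩

section Potential

variable [Fintype E] {φ : E → ℤ → ℝ}

/-- The total of `φ` at height `y` over the connectors strictly to the left of `ξ`. -/
noncomputable def cum (φ : E → ℤ → ℝ) (ξ : ℝ) (y : ℤ) : ℝ := ∑ e with B.ex e < ξ, φ e y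

/-- A family of functions supported on the connectors whose left-to-right sums are convex along
every vertical line at each height where the line meets no bar. -/
structure IsPotential (φ : E → ℤ → ℝ) : Prop where
  supp : ∀ e y, ¬ B.Spans e y → φ e y = 0
  convex : ∀ ξ y, B.Gap ξ y → 2 * B.cum φ ξ y ≤ B.cum φ ξ (y + 1) + B.cum φ ξ (y - 1)
  total : ∀ y, ∑ e, φ e y = 0

variable {B}

theorem cum_reflect (ξ : ℝ) (y : ℤ) :
    B.reflect.cum (fun e y => φ e (-y)) ξ y = B.cum φ ξ (-y) := rfl

theorem IsPotential.reflect (h : B.IsPotential φ) :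
    B.reflect.IsPotential fun e y => φ e (-y) where
  supp e y he := h.supp e (-y) fun h' => he ⟨neg_lt.1 h'.2, lt_neg.1 h'.1⟩
  convex ξ y hg := by
    have := h.convex ξ (-y) fun v hv => hg v (neg_eq_iff_eq_neg.2 hv)
    have e1 : -(y + 1) = -y - 1 := by ring
    have e2 : -(y - 1) = -y + 1 := by ring
    rw [cum_reflect, cum_reflect, cum_reflect, e1, e2]
    linarith
  total y := h.total (-y)

theorem IsPotential.cum_eq (h : B.IsPotential φ) {ξ η : ℝ} {y : ℤ} (hle : ξ ≤ η)
    (he : ∀ e, B.Spans e y → ξ ≤ B.ex e → η ≤ B.ex e) : B.cum φ ξ y = B.cum φ η y := by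
  classical
  unfold cum
  refine Finset.sum_subset (fun e => ?_) fun e h1 h2 => h.supp e y fun hs => ?_
  · simp only [Finset.mem_filter_univ]
    exact fun h' => h'.trans_le hle
  · simp only [Finset.mem_filter_univ, not_lt] at h1 h2
    exact absurd (he e hs h2) h1.not_ge

/-- To the right of everything the potential vanishes. -/
theorem IsPotential.cum_eq_zero_of_right (h : B.IsPotential φ) {ξ : ℝ} {y : ℤ}
    (he : ∀ e, B.Spans e y → B.ex e < ξ) : B.cum φ ξ y = 0 := by
  classical
  rw [← h.total y, cum]
  refine Finset.sum_subset (Finset.subset_univ _) fun e _ h2 => h.supp e y fun hs => ?_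
  exact h2 (by simpa using he e hs)

theorem IsPotential.cum_eq_zero_of_left (h : B.IsPotential φ) {ξ : ℝ} {y : ℤ}
    (he : ∀ e, B.Spans e y → ξ ≤ B.ex e) : B.cum φ ξ y = 0 := by
  classical
  refine Finset.sum_eq_zero fun e h2 => h.supp e y fun hs => ?_
  simp only [Finset.mem_filter_univ] at h2
  exact absurd (he e hs) h2.not_ge

theorem IsPotential.cum_eq_zero_of_not_mem (h : B.IsPotential φ) (ξ : ℝ) {y : ℤ}
    (hy : y ≤ B.bot ∨ B.top ≤ y) : B.cum φ ξ y = 0 := by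
  refine Finset.sum_eq_zero fun e _ => h.supp e y fun hs => ?_
  rcases hy with hy | hy
  · exact absurd (hs.1.trans_le hy) (B.bot_le _).not_gt
  · exact absurd (hy.trans_lt hs.2) (B.le_top _).not_gt

/-- The value at any point is the value at a point of the same height not cut by a bar. -/
theorem IsPotential.exists_gap [Finite V] (h : B.IsPotential φ) (ξ : ℝ) (y : ℤ) :
    ∃ η, B.Gap η y ∧ B.cum φ η y = B.cum φ ξ y := by
  by_cases hg : B.Gap ξ y
  · exact ⟨ξ, hg, rfl⟩
  · simp only [Gap, not_forall, not_lt] at hg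
    obtain ⟨v, rfl, h1, h2⟩ := hg
    refine ⟨B.lx v, B.gap_lx v, h.cum_eq h1.le fun e hs hle => ?_⟩
    exact h2.trans ((B.cross e v hs.1 hs.2).resolve_left hle.not_gt).le

theorem IsPotential.finite_range (h : B.IsPotential φ) :
    (Set.range fun p : ℝ × ℤ => B.cum φ p.1 p.2).Finite := by
  classical
  let F : Finset E × ℤ → ℝ := fun q => ∑ e ∈ q.1, φ e q.2
  refine (((Set.toFinite (Set.univ : Set (Finset E))).prod
    (Set.finite_Icc B.bot B.top)).image F |>.insert 0).subset ?_
  rintro _ ⟨⟨ξ, y⟩, rfl⟩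
  by_cases hy : y ∈ Set.Icc B.bot B.top
  · exact Or.inr ⟨(Finset.univ.filter fun e => B.ex e < ξ, y), ⟨trivial, hy⟩, rfl⟩
  · refine Or.inl (h.cum_eq_zero_of_not_mem ξ ?_)
    rw [Set.mem_Icc, not_and_or, not_le, not_le] at hy
    exact hy.imp le_of_lt le_of_lt

theorem IsPotential.cum_nonpos [Finite V] (h : B.IsPotential φ) (ξ : ℝ) (y : ℤ) :
    B.cum φ ξ y ≤ 0 := by
  obtain ⟨_, ⟨⟨ξ₀, y₀⟩, rfl⟩, hmax⟩ := Set.exists_max_image _ id h.finite_range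
    (Set.range_nonempty _)
  have hmax' : ∀ η z, B.cum φ η z ≤ B.cum φ ξ₀ y₀ := fun η z => hmax _ ⟨(η, z), rfl⟩
  have hup : ∀ n : ℕ, ∃ η, B.cum φ η (y₀ + n) = B.cum φ ξ₀ y₀ := by
    intro n
    induction n with
    | zero => exact ⟨ξ₀, by simp⟩
    | succ n ih =>
      obtain ⟨η, hη⟩ := ih
      obtain ⟨ζ, hg, hζ⟩ := h.exists_gap η (y₀ + n)
      have h1 := h.convex ζ _ hg
      have h2 := hmax' ζ (y₀ + n - 1)
      have h3 := hmax' ζ (y₀ + n + 1)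
      refine ⟨ζ, ?_⟩
      push_cast
      rw [← add_assoc]
      linarith
  obtain ⟨η, hη⟩ := hup (B.top - y₀).toNat
  rw [h.cum_eq_zero_of_not_mem η (Or.inr (by omega))] at hη
  exact (hmax' ξ y).trans hη.ge

theorem IsPotential.cum_add_one_eq_zero [Finite V] (h : B.IsPotential φ) {ξ : ℝ} {y : ℤ}
    (hg : B.Gap ξ y) (h0 : B.cum φ ξ y = 0) : B.cum φ ξ (y + 1) = 0 := by
  linarith [h.convex ξ y hg, h.cum_nonpos ξ (y + 1), h.cum_nonpos ξ (y - 1)]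

theorem IsPotential.cum_sub_one_eq_zero [Finite V] (h : B.IsPotential φ) {ξ : ℝ} {y : ℤ}
    (hg : B.Gap ξ y) (h0 : B.cum φ ξ y = 0) : B.cum φ ξ (y - 1) = 0 := by
  linarith [h.convex ξ y hg, h.cum_nonpos ξ (y + 1), h.cum_nonpos ξ (y - 1)]

/-- Two connectors bounding a region of nonzero potential, with zero potential on the other
sides, end at the same upper bar. -/
theorem IsPotential.hi_eq_hi [Finite V] (h : B.IsPotential φ) {e f : E} {y₀ : ℤ} {ζ : ℝ}
    (he : B.Spans e y₀) (hf : B.Spans f y₀) (hef : B.ex e < B.ex f)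
    (hfζ : B.ex f < ζ) (hζe : ∀ e, B.ex e < ζ → B.ex e ≤ B.ex f)
    (hζv : ∀ v, B.lx v < ζ → B.lx v ≤ B.ex f)
    (h0e : B.cum φ (B.ex e) y₀ = 0) (h0f : B.cum φ ζ y₀ = 0)
    (hne : ∀ ξ, B.ex e < ξ → ξ ≤ B.ex f → B.cum φ ξ y₀ ≠ 0) : B.hi e = B.hi f := by
  have hζg : ∀ y, B.Spans f y → B.Gap ζ y := by
    rintro y hs v rfl hv
    exact ((B.cross f v hs.1 hs.2).resolve_left (hζv v hv).not_gt).trans hfζ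
  have up : ∀ (g : E) (ξ : ℝ), (∀ y, B.Spans g y → B.Gap ξ y) → B.Spans g y₀ →
      B.cum φ ξ y₀ = 0 → ∀ n : ℕ, y₀ + n ≤ B.row (B.hi g) → B.cum φ ξ (y₀ + n) = 0 := by
    intro g ξ hg hs h0 n
    induction n with
    | zero => intro _; simpa using h0
    | succ n ih =>
      intro hn
      push_cast at hn ⊢
      rw [← add_assoc]
      exact h.cum_add_one_eq_zero (hg _ ⟨by have := hs.1; omega, by omega⟩) (ih (by omega))
  have upe := up e _ (fun y hs => B.gap_ex hs) he h0e
  have upf := up f _ hζg hf h0f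
  have climb : ∀ n : ℕ, y₀ + n < B.row (B.hi e) → y₀ + n < B.row (B.hi f) →
      ∀ ξ, B.ex e < ξ → ξ ≤ B.ex f → B.cum φ ξ (y₀ + n) ≠ 0 := by
    intro n
    induction n with
    | zero => intro _ _; simpa using hne
    | succ n ih =>
      intro h1 h2 ξ h3 h4 h5
      push_cast at h1 h2 h5
      rw [← add_assoc] at h5
      have ih' := ih (by omega) (by omega)
      by_cases hg : B.Gap ξ (y₀ + n + 1)
      · refine ih' ξ h3 h4 ?_
        simpa using h.cum_sub_one_eq_zero hg h5
      · simp only [Gap, not_forall, not_lt] at hg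
        obtain ⟨v, hv, h6, h7⟩ := hg
        have hse : B.Spans e (B.row v) := ⟨by have := he.1; omega, by omega⟩
        have hsf : B.Spans f (B.row v) := ⟨by have := hf.1; omega, by omega⟩
        have h8 : B.ex e < B.lx v :=
          (B.cross e v hse.1 hse.2).resolve_right (fun h => by linarith)
        rw [← hv] at h5
        rw [← h.cum_eq h6.le fun g hs hle =>
          h7.trans ((B.cross g v hs.1 hs.2).resolve_left hle.not_gt).le] at h5
        refine ih' (B.lx v) h8 (h6.le.trans h4) ?_
        have := h.cum_sub_one_eq_zero (B.gap_lx v) h5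
        rw [hv] at this
        simpa using this
  by_contra hneq
  have he' := he
  have hf' := hf
  obtain ⟨he1, he2⟩ := he
  obtain ⟨hf1, hf2⟩ := hf
  rcases le_or_gt (B.row (B.hi e)) (B.row (B.hi f)) with hle | hlt
  · have hlt : B.rx (B.hi e) < B.ex f := by
      rcases hle.lt_or_eq with hlt | heq
      · exact (B.cross f (B.hi e) (by omega) hlt).resolve_left
          fun h => absurd ((B.lx_hi e).trans hef.le) h.not_ge
      · rcases B.disjoint _ _ hneq heq with h | h
        · exact h.trans_le (B.lx_hi f)
        · linarith [B.rx_hi f, B.lx_hi e]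
    obtain ⟨ξ, h1, h2, h3⟩ := B.exists_right (B.rx (B.hi e))
    obtain ⟨n, hn⟩ : ∃ n : ℕ, y₀ + n + 1 = B.row (B.hi e) :=
      ⟨(B.row (B.hi e) - y₀ - 1).toNat, by omega⟩
    have hξf : ξ ≤ B.ex f := le_of_not_gt fun h' => absurd (h2 f h') hlt.not_ge
    refine climb n (by omega) (by omega) ξ ((B.rx_hi e).trans_lt h1) hξf ?_
    have hg : B.Gap ξ (B.row (B.hi e)) := by
      intro v hv hlv
      rcases eq_or_ne v (B.hi e) with rfl | hne'
      · exact h1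
      · rcases B.disjoint v _ hne' hv with h' | h'
        · exact (h'.trans_le (B.lx_le_rx _)).trans h1
        · exact absurd (h3 v hlv) h'.not_ge
    have h4 : B.cum φ ξ (B.row (B.hi e)) = 0 := by
      have := upe (n + 1) (by push_cast; omega)
      push_cast at this
      rw [← add_assoc, hn] at this
      rw [← this]
      refine (h.cum_eq ((B.rx_hi e).trans h1.le) fun g hs hle' => ?_).symm
      by_contra! hg'
      rcases B.cross g (B.hi e) hs.1 hs.2 with h' | h'
      · linarith [B.lx_hi e]
      · exact absurd (h2 g hg') h'.not_ge
    have := h.cum_sub_one_eq_zero hg h4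
    rw [← hn] at this
    simpa using this
  · have hlx : B.ex e < B.lx (B.hi f) :=
      (B.cross e (B.hi f) (by omega) hlt).resolve_right
        fun h => absurd (hef.le.trans (B.rx_hi f)) h.not_ge
    obtain ⟨n, hn⟩ : ∃ n : ℕ, y₀ + n + 1 = B.row (B.hi f) :=
      ⟨(B.row (B.hi f) - y₀ - 1).toNat, by omega⟩
    refine climb n (by omega) (by omega) _ hlx (B.lx_hi f) ?_
    have h4 : B.cum φ (B.lx (B.hi f)) (B.row (B.hi f)) = 0 := by
      have := upf (n + 1) (by push_cast; omega)
      push_cast at this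
      rw [← add_assoc, hn] at this
      rw [← this]
      refine h.cum_eq ((B.lx_hi f).trans hfζ.le) fun g hs hle' => ?_
      by_contra! hg'
      rcases B.cross g (B.hi f) hs.1 hs.2 with h' | h'
      · linarith
      · linarith [hζe g hg', B.rx_hi f]
    have := h.cum_sub_one_eq_zero (B.gap_lx _) h4
    rw [← hn] at this
    simpa using this

theorem IsPotential.cum_eq_zero [Finite V] (h : B.IsPotential φ) (ξ₀ : ℝ) (y₀ : ℤ) :
    B.cum φ ξ₀ y₀ = 0 := by
  classical
  by_contra hne
  have hleft : ∃ e, B.Spans e y₀ ∧ B.ex e < ξ₀ ∧ B.cum φ (B.ex e) y₀ = 0 ∧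
      ∀ ξ, B.ex e < ξ → ξ ≤ ξ₀ → B.cum φ ξ y₀ ≠ 0 := by
    have key : ∀ ξ ≤ ξ₀, B.cum φ ξ y₀ = 0 →
        ∃ e, B.Spans e y₀ ∧ B.ex e < ξ₀ ∧ ξ ≤ B.ex e ∧ B.cum φ (B.ex e) y₀ = 0 := by
      intro ξ hξ h0
      have hS : (Finset.univ.filter fun e => B.Spans e y₀ ∧ ξ ≤ B.ex e ∧ B.ex e < ξ₀).Nonempty := by
        by_contra hS
        rw [Finset.not_nonempty_iff_eq_empty, Finset.filter_eq_empty_iff] at hS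
        refine hne (h0 ▸ (h.cum_eq hξ fun e hs hle => ?_).symm)
        by_contra! h'
        exact hS (Finset.mem_univ e) ⟨hs, hle, h'⟩
      obtain ⟨e, he, hmin⟩ := Finset.exists_min_image _ B.ex hS
      simp only [Finset.mem_filter_univ] at he hmin
      refine ⟨e, he.1, he.2.2, he.2.1, h0 ▸ (h.cum_eq he.2.1 fun g hs hle => ?_).symm⟩
      by_contra! h'
      exact absurd (hmin g ⟨hs, hle, h'.trans he.2.2⟩) h'.not_ge
    let S := Finset.univ.filter fun e => B.Spans e y₀ ∧ B.ex e < ξ₀ ∧ B.cum φ (B.ex e) y₀ = 0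
    have hS : S.Nonempty := by
      by_cases hall : ∀ e, B.Spans e y₀ → ξ₀ ≤ B.ex e
      · exact absurd (h.cum_eq_zero_of_left hall) hne
      · have hE : (Finset.univ : Finset E).Nonempty := by
          push Not at hall
          exact ⟨hall.choose, Finset.mem_univ _⟩
        obtain ⟨m, -, hm⟩ := Finset.exists_min_image Finset.univ B.ex hE
        obtain ⟨e, h1, h2, -, h3⟩ := key (min ξ₀ (B.ex m)) (min_le_left _ _)
          (h.cum_eq_zero_of_left fun e _ => (min_le_right _ _).trans (hm e (Finset.mem_univ e)))
        exact ⟨e, by simp [S, h1, h2, h3]⟩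
    obtain ⟨e, he, hmax⟩ := Finset.exists_max_image _ B.ex hS
    simp only [S, Finset.mem_filter_univ] at he hmax
    refine ⟨e, he.1, he.2.1, he.2.2, fun ξ h1 h2 h0 => ?_⟩
    obtain ⟨g, h3, h4, h5, h6⟩ := key ξ h2 h0
    linarith [hmax g ⟨h3, h4, h6⟩]
  have hright : ∃ f ζ, B.Spans f y₀ ∧ ξ₀ ≤ B.ex f ∧ B.ex f < ζ ∧
      (∀ e, B.ex e < ζ → B.ex e ≤ B.ex f) ∧ (∀ v, B.lx v < ζ → B.lx v ≤ B.ex f) ∧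
      B.cum φ ζ y₀ = 0 ∧ ∀ ξ, ξ₀ ≤ ξ → ξ ≤ B.ex f → B.cum φ ξ y₀ ≠ 0 := by
    choose R hR1 hR2 hR3 using B.exists_right
    have key : ∀ ξ, ξ₀ ≤ ξ → B.cum φ ξ y₀ = 0 →
        ∃ f, B.Spans f y₀ ∧ ξ₀ ≤ B.ex f ∧ B.ex f < ξ ∧ B.cum φ (R (B.ex f)) y₀ = 0 := by
      intro ξ hξ h0
      have hS : (Finset.univ.filter fun e => B.Spans e y₀ ∧ ξ₀ ≤ B.ex e ∧ B.ex e < ξ).Nonempty := by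
        by_contra hS
        rw [Finset.not_nonempty_iff_eq_empty, Finset.filter_eq_empty_iff] at hS
        refine hne (h0 ▸ h.cum_eq hξ fun e hs hle => ?_)
        by_contra! h'
        exact hS (Finset.mem_univ e) ⟨hs, hle, h'⟩
      obtain ⟨f, hf, hmax⟩ := Finset.exists_max_image _ B.ex hS
      simp only [Finset.mem_filter_univ] at hf hmax
      have hRξ : min (R (B.ex f)) ξ ≤ ξ := min_le_right _ _
      refine ⟨f, hf.1, hf.2.1, hf.2.2, ?_⟩
      have h1 : B.cum φ (min (R (B.ex f)) ξ) y₀ = 0 := by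
        refine h0 ▸ h.cum_eq hRξ fun g hs hle => ?_
        by_contra! h'
        have h2 : B.ex f < B.ex g := (lt_min (hR1 _) hf.2.2).trans_le hle
        exact absurd (hmax g ⟨hs, hf.2.1.trans h2.le, h'⟩) h2.not_ge
      rw [← h1]
      refine (h.cum_eq (min_le_left _ _) fun g hs hle => ?_).symm
      by_contra! h'
      exact absurd ((lt_min (hR1 _) hf.2.2).trans_le hle) (hR2 _ g h').not_gt
    let S := Finset.univ.filter fun f =>
      B.Spans f y₀ ∧ ξ₀ ≤ B.ex f ∧ B.cum φ (R (B.ex f)) y₀ = 0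
    have hS : S.Nonempty := by
      by_cases hall : ∀ e, B.Spans e y₀ → B.ex e < ξ₀
      · exact absurd (h.cum_eq_zero_of_right hall) hne
      · have hE : (Finset.univ : Finset E).Nonempty := by
          push Not at hall
          exact ⟨hall.choose, Finset.mem_univ _⟩
        obtain ⟨m, -, hm⟩ := Finset.exists_max_image Finset.univ B.ex hE
        obtain ⟨e, h1, h2, -, h3⟩ := key (max ξ₀ (R (B.ex m))) (le_max_left _ _)
          (h.cum_eq_zero_of_right fun e _ =>
            ((hm e (Finset.mem_univ e)).trans_lt (hR1 _)).trans_le (le_max_right _ _))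
        exact ⟨e, by simp [S, h1, h2, h3]⟩
    obtain ⟨f, hf, hmin⟩ := Finset.exists_min_image _ B.ex hS
    simp only [S, Finset.mem_filter_univ] at hf hmin
    refine ⟨f, R (B.ex f), hf.1, hf.2.1, hR1 _, hR2 _, hR3 _, hf.2.2, fun ξ h1 h2 h0 => ?_⟩
    obtain ⟨g, h3, h4, h5, h6⟩ := key ξ h1 h0
    linarith [hmin g ⟨h3, h4, h6⟩]
  obtain ⟨e, he, heξ, h0e, hnee⟩ := hleft
  obtain ⟨f, ζ, hf, hfξ, hfζ, hζe, hζv, h0f, hnef⟩ := hright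
  have hne' : ∀ ξ, B.ex e < ξ → ξ ≤ B.ex f → B.cum φ ξ y₀ ≠ 0 := fun ξ h1 h2 =>
    (le_total ξ ξ₀).elim (hnee ξ h1) fun h3 => hnef ξ h3 h2
  have hlt : B.ex e < B.ex f := heξ.trans_le hfξ
  have hhi := h.hi_eq_hi he hf hlt hfζ hζe hζv h0e h0f hne'
  have hcum : ∀ ξ, B.reflect.cum (fun e y => φ e (-y)) ξ (-y₀) = B.cum φ ξ y₀ := by
    intro ξ
    rw [cum_reflect, neg_neg]
  have hlo : B.lo e = B.lo f := h.reflect.hi_eq_hi (y₀ := -y₀)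
    ⟨neg_lt_neg he.2, neg_lt_neg he.1⟩ ⟨neg_lt_neg hf.2, neg_lt_neg hf.1⟩ hlt hfζ hζe hζv
    ((hcum _).trans h0e) ((hcum _).trans h0f) fun ξ h1 h2 => (hcum ξ).trans_ne (hne' ξ h1 h2)
  rw [B.simple e f hlo hhi] at hlt
  exact lt_irrefl _ hlt

end Potential

/-- The elements met by a row: bars of the row, and connectors passing strictly through it. -/
def Present (r : ℤ) : V ⊕ E → Prop
  | Sum.inl v => B.row v = r
  | Sum.inr e => B.Spans e r

/-- The left end of an element. -/
def left : V ⊕ E → ℝ := Sum.elim B.lx B.ex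

/-- The right end of an element. -/
def right : V ⊕ E → ℝ := Sum.elim B.rx B.ex

/-- The abscissa at height `r` of the straight line through the end-vertices of `e`, as a linear
functional of the abscissae of the vertices. -/
noncomputable def line (e : E) (r : ℝ) : (V → ℝ) →ₗ[ℝ] ℝ :=
  ((B.row (B.hi e) - r) / (B.row (B.hi e) - B.row (B.lo e))) • LinearMap.proj (B.lo e) +
    ((r - B.row (B.lo e)) / (B.row (B.hi e) - B.row (B.lo e))) • LinearMap.proj (B.hi e)

/-- The abscissa at height `r` of an element in the straight-line drawing. -/
noncomputable def abscissa (r : ℤ) : V ⊕ E → (V → ℝ) →ₗ[ℝ] ℝ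
  | Sum.inl v => LinearMap.proj v
  | Sum.inr e => B.line e r

/-- The vertex abscissae `x` yield a straight-line drawing with the same left-to-right order in
each row. -/
def IsRealization (x : V → ℝ) : Prop :=
  ∀ r a b, B.Present r a → B.Present r b → B.right a < B.left b →
    B.abscissa r a x < B.abscissa r b x

/-- The tent function of a connector under a unit load in row `r`: it vanishes outside the range
of the connector. -/
noncomputable def tent (e : E) (r y : ℤ) : ℝ :=
  (B.row (B.hi e) - r) / (B.row (B.hi e) - B.row (B.lo e)) * max ((y : ℝ) - B.row (B.lo e)) 0 +
    (r - B.row (B.lo e)) / (B.row (B.hi e) - B.row (B.lo e)) * max ((y : ℝ) - B.row (B.hi e)) 0 -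
    max ((y : ℝ) - r) 0

theorem row_sub_row_pos (e : E) : (0 : ℝ) < B.row (B.hi e) - B.row (B.lo e) := by
  have := B.row_lt e
  rw [sub_pos]
  exact_mod_cast this

theorem tent_eq_zero {e : E} {r y : ℤ} (hr : B.Spans e r) (hy : ¬ B.Spans e y) :
    B.tent e r y = 0 := by
  have hpos := B.row_sub_row_pos e
  have h1 : (B.row (B.lo e) : ℝ) < r := by exact_mod_cast hr.1
  have h2 : (r : ℝ) < B.row (B.hi e) := by exact_mod_cast hr.2
  unfold tent
  rcases le_or_gt y (B.row (B.lo e)) with h | h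
  · have h3 : (y : ℝ) ≤ B.row (B.lo e) := by exact_mod_cast h
    rw [max_eq_right (by linarith), max_eq_right (by linarith), max_eq_right (by linarith)]
    ring
  · have h3 : (B.row (B.hi e) : ℝ) ≤ y := by
      exact_mod_cast not_lt.1 fun h' => hy ⟨h, h'⟩
    rw [max_eq_left (by linarith), max_eq_left (by linarith), max_eq_left (by linarith)]
    field_simp
    ring

theorem second_difference_max (a y : ℤ) :
    max ((y + 1 : ℤ) - a : ℝ) 0 + max ((y - 1 : ℤ) - a : ℝ) 0 - 2 * max (y - a : ℝ) 0 =
      if a = y then 1 else 0 := by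
  rcases lt_trichotomy a y with h | h | h
  · have h1 : (a : ℝ) + 1 ≤ y := by exact_mod_cast h
    rw [if_neg h.ne, max_eq_left (by push_cast; linarith), max_eq_left (by push_cast; linarith),
      max_eq_left (by linarith)]
    push_cast
    ring
  · subst h
    rw [if_pos rfl, max_eq_left (by push_cast; linarith), max_eq_right (by push_cast; linarith),
      max_eq_right (by linarith)]
    push_cast
    ring
  · have h1 : (y : ℝ) + 1 ≤ a := by exact_mod_cast h
    rw [if_neg h.ne', max_eq_right (by push_cast; linarith),
      max_eq_right (by push_cast; linarith), max_eq_right (by linarith)]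
    ring

theorem second_difference_tent (e : E) (r y : ℤ) :
    B.tent e r (y + 1) + B.tent e r (y - 1) - 2 * B.tent e r y =
      (B.row (B.hi e) - r) / (B.row (B.hi e) - B.row (B.lo e)) *
          (if B.row (B.lo e) = y then 1 else 0) +
        (r - B.row (B.lo e)) / (B.row (B.hi e) - B.row (B.lo e)) *
          (if B.row (B.hi e) = y then 1 else 0) -
        if r = y then 1 else 0 := by
  rw [← second_difference_max, ← second_difference_max, ← second_difference_max]
  unfold tent
  ring

section Realization

variable [Fintype E]

open Classical in
/-- The contribution of a unit load on an element in row `r` to the function of the connector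
`e`. -/
noncomputable def load (r : ℤ) (i : V ⊕ E) (e : E) (y : ℤ) : ℝ :=
  if i = Sum.inr e then B.tent e r y else 0

open Classical in
/-- The indicator function of the bars of row `y` to the left of `ξ`. -/
noncomputable def leftBars (ξ : ℝ) (y : ℤ) (v : V) : ℝ :=
  if B.row v = y ∧ B.rx v < ξ then 1 else 0

open Classical in
theorem cum_load (r : ℤ) (i : V ⊕ E) (ξ : ℝ) (y : ℤ) :
    B.cum (B.load r i) ξ y =
      i.elim (fun _ => 0) fun e => if B.ex e < ξ then B.tent e r y else 0 := by
  unfold cum load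
  rcases i with v | e
  · simp
  · simp [Finset.sum_ite_eq]

open Classical in
theorem second_difference_cum_load {r : ℤ} {i : V ⊕ E} {ξ : ℝ} {y : ℤ} (hi : B.Present r i)
    (hg : B.Gap ξ y) :
    B.cum (B.load r i) ξ (y + 1) + B.cum (B.load r i) ξ (y - 1) - 2 * B.cum (B.load r i) ξ y =
      B.abscissa r i (B.leftBars ξ y) - if r = y ∧ B.right i < ξ then 1 else 0 := by
  rw [cum_load, cum_load, cum_load]
  rcases i with v | e
  · have hv : B.row v = r := hi
    by_cases h : r = y ∧ B.rx v < ξ <;> simp [abscissa, leftBars, right, hv, h]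
  · have hb : ∀ v, B.lx v ≤ B.ex e → B.ex e ≤ B.rx v →
        B.leftBars ξ y v = if B.row v = y ∧ B.ex e < ξ then 1 else 0 := by
      intro v h1 h2
      unfold leftBars
      refine if_congr (and_congr_right fun hv => ⟨fun h => h2.trans_lt h, fun h => ?_⟩) rfl rfl
      exact hg v hv (h1.trans_lt h)
    simp only [Sum.elim_inr, abscissa, line, right, LinearMap.add_apply, LinearMap.smul_apply,
      LinearMap.proj_apply, smul_eq_mul, hb _ (B.lx_lo e) (B.rx_lo e),
      hb _ (B.lx_hi e) (B.rx_hi e)]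
    by_cases hξ : B.ex e < ξ
    · simpa only [hξ, and_true, if_true] using B.second_difference_tent e r y
    · simp [hξ]

/-- The vertices of a bar system can be placed at abscissae such that the straight-line drawing
has the same left-to-right order in each row. -/
theorem exists_realization [Fintype V] :
    ∃ x, B.IsRealization x := by
  classical
  let C := {c : ℤ × (V ⊕ E) × (V ⊕ E) //
    B.Present c.1 c.2.1 ∧ B.Present c.1 c.2.2 ∧ B.right c.2.1 < B.left c.2.2}
  have hpr : ∀ r i, B.Present r i → r ∈ Set.Icc B.bot B.top := by
    rintro r (v | e) h
    · exact h ▸ ⟨B.bot_le v, B.le_top v⟩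
    · exact ⟨(B.bot_le _).trans h.1.le, h.2.le.trans (B.le_top _)⟩
  have hlr : ∀ i, B.left i ≤ B.right i := by
    rintro (v | e)
    · exact B.lx_le_rx v
    · exact le_rfl
  have : Finite C := by
    refine Set.Finite.to_subtype (((Set.finite_Icc B.bot B.top).prod
      (Set.finite_univ (α := (V ⊕ E) × (V ⊕ E)))).subset ?_)
    exact fun c hc => ⟨hpr _ _ hc.1, trivial⟩
  rcases exists_forall_pos_or_exists_convex_combination_eq_zero
    (fun c : C => B.abscissa c.1.1 c.1.2.2 - B.abscissa c.1.1 c.1.2.1) with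
    ⟨x, hx⟩ | ⟨κ, hκ, w, c, hw, hw1, hsum⟩
  · exact ⟨x, fun r a b ha hb hab => sub_pos.1 (hx ⟨(r, a, b), ha, hb, hab⟩)⟩
  · exfalso
    let φ : E → ℤ → ℝ := fun e y => ∑ k, w k *
      (B.load (c k).1.1 (c k).1.2.2 e y - B.load (c k).1.1 (c k).1.2.1 e y)
    have hcum : ∀ ξ y, B.cum φ ξ y = ∑ k, w k *
        (B.cum (B.load (c k).1.1 (c k).1.2.2) ξ y - B.cum (B.load (c k).1.1 (c k).1.2.1) ξ y) := by
      intro ξ y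
      simp only [cum, φ]
      rw [Finset.sum_comm]
      refine Finset.sum_congr rfl fun k _ => ?_
      rw [← Finset.mul_sum, Finset.sum_sub_distrib]
    let sep : κ → ℝ → ℤ → ℝ := fun k ξ y =>
      (if (c k).1.1 = y ∧ B.right (c k).1.2.1 < ξ then 1 else 0) -
        if (c k).1.1 = y ∧ B.right (c k).1.2.2 < ξ then 1 else 0
    have hdiff : ∀ ξ y, B.Gap ξ y →
        B.cum φ ξ (y + 1) + B.cum φ ξ (y - 1) - 2 * B.cum φ ξ y = ∑ k, w k * sep k ξ y := by
      intro ξ y hg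
      have h0 := hsum (B.leftBars ξ y)
      rw [← sub_zero (∑ k, w k * sep k ξ y), ← neg_eq_zero.2 h0, sub_neg_eq_add,
        ← Finset.sum_add_distrib, hcum, hcum, hcum, Finset.mul_sum, ← Finset.sum_add_distrib,
        ← Finset.sum_sub_distrib]
      refine Finset.sum_congr rfl fun k _ => ?_
      have h1 := B.second_difference_cum_load (c k).2.1 hg
      have h2 := B.second_difference_cum_load (c k).2.2.1 hg
      simp only [sep, LinearMap.sub_apply]
      linear_combination w k * (h2 - h1)
    have hmono : ∀ k, B.right (c k).1.2.1 < B.right (c k).1.2.2 := fun k =>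
      (c k).2.2.2.trans_le (hlr _)
    have hsep : ∀ k ξ y, 0 ≤ sep k ξ y := by
      intro k ξ y
      simp only [sep]
      split_ifs with h1 h2 h2
      · simp
      · simp
      · exact absurd ⟨h2.1, (hmono k).trans h2.2⟩ h1
      · simp
    have hload : ∀ r i e y, B.Present r i → ¬ B.Spans e y → B.load r i e y = 0 := by
      intro r i e y hi hy
      unfold load
      split_ifs with h
      · subst h
        exact B.tent_eq_zero hi hy
      · rfl
    have hsupp : ∀ e y, ¬ B.Spans e y → φ e y = 0 := by
      intro e y hy
      refine Finset.sum_eq_zero fun k _ => ?_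
      rw [hload _ _ _ _ (c k).2.1 hy, hload _ _ _ _ (c k).2.2.1 hy]
      ring
    have hpot : B.IsPotential φ := by
      refine ⟨hsupp, fun ξ y hg => ?_, ?_⟩
      · have := hdiff ξ y hg
        have h2 : 0 ≤ ∑ k, w k * sep k ξ y :=
          Finset.sum_nonneg fun k _ => mul_nonneg (hw k) (hsep k ξ y)
        linarith
      · obtain ⟨ξ, hξ⟩ : ∃ ξ : ℝ, ∀ i, B.right i < ξ := by
          obtain ⟨M, hM⟩ := (Set.finite_range B.right).bddAbove
          exact ⟨M + 1, fun i => (hM ⟨i, rfl⟩).trans_lt (lt_add_one M)⟩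
        have htot : ∀ y, B.cum φ ξ y = ∑ e, φ e y := by
          intro y
          rw [cum, Finset.filter_true_of_mem (p := fun e => B.ex e < ξ) fun e _ => hξ (Sum.inr e)]
        have hstep : ∀ y, B.cum φ ξ (y + 1) + B.cum φ ξ (y - 1) - 2 * B.cum φ ξ y = 0 := by
          intro y
          rw [hdiff ξ y fun v _ _ => hξ (Sum.inl v)]
          refine Finset.sum_eq_zero fun k _ => ?_
          simp [sep, hξ]
        have hlow : ∀ y ≤ B.bot, B.cum φ ξ y = 0 := by
          intro y hy
          refine Finset.sum_eq_zero fun e _ => hsupp e y fun hs => ?_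
          exact absurd (hs.1.trans_le hy) (B.bot_le _).not_gt
        have hup : ∀ n : ℕ, B.cum φ ξ (B.bot + n) = 0 ∧ B.cum φ ξ (B.bot + n + 1) = 0 := by
          intro n
          induction n with
          | zero =>
            have h1 := hstep B.bot
            rw [hlow _ le_rfl, hlow (B.bot - 1) (by omega)] at h1
            refine ⟨hlow _ (by simp), ?_⟩
            simp only [Nat.cast_zero, add_zero]
            linarith
          | succ n ih =>
            have h1 := hstep (B.bot + n + 1)
            rw [add_sub_cancel_right, ih.1, ih.2] at h1
            push_cast
            rw [← add_assoc]
            exact ⟨ih.2, by linarith⟩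
        intro y
        rw [← htot]
        rcases le_total y B.bot with h | h
        · exact hlow y h
        · have := (hup (y - B.bot).toNat).1
          rwa [Int.toNat_of_nonneg (by omega), add_sub_cancel] at this
    have hzero : ∀ k, w k = 0 := by
      intro k
      have hg : B.Gap (B.left (c k).1.2.2) (c k).1.1 := by
        have := (c k).2.2.1
        rcases h : (c k).1.2.2 with v | e
        · rw [h] at this
          have hv : B.row v = (c k).1.1 := this
          rw [← hv]
          exact B.gap_lx v
        · rw [h] at this
          exact B.gap_ex this
      have h1 := hdiff _ _ hg
      rw [hpot.cum_eq_zero, hpot.cum_eq_zero, hpot.cum_eq_zero] at h1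
      have h2 := (Finset.sum_eq_zero_iff_of_nonneg fun k' _ =>
        mul_nonneg (hw k') (hsep k' _ _)).1 (by linarith [h1]) k (Finset.mem_univ k)
      simpa [sep, (c k).2.2.2, (hlr (c k).1.2.2).not_gt] using h2
    simp [hzero] at hw1

end Realization

/-- The bars `u` and `w` are consecutive in their row. -/
def Consecutive (u w : V) : Prop :=
  B.row u = B.row w ∧ B.rx u < B.lx w ∧ ∀ a, B.Present (B.row u) a →
    a = Sum.inl u ∨ a = Sum.inl w ∨ B.right a < B.lx u ∨ B.rx w < B.left a

/-- Connectors on a common vertical line have no common height in their interiors. -/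
def NoOverlap : Prop :=
  ∀ i j, B.ex i = B.ex j → ∀ y : ℝ, B.row (B.lo i) < y → y < B.row (B.hi i) →
    B.row (B.lo j) < y → y < B.row (B.hi j) → i = j

/-- The position of a vertex in the straight-line drawing with vertex abscissae `x`. -/
def point (x : V → ℝ) (v : V) : ℝ × ℝ := (x v, B.row v)

/-- The element that the connector `i`, its end-bars included, occupies in row `r` is `a`. -/
def IsAt (i : E) (r : ℤ) (a : V ⊕ E) : Prop :=
  (a = Sum.inr i ∧ B.Spans i r) ∨
    ∃ v, (v = B.lo i ∨ v = B.hi i) ∧ a = Sum.inl v ∧ B.row v = r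

variable {B}

theorem line_lo (i : E) (x : V → ℝ) : B.line i (B.row (B.lo i)) x = x (B.lo i) := by
  have := B.row_sub_row_pos i
  simp [line, this.ne']

theorem line_hi (i : E) (x : V → ℝ) : B.line i (B.row (B.hi i)) x = x (B.hi i) := by
  have := B.row_sub_row_pos i
  simp [line, this.ne']

theorem exists_isAt {i : E} {r : ℤ} (h1 : B.row (B.lo i) ≤ r) (h2 : r ≤ B.row (B.hi i)) :
    ∃ a, B.IsAt i r a := by
  rcases h1.eq_or_lt with h1 | h1
  · exact ⟨_, Or.inr ⟨_, Or.inl rfl, rfl, h1⟩⟩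
  rcases h2.eq_or_lt with h2 | h2
  · exact ⟨_, Or.inr ⟨_, Or.inr rfl, rfl, h2.symm⟩⟩
  · exact ⟨_, Or.inl ⟨rfl, h1, h2⟩⟩

theorem IsAt.present {i : E} {r : ℤ} {a : V ⊕ E} (h : B.IsAt i r a) : B.Present r a := by
  rcases h with ⟨rfl, h⟩ | ⟨v, -, rfl, h⟩ <;> exact h

theorem IsAt.abscissa_eq {i : E} {r : ℤ} {a : V ⊕ E} (h : B.IsAt i r a) (x : V → ℝ) :
    B.abscissa r a x = B.line i r x := by
  rcases h with ⟨rfl, h⟩ | ⟨v, rfl | rfl, rfl, rfl⟩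
  · rfl
  · exact (line_lo i x).symm
  · exact (line_hi i x).symm

theorem IsAt.left_le {i : E} {r : ℤ} {a : V ⊕ E} (h : B.IsAt i r a) : B.left a ≤ B.ex i := by
  rcases h with ⟨rfl, h⟩ | ⟨v, rfl | rfl, rfl, rfl⟩
  · exact le_rfl
  · exact B.lx_lo i
  · exact B.lx_hi i

theorem IsAt.le_right {i : E} {r : ℤ} {a : V ⊕ E} (h : B.IsAt i r a) : B.ex i ≤ B.right a := by
  rcases h with ⟨rfl, h⟩ | ⟨v, rfl | rfl, rfl, rfl⟩
  · exact le_rfl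
  · exact B.rx_lo i
  · exact B.rx_hi i

/-- Distinct elements of a row are separated, except for connectors on a common vertical line. -/
theorem Present.right_lt_left_or {r : ℤ} {a b : V ⊕ E} (ha : B.Present r a) (hb : B.Present r b)
    (hab : a ≠ b) : B.right a < B.left b ∨ B.right b < B.left a ∨
      ∃ i j, a = Sum.inr i ∧ b = Sum.inr j ∧ B.ex i = B.ex j := by
  rcases a with u | i <;> rcases b with v | j
  · have := B.disjoint u v (fun h => hab (h ▸ rfl)) (Eq.trans ha (Eq.symm hb))
    tauto
  · have hu : B.row u = r := ha
    subst hu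
    have := B.cross j u hb.1 hb.2
    exact this.elim (fun h => Or.inr (Or.inl h)) Or.inl
  · have hv : B.row v = r := hb
    subst hv
    have := B.cross i v ha.1 ha.2
    exact this.elim Or.inl fun h => Or.inr (Or.inl h)
  · rcases lt_trichotomy (B.ex i) (B.ex j) with h | h | h
    · exact Or.inl h
    · exact Or.inr (Or.inr ⟨i, j, rfl, rfl, h⟩)
    · exact Or.inr (Or.inl h)

namespace IsRealization

variable {x : V → ℝ} (hx : B.IsRealization x)

include hx

theorem abscissa_ne {r : ℤ} {v : V} {a : V ⊕ E} (hv : B.row v = r) (ha : B.Present r a)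
    (hva : a ≠ Sum.inl v) : B.abscissa r a x ≠ x v := by
  have hv : B.Present r (Sum.inl v) := hv
  rcases ha.right_lt_left_or hv hva with h | h | ⟨i, j, -, h, -⟩
  · exact (hx r _ _ ha hv h).ne
  · exact (hx r _ _ hv ha h).ne'
  · cases h

theorem point_injective : Function.Injective (B.point x) := by
  intro u v h
  by_contra huv
  have h2 : B.row u = B.row v := by
    have : (B.row u : ℝ) = B.row v := congrArg Prod.snd h
    exact_mod_cast this
  exact hx.abscissa_ne (a := Sum.inl u) rfl h2 (by simpa using huv) (congrArg Prod.fst h)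

theorem line_lt_line_or {i j : E} {r : ℤ} (hij : B.ex i < B.ex j)
    (h1 : B.row (B.lo i) ≤ r) (h2 : r ≤ B.row (B.hi i))
    (h3 : B.row (B.lo j) ≤ r) (h4 : r ≤ B.row (B.hi j)) :
    B.line i r x < B.line j r x ∨ B.line i r x = B.line j r x ∧
      ∃ v, (v = B.lo i ∨ v = B.hi i) ∧ (v = B.lo j ∨ v = B.hi j) ∧ B.row v = r := by
  obtain ⟨a, ha⟩ := exists_isAt h1 h2
  obtain ⟨b, hb⟩ := exists_isAt h3 h4
  rw [← ha.abscissa_eq, ← hb.abscissa_eq]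
  by_cases hab : a = b
  · subst hab
    refine Or.inr ⟨rfl, ?_⟩
    rcases ha with ⟨rfl, -⟩ | ⟨v, hv, rfl, hr⟩ <;> rcases hb with ⟨h, -⟩ | ⟨w, hw, h, -⟩
    · cases h
      exact absurd hij (lt_irrefl _)
    · cases h
    · cases h
    · cases h
      exact ⟨_, hv, hw, hr⟩
  · left
    rcases ha.present.right_lt_left_or hb.present hab with h | h | ⟨i', j', rfl, rfl, h⟩
    · exact hx _ _ _ ha.present hb.present h
    · exact absurd (hb.le_right.trans_lt (h.trans_le ha.left_le)) hij.not_gt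
    · exact absurd h (show B.ex i' < B.ex j' from ha.left_le.trans_lt (hij.trans_le hb.le_right)).ne

omit hx in
theorem mem_connector {i : E} {p : ℝ × ℝ}
    (hp : p ∈ segment ℝ (B.point x (B.lo i)) (B.point x (B.hi i))) :
    p.1 = B.line i p.2 x ∧ (B.row (B.lo i) : ℝ) ≤ p.2 ∧ p.2 ≤ B.row (B.hi i) := by
  have hpos := B.row_sub_row_pos i
  obtain ⟨s, t, hs, ht, hst, rfl⟩ := hp
  obtain rfl : s = 1 - t := by linarith
  simp only [point, line, Prod.fst_add, Prod.snd_add, Prod.smul_fst, Prod.smul_snd, smul_eq_mul,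
    LinearMap.add_apply, LinearMap.smul_apply, LinearMap.proj_apply]
  refine ⟨?_, by nlinarith, by nlinarith⟩
  field_simp
  ring

omit hx in
theorem line_interpolate (i : E) (a y b : ℝ) :
    (b - a) * B.line i y x = (b - y) * B.line i a x + (y - a) * B.line i b x := by
  have := B.row_sub_row_pos i
  simp only [line, LinearMap.add_apply, LinearMap.smul_apply, LinearMap.proj_apply, smul_eq_mul]
  field_simp
  ring

theorem line_lt_line {i j : E} (hij : B.ex i < B.ex j) {y : ℝ}
    (h1 : B.row (B.lo i) < y) (h2 : y < B.row (B.hi i))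
    (h3 : B.row (B.lo j) < y) (h4 : y < B.row (B.hi j)) :
    B.line i y x < B.line j y x := by
  obtain ⟨a, ha⟩ : ∃ a, a = max (B.row (B.lo i)) (B.row (B.lo j)) := ⟨_, rfl⟩
  obtain ⟨b, hb⟩ : ∃ b, b = min (B.row (B.hi i)) (B.row (B.hi j)) := ⟨_, rfl⟩
  have hay : (a : ℝ) < y := by
    rw [ha]
    push_cast
    exact max_lt h1 h3
  have hyb : y < b := by
    rw [hb]
    push_cast
    exact lt_min h2 h4
  have hab : a < b := by exact_mod_cast hay.trans hyb
  have hia := line_interpolate (B := B) (x := x) i a y b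
  have hja := line_interpolate (B := B) (x := x) j a y b
  have ka := hx.line_lt_line_or hij (r := a) (by omega) (by omega) (by omega) (by omega)
  have kb := hx.line_lt_line_or hij (r := b) (by omega) (by omega) (by omega) (by omega)
  have hab' : (0 : ℝ) < b - a := by linarith
  refine lt_of_mul_lt_mul_left ?_ hab'.le
  rw [hia, hja]
  rcases ka with ka | ⟨ka, v, hvi, hvj, hv⟩
  · have kb : B.line i b x ≤ B.line j b x := kb.elim le_of_lt fun h => h.1.le
    nlinarith
  rcases kb with kb | ⟨-, w, hwi, hwj, hw⟩
  · rw [ka]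
    nlinarith
  refine absurd hij ?_
  have hvi : v = B.lo i := hvi.resolve_right fun h => by subst h; omega
  have hvj : v = B.lo j := hvj.resolve_right fun h => by subst h; omega
  have hwi : w = B.hi i := hwi.resolve_left fun h => by subst h; omega
  have hwj : w = B.hi j := hwj.resolve_left fun h => by subst h; omega
  rw [B.simple i j (hvi.symm.trans hvj) (hwi.symm.trans hwj)]
  exact lt_irrefl _

omit hx in
theorem eq_point {p : ℝ × ℝ} {v : V} (h1 : p.1 = x v) (h2 : p.2 = B.row v) :
    p = B.point x v :=
  Prod.ext h1 h2

theorem isAt_inl {i : E} {v : V}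
    (hp : B.point x v ∈ segment ℝ (B.point x (B.lo i)) (B.point x (B.hi i))) :
    v = B.lo i ∨ v = B.hi i := by
  obtain ⟨h1, h2, h3⟩ := mem_connector hp
  have h2 : (B.row (B.lo i) : ℝ) ≤ B.row v := h2
  have h3 : (B.row v : ℝ) ≤ B.row (B.hi i) := h3
  obtain ⟨a, ha⟩ := exists_isAt (i := i) (r := B.row v) (by exact_mod_cast h2)
    (by exact_mod_cast h3)
  have hav : a = Sum.inl v := by
    by_contra hav
    exact hx.abscissa_ne rfl ha.present hav ((ha.abscissa_eq x).trans h1.symm)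
  rcases ha with ⟨rfl, -⟩ | ⟨w, hw, rfl, -⟩
  · cases hav
  · cases hav
    exact hw

theorem eq_or_eq_point_of_connectors (hB : B.NoOverlap) {i j : E} {p : ℝ × ℝ}
    (hi : p ∈ segment ℝ (B.point x (B.lo i)) (B.point x (B.hi i)))
    (hj : p ∈ segment ℝ (B.point x (B.lo j)) (B.point x (B.hi j))) :
    i = j ∨ (∃ v, (v = B.lo i ∨ v = B.hi i) ∧ p = B.point x v) ∨
      ∃ v, (v = B.lo j ∨ v = B.hi j) ∧ p = B.point x v := by
  have key : ∀ {k : E}, p ∈ segment ℝ (B.point x (B.lo k)) (B.point x (B.hi k)) →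
      (∃ v, (v = B.lo k ∨ v = B.hi k) ∧ p = B.point x v) ∨
        (B.row (B.lo k) < p.2 ∧ p.2 < B.row (B.hi k)) := by
    intro k hk
    obtain ⟨h1, h2, h3⟩ := mem_connector hk
    rcases h2.eq_or_lt with h2 | h2
    · rw [← h2, line_lo] at h1
      exact Or.inl ⟨_, Or.inl rfl, eq_point h1 h2.symm⟩
    rcases h3.eq_or_lt with h3 | h3
    · rw [h3, line_hi] at h1
      exact Or.inl ⟨_, Or.inr rfl, eq_point h1 h3⟩
    exact Or.inr ⟨h2, h3⟩
  rcases key hi with h | ⟨h1, h2⟩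
  · exact Or.inr (Or.inl h)
  rcases key hj with h | ⟨h3, h4⟩
  · exact Or.inr (Or.inr h)
  have hpi := (mem_connector hi).1
  have hpj := (mem_connector hj).1
  rcases lt_trichotomy (B.ex i) (B.ex j) with h | h | h
  · exact absurd (hpi.symm.trans hpj) (hx.line_lt_line h h1 h2 h3 h4).ne
  · exact Or.inl (hB i j h _ h1 h2 h3 h4)
  · exact absurd (hpi.symm.trans hpj) (hx.line_lt_line h h3 h4 h1 h2).ne'

omit hx in
theorem mem_horizontal {u w : V} (huw : B.row u = B.row w) (hlt : x u ≤ x w) {p : ℝ × ℝ}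
    (hp : p ∈ segment ℝ (B.point x u) (B.point x w)) :
    p.2 = B.row u ∧ x u ≤ p.1 ∧ p.1 ≤ x w := by
  obtain ⟨s, t, hs, ht, hst, rfl⟩ := hp
  obtain rfl : s = 1 - t := by linarith
  simp only [point, Prod.fst_add, Prod.snd_add, Prod.smul_fst, Prod.smul_snd, smul_eq_mul, ← huw]
  exact ⟨by ring, by nlinarith, by nlinarith⟩

theorem lt_of_consecutive {u w : V} (h : B.Consecutive u w) : x u < x w :=
  hx _ (Sum.inl u) (Sum.inl w) rfl h.1.symm h.2.1

theorem abscissa_of_consecutive {u w : V} (h : B.Consecutive u w) {a : V ⊕ E}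
    (ha : B.Present (B.row u) a) :
    a = Sum.inl u ∨ a = Sum.inl w ∨ B.abscissa (B.row u) a x < x u ∨
      x w < B.abscissa (B.row u) a x := by
  refine (h.2.2 a ha).imp_right (Or.imp_right (Or.imp (fun h' => ?_) fun h' => ?_))
  · exact hx _ _ (Sum.inl u) ha rfl h'
  · exact hx _ (Sum.inl w) _ h.1.symm ha h'

theorem eq_or_eq_of_consecutive {u w v : V} (h : B.Consecutive u w)
    (hp : B.point x v ∈ segment ℝ (B.point x u) (B.point x w)) : v = u ∨ v = w := by
  obtain ⟨h1, h2, h3⟩ := mem_horizontal h.1 (hx.lt_of_consecutive h).le hp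
  have h1 : (B.row v : ℝ) = B.row u := h1
  rcases hx.abscissa_of_consecutive h (a := Sum.inl v) (by exact_mod_cast h1) with h | h | h | h
  · exact Or.inl (Sum.inl_injective h)
  · exact Or.inr (Sum.inl_injective h)
  · exact absurd h h2.not_gt
  · exact absurd h h3.not_gt

theorem eq_point_of_consecutive_of_connector {u w : V} {i : E} {p : ℝ × ℝ}
    (h : B.Consecutive u w) (hp : p ∈ segment ℝ (B.point x u) (B.point x w))
    (hi : p ∈ segment ℝ (B.point x (B.lo i)) (B.point x (B.hi i))) :
    ∃ v, (v = B.lo i ∨ v = B.hi i) ∧ p = B.point x v := by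
  obtain ⟨h1, h2, h3⟩ := mem_horizontal h.1 (hx.lt_of_consecutive h).le hp
  obtain ⟨h4, h5, h6⟩ := mem_connector hi
  rw [h1] at h4 h5 h6
  obtain ⟨a, ha⟩ := exists_isAt (i := i) (r := B.row u) (by exact_mod_cast h5)
    (by exact_mod_cast h6)
  have hap := (ha.abscissa_eq x).trans h4.symm
  have := hx.abscissa_of_consecutive h ha.present
  rw [hap] at this
  rcases ha with ⟨rfl, -⟩ | ⟨v, hv, rfl, hr⟩
  · rcases this with h | h | h | h
    · cases h
    · cases h
    · exact absurd h h2.not_gt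
    · exact absurd h h3.not_gt
  · exact ⟨v, hv, eq_point hap.symm (by rw [h1, hr])⟩

theorem eq_or_eq_point_of_consecutive {u w u' w' : V} {p : ℝ × ℝ}
    (h : B.Consecutive u w) (hp : p ∈ segment ℝ (B.point x u) (B.point x w))
    (h' : B.Consecutive u' w') (hp' : p ∈ segment ℝ (B.point x u') (B.point x w')) :
    (u = u' ∧ w = w') ∨ (∃ v, (v = u ∨ v = w) ∧ p = B.point x v) ∨
      ∃ v, (v = u' ∨ v = w') ∧ p = B.point x v := by
  obtain ⟨h1, h2, h3⟩ := mem_horizontal h.1 (hx.lt_of_consecutive h).le hp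
  obtain ⟨h1', h2', h3'⟩ := mem_horizontal h'.1 (hx.lt_of_consecutive h').le hp'
  rcases h2.eq_or_lt with h2 | h2
  · exact Or.inr (Or.inl ⟨u, Or.inl rfl, eq_point h2.symm h1⟩)
  rcases h3.eq_or_lt with h3 | h3
  · exact Or.inr (Or.inl ⟨w, Or.inr rfl, eq_point h3 (h.1 ▸ h1)⟩)
  rcases h2'.eq_or_lt with h2' | h2'
  · exact Or.inr (Or.inr ⟨u', Or.inl rfl, eq_point h2'.symm h1'⟩)
  rcases h3'.eq_or_lt with h3' | h3'
  · exact Or.inr (Or.inr ⟨w', Or.inr rfl, eq_point h3' (h'.1 ▸ h1')⟩)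
  have hr : B.row u = B.row u' := by exact_mod_cast h1.symm.trans h1'
  have k1 := hx.abscissa_of_consecutive h (a := Sum.inl u') hr.symm
  have k2 := hx.abscissa_of_consecutive h (a := Sum.inl w') (h'.1.symm.trans hr.symm)
  have k3 := hx.abscissa_of_consecutive h' (a := Sum.inl u) hr
  have k4 := hx.abscissa_of_consecutive h' (a := Sum.inl w) (h.1.symm.trans hr)
  simp only [abscissa, LinearMap.proj_apply, Sum.inl.injEq] at k1 k2 k3 k4
  left
  constructor
  · rcases k1 with k | k | k | k
    · exact k.symm
    · subst k; linarith
    · rcases k3 with l | l | l | l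
      · exact l
      · subst l; linarith
      · linarith
      · linarith
    · linarith
  · rcases k2 with k | k | k | k
    · subst k; linarith
    · exact k.symm
    · linarith
    · rcases k4 with l | l | l | l
      · subst l; linarith
      · exact l
      · linarith
      · linarith

end IsRealization

/-- A realization of a bar system is a planar straight-line drawing of every graph whose edges
are connectors or join consecutive bars. -/
theorem IsRealization.isPlanar {x : V → ℝ} (hx : B.IsRealization x) (hB : B.NoOverlap)
    {G : SimpleGraph V}
    (hG : ∀ e ∈ G.edgeSet, (∃ i, e = s(B.lo i, B.hi i)) ∨ ∃ u w, B.Consecutive u w ∧ e = s(u, w)) :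
    (StraightDrawing.mk (G := G) (B.point x) hx.point_injective).IsPlanar := by
  have hvert : ∀ v : V, ∀ e ∈ G.edgeSet, v ∉ e → B.point x v ∉
      (StraightDrawing.mk (G := G) (B.point x) hx.point_injective).edgePts e := by
    intro v e he hve hv
    rcases hG e he with ⟨i, rfl⟩ | ⟨u, w, huw, rfl⟩
    · exact hve (Sym2.mem_iff.2 (hx.isAt_inl hv))
    · exact hve (Sym2.mem_iff.2 (hx.eq_or_eq_of_consecutive huw hv))
  refine ⟨hvert, fun e he f hf hef p ⟨hpe, hpf⟩ => ?_⟩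
  have key : e = f ∨ (∃ v, v ∈ e ∧ p = B.point x v) ∨ ∃ v, v ∈ f ∧ p = B.point x v := by
    rcases hG e he with ⟨i, rfl⟩ | ⟨u, w, huw, rfl⟩ <;>
      rcases hG f hf with ⟨j, rfl⟩ | ⟨u', w', huw', rfl⟩ <;> simp only [Sym2.mem_iff]
    · exact (hx.eq_or_eq_point_of_connectors hB (i := i) (j := j) hpe hpf).imp_left
        fun h => by rw [h]
    · exact Or.inr (Or.inl (hx.eq_point_of_consecutive_of_connector huw' hpf hpe))
    · exact Or.inr (Or.inr (hx.eq_point_of_consecutive_of_connector huw hpe hpf))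
    · exact (hx.eq_or_eq_point_of_consecutive huw hpe huw' hpf).imp_left
        fun h => by rw [h.1, h.2]
  rcases key with h | ⟨v, hv, rfl⟩ | ⟨v, hv, rfl⟩
  · exact absurd h hef
  · exact ⟨v, hv, by_contra fun h => hvert v f hf h hpf, rfl⟩
  · exact ⟨v, by_contra fun h => hvert v e he h hpe, hv, rfl⟩

end BarSystem

theorem mem_segment_iff_of_snd_eq {a b c : ℝ} {p : Pt} :
    p ∈ segment ℝ ((a, c) : Pt) (b, c) ↔ p.1 ∈ uIcc a b ∧ p.2 = c := by
  rw [← Prod.image_mk_segment_left, segment_eq_uIcc]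
  constructor
  · rintro ⟨t, ht, rfl⟩
    exact ⟨ht, rfl⟩
  · rintro ⟨h, rfl⟩
    exact ⟨p.1, h, rfl⟩

theorem mem_segment_iff_of_fst_eq {a b c : ℝ} {p : Pt} :
    p ∈ segment ℝ ((c, a) : Pt) (c, b) ↔ p.2 ∈ uIcc a b ∧ p.1 = c := by
  rw [← Prod.image_mk_segment_right, segment_eq_uIcc]
  constructor
  · rintro ⟨t, ht, rfl⟩
    exact ⟨ht, rfl⟩
  · rintro ⟨h, rfl⟩
    exact ⟨p.2, h, rfl⟩

namespace IsFlatVisRep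

variable {V : Type} {G : SimpleGraph V} {D : VisData V} {h : ℕ} (hD : IsFlatVisRep G D h)

include hD

theorem mem_vseg {v : V} {p : Pt} :
    p ∈ D.vseg v ↔ D.lx v ≤ p.1 ∧ p.1 ≤ D.rx v ∧ p.2 = D.ly v := by
  rw [VisData.vseg, mem_segment_iff_of_snd_eq, uIcc_of_le (hD.1 v), mem_Icc, and_assoc]

theorem exists_ends_s15 {u v : V} (huv : G.Adj u v) :
    ∃ P ∈ D.vseg u, ∃ Q ∈ D.vseg v, (P.1 = Q.1 ∨ P.2 = Q.2) ∧
      D.eseg s(u, v) = segment ℝ P Q ∧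
      ∀ p, p = D.ep1 s(u, v) ∨ p = D.ep2 s(u, v) ↔ p = P ∨ p = Q := by
  have h1 := hD.2.2.1 s(u, v) huv
  rcases hD.2.2.2.2.1 u v huv with h2 | h2
  · exact ⟨_, h2.1, _, h2.2, h1, rfl, fun p => Iff.rfl⟩
  · exact ⟨_, h2.2, _, h2.1, h1.imp Eq.symm Eq.symm, segment_symm ℝ _ _, fun p => or_comm⟩

theorem eq_end_of_mem_vseg {e : Sym2 V} (he : e ∈ G.edgeSet) {w : V} {p : Pt} (h1 : p ∈ D.eseg e)
    (h2 : p ∈ D.vseg w) : p = D.ep1 e ∨ p = D.ep2 e :=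
  hD.2.2.2.2.2.2.1 e he w p ⟨h1, h2⟩

theorem eq_end_of_mem_eseg {e f : Sym2 V} (he : e ∈ G.edgeSet) (hf : f ∈ G.edgeSet) (hef : e ≠ f)
    {p : Pt} (h1 : p ∈ D.eseg e) (h2 : p ∈ D.eseg f) : p = D.ep1 e ∨ p = D.ep2 e :=
  (hD.2.2.2.2.2.2.2 e he f hf hef p ⟨h1, h2⟩).1

theorem eq_of_mem_vseg {u v : V} {p : Pt} (h1 : p ∈ D.vseg u) (h2 : p ∈ D.vseg v) : u = v :=
  by_contra fun huv => Set.disjoint_left.1 (hD.2.2.2.2.2.1 u v huv) h1 h2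

theorem rx_lt_lx_or {u v : V} (huv : u ≠ v) (hy : D.ly u = D.ly v) :
    D.rx u < D.lx v ∨ D.rx v < D.lx u := by
  by_contra! hlt
  refine huv (hD.eq_of_mem_vseg (p := (max (D.lx u) (D.lx v), D.ly u)) (hD.mem_vseg.2 ?_)
    (hD.mem_vseg.2 ?_))
  · exact ⟨le_max_left _ _, max_le (hD.1 u) hlt.1, rfl⟩
  · exact ⟨le_max_right _ _, max_le hlt.2 (hD.1 v), hy⟩

/-- An edge between bars of different heights is drawn vertically. -/
theorem exists_vertical {u w : V} (huw : G.Adj u w) (hlt : D.ly u < D.ly w) :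
    ∃ ξ, (D.lx u ≤ ξ ∧ ξ ≤ D.rx u) ∧ (D.lx w ≤ ξ ∧ ξ ≤ D.rx w) ∧
      (∀ y, D.ly u ≤ y → y ≤ D.ly w → (ξ, y) ∈ D.eseg s(u, w)) ∧
      ∀ p, p = D.ep1 s(u, w) ∨ p = D.ep2 s(u, w) → p.2 = D.ly u ∨ p.2 = D.ly w := by
  obtain ⟨P, hP, Q, hQ, hPQ, hseg, hends⟩ := hD.exists_ends_s15 huw
  rw [hD.mem_vseg] at hP hQ
  have hx : P.1 = Q.1 := hPQ.resolve_right fun h => by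
    rw [hP.2.2, hQ.2.2] at h
    exact hlt.ne h
  refine ⟨P.1, ⟨hP.1, hP.2.1⟩, ⟨hx ▸ hQ.1, hx ▸ hQ.2.1⟩, fun y h1 h2 => ?_, fun p hp => ?_⟩
  · rw [hseg, show P = (P.1, D.ly u) from Prod.ext rfl hP.2.2,
      show Q = (P.1, D.ly w) from Prod.ext hx.symm hQ.2.2, mem_segment_iff_of_fst_eq]
    exact ⟨mem_uIcc_of_le h1 h2, rfl⟩
  · rcases (hends p).1 hp with rfl | rfl
    · exact Or.inl hP.2.2
    · exact Or.inr hQ.2.2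

/-- An edge between bars of the same height bridges the gap between the two bars. -/
theorem exists_horizontal {u w : V} (huw : G.Adj u w) (hy : D.ly u = D.ly w) :
    (∀ t, D.rx u ≤ t → t ≤ D.lx w → (t, D.ly u) ∈ D.eseg s(u, w)) ∧
      ∀ p, p = D.ep1 s(u, w) ∨ p = D.ep2 s(u, w) → p ∈ D.vseg u ∨ p ∈ D.vseg w := by
  obtain ⟨P, hP, Q, hQ, -, hseg, hends⟩ := hD.exists_ends_s15 huw
  refine ⟨fun t h1 h2 => ?_, fun p hp => ?_⟩
  · rw [hD.mem_vseg] at hP hQ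
    rw [hseg, show P = (P.1, D.ly u) from Prod.ext rfl hP.2.2,
      show Q = (Q.1, D.ly u) from Prod.ext rfl (hQ.2.2.trans hy.symm), mem_segment_iff_of_snd_eq]
    exact ⟨mem_uIcc_of_le (hP.2.1.trans h1) (h2.trans hQ.1), rfl⟩
  · rcases (hends p).1 hp with rfl | rfl
    · exact Or.inl hP
    · exact Or.inr hQ

theorem lt_or_lt_of_vertical_of_bar {u w v : V} {ξ : ℝ} (huw : G.Adj u w)
    (hseg : ∀ y, D.ly u ≤ y → y ≤ D.ly w → (ξ, y) ∈ D.eseg s(u, w))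
    (hends : ∀ p, p = D.ep1 s(u, w) ∨ p = D.ep2 s(u, w) → p.2 = D.ly u ∨ p.2 = D.ly w)
    (h1 : D.ly u < D.ly v) (h2 : D.ly v < D.ly w) : ξ < D.lx v ∨ D.rx v < ξ := by
  by_contra! hv
  rcases hends _ (hD.eq_end_of_mem_vseg huw (hseg _ h1.le h2.le)
    (hD.mem_vseg.2 ⟨hv.1, hv.2, rfl⟩)) with h | h
  · exact h1.ne' h
  · exact h2.ne h

/-- Every flat visibility representation gives a bar system whose connectors are the vertical
edges. -/
theorem exists_barSystem :
    ∃ (E : Type) (_ : Finite V → Finite E) (B : BarSystem V E), (∀ v, (B.row v : ℝ) = D.ly v) ∧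
      B.NoOverlap ∧ ∀ e ∈ G.edgeSet,
        (∃ i, e = s(B.lo i, B.hi i)) ∨ ∃ u w, B.Consecutive u w ∧ e = s(u, w) := by
  choose k hk1 hkh hk using hD.2.1
  have hlt : ∀ {u v}, k u < k v ↔ D.ly u < D.ly v := by
    intro u v
    rw [hk, hk, Int.cast_lt]
  have heq : ∀ {u v}, k u = k v ↔ D.ly u = D.ly v := by
    intro u v
    rw [hk, hk, Int.cast_inj]
  choose ξ hξ1 hξ2 hseg hends using fun i : {p : V × V // G.Adj p.1 p.2 ∧ k p.1 < k p.2} =>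
    hD.exists_vertical i.2.1 (hlt.1 i.2.2)
  let B : BarSystem V {p : V × V // G.Adj p.1 p.2 ∧ k p.1 < k p.2} :=
    { row := k
      lx := D.lx
      rx := D.rx
      lo := fun i => i.1.1
      hi := fun i => i.1.2
      ex := ξ
      bot := 1
      top := h
      bot_le := hk1
      le_top := hkh
      lx_le_rx := hD.1
      disjoint := fun u v huv h => hD.rx_lt_lx_or huv (heq.1 h)
      row_lt := fun i => i.2.2
      lx_lo := fun i => (hξ1 i).1
      rx_lo := fun i => (hξ1 i).2
      lx_hi := fun i => (hξ2 i).1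
      rx_hi := fun i => (hξ2 i).2
      cross := fun i v h1 h2 =>
        hD.lt_or_lt_of_vertical_of_bar i.2.1 (hseg i) (hends i) (hlt.1 h1) (hlt.1 h2)
      simple := fun i j h1 h2 => Subtype.ext (Prod.ext h1 h2) }
  have hcons : ∀ u w, G.Adj u w → k u = k w → D.rx u < D.lx w → B.Consecutive u w := by
    intro u w huw hy hux
    obtain ⟨hs, he⟩ := hD.exists_horizontal huw (heq.1 hy)
    refine ⟨hy, hux, ?_⟩
    rintro (v | i) ha
    · have hv : k v = k u := ha
      by_cases hvu : v = u
      · exact Or.inl (hvu ▸ rfl)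
      by_cases hvw : v = w
      · exact Or.inr (Or.inl (hvw ▸ rfl))
      refine Or.inr (Or.inr ?_)
      rcases hD.rx_lt_lx_or hvu (heq.1 hv) with h1 | h1
      · exact Or.inl h1
      rcases hD.rx_lt_lx_or hvw (heq.1 (hv.trans hy)) with h2 | h2
      · have hp : (D.lx v, D.ly u) ∈ D.vseg v :=
          hD.mem_vseg.2 ⟨le_rfl, hD.1 v, (heq.1 hv).symm⟩
        rcases he _ (hD.eq_end_of_mem_vseg huw
          (hs _ h1.le ((hD.1 v).trans h2.le)) hp) with h3 | h3
        · exact absurd (hD.eq_of_mem_vseg hp h3) hvu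
        · exact absurd (hD.eq_of_mem_vseg hp h3) hvw
      · exact Or.inr h2
    · have h1 : D.ly i.1.1 < D.ly u := hlt.1 ha.1
      have h2 : D.ly u < D.ly i.1.2 := hlt.1 ha.2
      refine Or.inr (Or.inr ?_)
      rcases B.cross i u ha.1 ha.2 with h3 | h3
      · exact Or.inl h3
      rcases B.cross i w (ha.1.trans_eq hy) (hy.symm.trans_lt ha.2) with h4 | h4
      · have hne : s(i.1.1, i.1.2) ≠ s(u, w) := by
          intro h
          rcases Sym2.eq_iff.1 h with h | h
          · exact h1.ne (h.1 ▸ rfl)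
          · exact h2.ne' (h.2 ▸ rfl)
        rcases hends i _ (hD.eq_end_of_mem_eseg i.2.1 huw hne (hseg i _ h1.le h2.le)
          (hs _ h3.le h4.le)) with h | h
        · exact absurd h h1.ne'
        · exact absurd h h2.ne
      · exact Or.inr h4
  refine ⟨_, fun _ => inferInstance, B, fun v => (hk v).symm, ?_, ?_⟩
  · intro i j hij y h1 h2 h3 h4
    have h1 : D.ly i.1.1 < y := (hk _).trans_lt h1
    have h2 : y < D.ly i.1.2 := h2.trans_eq (hk _).symm
    have h3 : D.ly j.1.1 < y := (hk _).trans_lt h3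
    have h4 : y < D.ly j.1.2 := h4.trans_eq (hk _).symm
    have hij : ξ i = ξ j := hij
    by_contra hne
    have hne' : s(i.1.1, i.1.2) ≠ s(j.1.1, j.1.2) := by
      intro h
      rcases Sym2.eq_iff.1 h with h | h
      · exact hne (Subtype.ext (Prod.ext h.1 h.2))
      · rw [h.1] at h1
        rw [h.2] at h2
        linarith
    rcases hends i _ (hD.eq_end_of_mem_eseg i.2.1 j.2.1 hne' (hseg i y h1.le h2.le)
      (hij ▸ hseg j y h3.le h4.le)) with h | h
    · exact h1.ne' h
    · exact h2.ne h
  · intro e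
    induction e with
    | h u w =>
      intro huw
      have huw : G.Adj u w := huw
      rcases lt_trichotomy (k u) (k w) with h | h | h
      · exact Or.inl ⟨⟨(u, w), huw, h⟩, rfl⟩
      · rcases hD.rx_lt_lx_or huw.ne (heq.1 h) with h' | h'
        · exact Or.inr ⟨u, w, hcons u w huw h h', rfl⟩
        · exact Or.inr ⟨w, u, hcons w u huw.symm h.symm h', Sym2.eq_swap⟩
      · exact Or.inl ⟨⟨(w, u), huw.symm, h⟩, Sym2.eq_swap⟩

end IsFlatVisRep

/-- For every planar flat visibility representation (of some height
`h`) of a simple graph there is a planar straight-line drawing in which every vertex's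
`y`-coordinate equals that of its segment in the representation. -/
theorem stmt15 {V : Type} [Fintype V] (G : SimpleGraph V) (h : ℕ)
    (D : VisData V) (hD : IsFlatVisRep G D h) :
    ∃ Γ : StraightDrawing G, Γ.IsPlanar ∧ ∀ v : V, (Γ.pos v).2 = D.ly v := by
  obtain ⟨E, hE, B, hrow, hB, hG⟩ := hD.exists_barSystem
  have := hE inferInstance
  have := Fintype.ofFinite E
  obtain ⟨x, hx⟩ := B.exists_realization
  exact ⟨⟨B.point x, hx.point_injective⟩, hx.isPlanar hB hG, hrow⟩
end
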